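/- arXiv:1910.02645 — 3 statements merged into one kernel-verified Lean document; each statement's English description precedes it below -/
import Mathlib

section
/- Let α > 1, c ∈ ℝ, and f ∈ 𝒮(ℝ²) with (∂^k f/∂x^k)(c,y) = 0 for k = 0,…,m. Define F_α(ξ,η) = f(sgn(ξ)|ξ|^{1/α} + c, η)/(α|ξ|^{(α-1)/α}) for ξ ≠ 0. Fix s, u ∈ ℝ. If m > α - 2, then F_α(ξ, sξ + u) → 0 as ξ → 0± . If m = α - 2, then F_α(ξ, sξ + u) → (±1)^{m+1}/(m+2)! · (∂^{m+1} f/∂x^{m+1})(c, u) as ξ → 0±. -/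
open Filter

open scoped LineDeriv

/-- The `x`-derivatives of the slices of a Schwartz function on the plane are again slices of a
Schwartz function. -/
theorem SchwartzMap.iteratedDeriv_slice_eq (f : SchwartzMap (ℝ × ℝ) ℝ) (n : ℕ) (y : ℝ) :
    iteratedDeriv n (fun x : ℝ => f (x, y)) =
      fun x => (∂_{((1, 0) : ℝ × ℝ)}^[n] f) (x, y) := by
  induction n with
  | zero => simp
  | succ n ih =>
    funext x
    rw [iteratedDeriv_succ, ih, Function.iterate_succ_apply',
      SchwartzMap.lineDerivOp_apply_eq_fderiv]
    exact ((SchwartzMap.differentiableAt _).hasFDerivAt.comp_hasDerivAt x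
      ((hasDerivAt_id x).prodMk (hasDerivAt_const x y))).deriv

/-- Taylor's formula with Lagrange remainder when all lower derivatives vanish. -/
theorem exists_eq_iteratedDeriv_mul_pow_div_factorial {g : ℝ → ℝ} {c : ℝ} {m : ℕ}
    (hg : ContDiff ℝ (m + 1) g) (hvan : ∀ k ≤ m, iteratedDeriv k g c = 0) (t : ℝ) :
    ∃ θ, |θ - c| ≤ |t| ∧
      g (t + c) = iteratedDeriv (m + 1) g θ * t ^ (m + 1) / ((m + 1).factorial : ℝ) := by
  rcases eq_or_ne t 0 with rfl | ht
  · have h₀ := hvan 0 m.zero_le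
    rw [iteratedDeriv_zero] at h₀
    exact ⟨c, by simp, by simp [h₀]⟩
  have hne : c ≠ t + c := by simpa using ht
  obtain ⟨θ, hθ, h⟩ := taylor_mean_remainder_lagrange_iteratedDeriv hne hg.contDiffOn
  have htaylor : taylorWithinEval g m (Set.uIcc c (t + c)) c (t + c) = 0 := by
    rw [taylor_within_apply]
    refine Finset.sum_eq_zero fun k hk => ?_
    have hk : k ≤ m := Nat.lt_succ_iff.mp (Finset.mem_range.mp hk)
    rw [iteratedDerivWithin_eq_iteratedDeriv (uniqueDiffOn_uIcc hne)
      (hg.contDiffAt.of_le (by exact_mod_cast hk.trans m.le_succ)) Set.left_mem_uIcc,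
      hvan k hk, smul_zero]
  refine ⟨θ, ?_, by simpa [htaylor] using h⟩
  simpa using Set.abs_sub_left_of_mem_uIcc (Set.uIoo_subset_uIcc_self hθ)

theorem SchwartzMap.tendsto_slice_div_pow {ι : Type*} {l : Filter ι} {c u : ℝ} {m : ℕ}
    (f : SchwartzMap (ℝ × ℝ) ℝ)
    (hvan : ∀ k ≤ m, ∀ y : ℝ, iteratedDeriv k (fun x : ℝ => f (x, y)) c = 0)
    {t y : ι → ℝ} (ht : Tendsto t l (nhds 0)) (ht₀ : ∀ᶠ i in l, t i ≠ 0)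
    (hy : Tendsto y l (nhds u)) :
    Tendsto (fun i => f (t i + c, y i) / t i ^ (m + 1)) l
      (nhds (iteratedDeriv (m + 1) (fun x : ℝ => f (x, u)) c / ((m + 1).factorial : ℝ))) := by
  have hsmooth (v : ℝ) : ContDiff ℝ (m + 1) fun x : ℝ => f (x, v) :=
    (f.smooth (m + 1)).comp (contDiff_id.prodMk contDiff_const)
  choose θ hθ hfθ using fun i =>
    exists_eq_iteratedDeriv_mul_pow_div_factorial (hsmooth (y i))
      (fun k hk => hvan k hk (y i)) (t i)
  have hθc : Tendsto θ l (nhds c) := by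
    rw [tendsto_iff_dist_tendsto_zero]
    refine squeeze_zero (fun _ => dist_nonneg) (fun i => (Real.dist_eq _ _).trans_le (hθ i)) ?_
    simpa using ht.abs
  have hlim := (((∂_{((1, 0) : ℝ × ℝ)}^[m + 1] f).continuous.tendsto (c, u)).comp
    (hθc.prodMk_nhds hy)).div_const ((m + 1).factorial : ℝ)
  rw [f.iteratedDeriv_slice_eq]
  refine hlim.congr' ?_
  filter_upwards [ht₀] with i hi
  rw [hfθ, f.iteratedDeriv_slice_eq]
  simp only [Function.comp_apply]
  field_simp

/-- The limit of `F_α(ξ, sξ + u)` along a filter on which `ξ` has constant sign `σ` and the excess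
power of `|ξ|` tends to `L`. -/
theorem SchwartzMap.tendsto_rpow_slice_div {α c s u σ L : ℝ} (hα : 0 < α) {m : ℕ}
    (f : SchwartzMap (ℝ × ℝ) ℝ)
    (hvan : ∀ k ≤ m, ∀ y : ℝ, iteratedDeriv k (fun x : ℝ => f (x, y)) c = 0)
    {l : Filter ℝ} (hl : l ≤ nhds 0) (hl₀ : ∀ᶠ ξ in l, ξ ≠ 0)
    (hσ : ∀ᶠ ξ in l, Real.sign ξ = σ)
    (hL : Tendsto (fun ξ : ℝ => |ξ| ^ ((m + 2 - α) / α)) l (nhds L)) :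
    Tendsto (fun ξ : ℝ => f (Real.sign ξ * |ξ| ^ (1 / α) + c, s * ξ + u) /
        (α * |ξ| ^ ((α - 1) / α))) l
      (nhds (iteratedDeriv (m + 1) (fun x : ℝ => f (x, u)) c / ((m + 1).factorial : ℝ) *
        (σ ^ (m + 1) * L / α))) := by
  have hpow : Tendsto (fun ξ : ℝ => |ξ| ^ (1 / α)) l (nhds 0) := by
    have h : Tendsto (fun ξ : ℝ => |ξ| ^ (1 / α)) (nhds 0) (nhds (|0| ^ (1 / α))) :=
      (continuous_abs.tendsto 0).rpow_const (Or.inr (by positivity))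
    rw [abs_zero, Real.zero_rpow (by positivity)] at h
    exact h.mono_left hl
  have ht : Tendsto (fun ξ : ℝ => Real.sign ξ * |ξ| ^ (1 / α)) l (nhds 0) := by
    have h := hpow.const_mul σ
    rw [mul_zero] at h
    refine h.congr' ?_
    filter_upwards [hσ] with ξ hξ
    rw [hξ]
  have ht₀ : ∀ᶠ ξ in l, Real.sign ξ * |ξ| ^ (1 / α) ≠ 0 := by
    filter_upwards [hl₀] with ξ hξ
    exact mul_ne_zero (by simpa [Real.sign_eq_zero_iff] using hξ)
      (Real.rpow_pos_of_pos (abs_pos.mpr hξ) _).ne'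
  have hy : Tendsto (fun ξ : ℝ => s * ξ + u) l (nhds u) := by
    have h : Tendsto (fun ξ : ℝ => s * ξ + u) (nhds 0) (nhds (s * 0 + u)) :=
      Continuous.tendsto (by fun_prop) 0
    rw [mul_zero, zero_add] at h
    exact h.mono_left hl
  refine ((f.tendsto_slice_div_pow hvan ht ht₀ hy).mul
    ((hL.const_mul (σ ^ (m + 1))).div_const α)).congr' ?_
  filter_upwards [hl₀, hσ, ht₀] with ξ hξ hξσ hξt
  have hpos : 0 < |ξ| := abs_pos.mpr hξ
  have hexp : |ξ| ^ ((m + 2 - α) / α) * |ξ| ^ ((α - 1) / α) = (|ξ| ^ (1 / α)) ^ (m + 1) := by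
    rw [← Real.rpow_add hpos, ← Real.rpow_natCast, ← Real.rpow_mul hpos.le]
    congr 1
    push_cast
    field_simp
    ring
  have hden : |ξ| ^ ((α - 1) / α) ≠ 0 := (Real.rpow_pos_of_pos hpos _).ne'
  rw [div_mul_div_comm, div_eq_div_iff (mul_ne_zero (pow_ne_zero _ hξt) hα.ne')
    (mul_ne_zero hα.ne' hden), mul_pow, ← hexp, hξσ]
  ring



/-- One-sided limits of `F_α(ξ, sξ + u)` as `ξ → 0±`. -/
theorem Falpha_limits (α c s u : ℝ) (hα : 1 < α) (m : ℕ) (hm : (m : ℝ) ≥ α - 2)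
    (f : SchwartzMap (ℝ × ℝ) ℝ)
    (hvan : ∀ k ≤ m, ∀ y : ℝ, iteratedDeriv k (fun x : ℝ => f (x, y)) c = 0)
    (F : ℝ → ℝ → ℝ)
    (hF : ∀ ξ : ℝ, ξ ≠ 0 → ∀ η : ℝ,
      F ξ η = f (Real.sign ξ * |ξ| ^ (1 / α) + c, η) / (α * |ξ| ^ ((α - 1) / α))) :
    ((m : ℝ) > α - 2 →
      Tendsto (fun ξ : ℝ => F ξ (s * ξ + u)) (nhdsWithin 0 (Set.Ioi 0)) (nhds 0) ∧
      Tendsto (fun ξ : ℝ => F ξ (s * ξ + u)) (nhdsWithin 0 (Set.Iio 0)) (nhds 0)) ∧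
    ((m : ℝ) = α - 2 →
      Tendsto (fun ξ : ℝ => F ξ (s * ξ + u)) (nhdsWithin 0 (Set.Ioi 0))
        (nhds (1 / ((m + 2).factorial : ℝ) *
          iteratedDeriv (m + 1) (fun x : ℝ => f (x, u)) c)) ∧
      Tendsto (fun ξ : ℝ => F ξ (s * ξ + u)) (nhdsWithin 0 (Set.Iio 0))
        (nhds ((-1) ^ (m + 1) / ((m + 2).factorial : ℝ) *
          iteratedDeriv (m + 1) (fun x : ℝ => f (x, u)) c))) := by
  have hα₀ : 0 < α := one_pos.trans hα
  have key {l : Filter ℝ} {σ L : ℝ} (hl : l ≤ nhds 0) (hl₀ : ∀ᶠ ξ in l, ξ ≠ 0)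
      (hσ : ∀ᶠ ξ in l, Real.sign ξ = σ)
      (hL : Tendsto (fun ξ : ℝ => |ξ| ^ ((m + 2 - α) / α)) l (nhds L)) :
      Tendsto (fun ξ : ℝ => F ξ (s * ξ + u)) l
        (nhds (iteratedDeriv (m + 1) (fun x : ℝ => f (x, u)) c / ((m + 1).factorial : ℝ) *
          (σ ^ (m + 1) * L / α))) := by
    refine (f.tendsto_rpow_slice_div (s := s) hα₀ hvan hl hl₀ hσ hL).congr' ?_
    filter_upwards [hl₀] with ξ hξ
    rw [hF ξ hξ]
  have hright₀ : ∀ᶠ ξ : ℝ in nhdsWithin 0 (Set.Ioi 0), ξ ≠ 0 :=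
    eventually_mem_nhdsWithin.mono fun _ h => ne_of_gt h
  have hleft₀ : ∀ᶠ ξ : ℝ in nhdsWithin 0 (Set.Iio 0), ξ ≠ 0 :=
    eventually_mem_nhdsWithin.mono fun _ h => ne_of_lt h
  have hright : ∀ᶠ ξ : ℝ in nhdsWithin 0 (Set.Ioi 0), Real.sign ξ = 1 :=
    eventually_mem_nhdsWithin.mono fun _ h => Real.sign_of_pos h
  have hleft : ∀ᶠ ξ : ℝ in nhdsWithin 0 (Set.Iio 0), Real.sign ξ = -1 :=
    eventually_mem_nhdsWithin.mono fun _ h => Real.sign_of_neg h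
  constructor
  · intro hgt
    have hexp : 0 < ((m : ℝ) + 2 - α) / α := div_pos (by linarith) hα₀
    have hL : Tendsto (fun ξ : ℝ => |ξ| ^ ((m + 2 - α) / α)) (nhds 0) (nhds 0) := by
      have h : Tendsto (fun ξ : ℝ => |ξ| ^ ((m + 2 - α) / α)) (nhds 0)
          (nhds (|0| ^ ((m + 2 - α) / α))) :=
        (continuous_abs.tendsto 0).rpow_const (Or.inr hexp.le)
      rwa [abs_zero, Real.zero_rpow hexp.ne'] at h
    constructor
    · simpa using key nhdsWithin_le_nhds hright₀ hright (hL.mono_left nhdsWithin_le_nhds)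
    · simpa using key nhdsWithin_le_nhds hleft₀ hleft (hL.mono_left nhdsWithin_le_nhds)
  · intro heq
    obtain rfl : α = m + 2 := by linarith
    have hL (l : Filter ℝ) :
        Tendsto (fun ξ : ℝ => |ξ| ^ (((m : ℝ) + 2 - (m + 2)) / (m + 2))) l (nhds 1) := by
      simpa using tendsto_const_nhds
    have hfact : ((m + 2).factorial : ℝ) = (m + 2) * (m + 1).factorial := by
      rw [Nat.factorial_succ]
      push_cast
      ring
    rw [hfact]
    constructor
    · convert key nhdsWithin_le_nhds hright₀ hright (hL _) using 2
      rw [one_pow]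
      field_simp
    · convert key nhdsWithin_le_nhds hleft₀ hleft (hL _) using 2
      field_simp
end

section
/- Let α > 1, c ∈ ℝ, and f ∈ 𝒮(ℝ²) with (∂^k f/∂x^k)(c,y)=0 for k=0,…,m, m ≥ α - 2, and define Q_α f(s,u) = ∫_ℝ f(x+c, s x|x|^{α-1} + u) dx. Then the inversion formula holds: for all (x,y) with x ≠ c, f(x,y) = (α|x-c|^{α-1}/(2π²)) ∫_ℝ ( p.v. ∫_ℝ (∂_u Q_α f)(s,u) / (y - s(x-c)|x-c|^{α-1} - u) du ) ds. -/
open MeasureTheory Filter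

/-- The Cauchy principal value of `∫ g` around the singular point `a`. -/
noncomputable def pv (g : ℝ → ℝ) (a : ℝ) : ℝ :=
  limUnder (nhdsWithin 0 (Set.Ioi 0)) (fun ε : ℝ => ∫ v in {v : ℝ | ε < |v - a|}, g v)

section

open Set Topology SchwartzMap LineDeriv FourierTransform


/-- The symmetric second difference quotient of `g` at `z` with step `v`. -/
noncomputable def symmDiffQuot (g : ℝ → ℝ) (z v : ℝ) : ℝ :=
  (2 * g z - g (z - v) - g (z + v)) / v ^ 2

theorem abs_second_difference_le {g g' g'' : ℝ → ℝ} (hg : ∀ z, HasDerivAt g (g' z) z)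
    (hg' : ∀ z, HasDerivAt g' (g'' z) z) {z v M : ℝ} (hv : 0 ≤ v)
    (hM : ∀ w ∈ Icc (z - v) (z + v), |g'' w| ≤ M) :
    |2 * g z - g (z - v) - g (z + v)| ≤ 2 * M * v ^ 2 := by
  have hM0 : 0 ≤ M := (abs_nonneg _).trans (hM z ⟨by linarith, by linarith⟩)
  have hd : ∀ t, HasDerivAt (fun t => 2 * g z - g (z - t) - g (z + t)) (g' (z - t) - g' (z + t)) t := by
    intro t
    have h1 : HasDerivAt (fun t => g (z - t)) (-g' (z - t)) t := by
      simpa using (hg (z - t)).comp_const_sub z t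
    have h2 : HasDerivAt (fun t => g (z + t)) (g' (z + t)) t := by
      simpa using (hg (z + t)).comp_const_add z t
    convert! (h1.const_sub (2 * g z)).sub h2 using 1
    ring
  have hb : ∀ t ∈ Icc 0 v, ‖g' (z - t) - g' (z + t)‖ ≤ 2 * M * v := by
    intro t ht
    have := (convex_Icc (z - v) (z + v)).norm_image_sub_le_of_norm_hasDerivWithin_le
      (f := g') (f' := g'') (C := M) (x := z + t) (y := z - t)
      (fun x _ => (hg' x).hasDerivWithinAt) (fun x hx => hM x hx)
      ⟨by linarith [ht.1], by linarith [ht.2]⟩ ⟨by linarith [ht.2], by linarith [ht.1]⟩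
    refine this.trans ?_
    have : ‖z - t - (z + t)‖ = 2 * t := by
      rw [Real.norm_eq_abs, show z - t - (z + t) = -(2 * t) by ring, abs_neg,
        abs_of_nonneg (by linarith [ht.1])]
    rw [this]
    nlinarith [ht.2]
  have := (convex_Icc 0 v).norm_image_sub_le_of_norm_hasDerivWithin_le
      (fun x _ => (hd x).hasDerivWithinAt) hb (x := 0) (y := v) ⟨le_rfl, hv⟩ ⟨hv, le_rfl⟩
  simp only [Real.norm_eq_abs, sub_zero, add_zero, abs_of_nonneg hv] at this
  have e : 2 * g z - g z - g z = 0 := by ring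
  rw [e, sub_zero] at this
  linarith

theorem abs_symmDiffQuot_le {g g' g'' : ℝ → ℝ} (hg : ∀ z, HasDerivAt g (g' z) z)
    (hg' : ∀ z, HasDerivAt g' (g'' z) z) {M : ℝ} (h0 : ∀ w, |g w| ≤ M)
    (h2 : ∀ w, |g'' w| ≤ M) (z v : ℝ) (hv : 0 < v) :
    |symmDiffQuot g z v| ≤ 8 * M * (1 + v ^ 2)⁻¹ := by
  have hM : 0 ≤ M := (abs_nonneg _).trans (h0 0)
  unfold symmDiffQuot
  rw [abs_div, abs_of_pos (by positivity : 0 < v ^ 2), div_le_iff₀ (by positivity)]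
  have hA : |2 * g z - g (z - v) - g (z + v)| ≤ 2 * M * v ^ 2 :=
    abs_second_difference_le hg hg' hv.le fun w _ => h2 w
  have hB : |2 * g z - g (z - v) - g (z + v)| ≤ 4 * M := by
    have a := abs_le.1 (h0 z)
    have b := abs_le.1 (h0 (z - v))
    have c := abs_le.1 (h0 (z + v))
    exact abs_le.2 ⟨by linarith, by linarith⟩
  rw [mul_right_comm, ← div_eq_mul_inv, le_div_iff₀ (by positivity)]
  nlinarith

/-- The decaying pointwise bound on the second difference quotient. -/
theorem abs_symmDiffQuot_le_of_decay {g g' g'' : ℝ → ℝ} (hg : ∀ z, HasDerivAt g (g' z) z)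
    (hg' : ∀ z, HasDerivAt g' (g'' z) z) {B : ℝ} (h0 : ∀ w, |g w| ≤ B * (1 + w ^ 2)⁻¹)
    (h2 : ∀ w, |g'' w| ≤ B * (1 + w ^ 2)⁻¹) (z v : ℝ) (hv : 0 < v) :
    |symmDiffQuot g z v| ≤ 12 * B * (1 + v ^ 2)⁻¹ *
      ((1 + z ^ 2)⁻¹ + (1 + (z - v) ^ 2)⁻¹ + (1 + (z + v) ^ 2)⁻¹) := by
  have hB : 0 ≤ B := by
    have := (abs_nonneg _).trans (h0 0)
    simpa using this
  unfold symmDiffQuot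
  rw [abs_div, abs_of_pos (by positivity : 0 < v ^ 2), div_le_iff₀ (by positivity)]
  have i1 : 0 < (1 + z ^ 2)⁻¹ := by positivity
  have i2 : 0 < (1 + (z - v) ^ 2)⁻¹ := by positivity
  have i3 : 0 < (1 + (z + v) ^ 2)⁻¹ := by positivity
  rcases le_total v 1 with h | h
  · have hA := abs_second_difference_le hg hg' (z := z) (v := v) (M := 3 * B * (1 + z ^ 2)⁻¹) hv.le (by
      intro w hw
      refine (h2 w).trans ?_
      rw [← div_eq_mul_inv, ← div_eq_mul_inv, div_le_div_iff₀ (by positivity) (by positivity)]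
      have : 1 + z ^ 2 ≤ 3 * (1 + w ^ 2) := by
        have : |z - w| ≤ 1 := abs_le.2 ⟨by linarith [hw.2], by linarith [hw.1]⟩
        have : (z - w) ^ 2 ≤ 1 := by
          rw [← sq_abs]; nlinarith [abs_nonneg (z - w)]
        nlinarith [sq_nonneg (z - 2 * w)]
      nlinarith)
    refine hA.trans ?_
    have hv2 : (1 : ℝ) / 2 ≤ (1 + v ^ 2)⁻¹ := by
      rw [← one_div]; exact one_div_le_one_div_of_le (by positivity) (by nlinarith)
    calc 2 * (3 * B * (1 + z ^ 2)⁻¹) * v ^ 2 = 12 * B * (1 / 2) * (1 + z ^ 2)⁻¹ * v ^ 2 := by ring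
      _ ≤ _ := by gcongr; linarith
  · have a := abs_le.1 (h0 z)
    have b := abs_le.1 (h0 (z - v))
    have c := abs_le.1 (h0 (z + v))
    have hA : |2 * g z - g (z - v) - g (z + v)| ≤
        2 * B * ((1 + z ^ 2)⁻¹ + (1 + (z - v) ^ 2)⁻¹ + (1 + (z + v) ^ 2)⁻¹) := by
      have j2 := mul_nonneg hB i2.le
      have j3 := mul_nonneg hB i3.le
      exact abs_le.2 ⟨by linarith, by linarith⟩
    refine hA.trans ?_
    have hv2 : (1 : ℝ) / 2 ≤ (1 + v ^ 2)⁻¹ * v ^ 2 := by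
      rw [← div_eq_inv_mul, div_le_div_iff₀ (by positivity) (by positivity)]; nlinarith
    set P := (1 + z ^ 2)⁻¹ + (1 + (z - v) ^ 2)⁻¹ + (1 + (z + v) ^ 2)⁻¹
    have hP : 0 ≤ P := by positivity
    have : 0 ≤ 12 * B * P := by positivity
    nlinarith

theorem integrableOn_inv_one_add_sq (s : Set ℝ) : IntegrableOn (fun v : ℝ => (1 + v ^ 2)⁻¹) s :=
  integrable_inv_one_add_sq.integrableOn

theorem measurable_symmDiffQuot {g : ℝ → ℝ} (hg : Measurable g) :
    Measurable fun p : ℝ × ℝ => symmDiffQuot g p.1 p.2 := by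
  unfold symmDiffQuot; fun_prop

theorem integrableOn_symmDiffQuot {g g' g'' : ℝ → ℝ} (hg : ∀ z, HasDerivAt g (g' z) z)
    (hg' : ∀ z, HasDerivAt g' (g'' z) z) {M : ℝ} (h0 : ∀ w, |g w| ≤ M)
    (h2 : ∀ w, |g'' w| ≤ M) (z : ℝ) : IntegrableOn (symmDiffQuot g z) (Ioi 0) := by
  have hgm : Measurable g := (continuous_iff_continuousAt.2 fun z => (hg z).continuousAt).measurable
  refine Integrable.mono' ((integrableOn_inv_one_add_sq _).const_mul (8 * M))
    ((measurable_symmDiffQuot hgm).comp (measurable_const.prodMk measurable_id)).aestronglyMeasurable ?_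
  filter_upwards [ae_restrict_mem measurableSet_Ioi] with v hv
  exact abs_symmDiffQuot_le hg hg' h0 h2 z v hv

theorem integral_abs_sub_gt_eq {k : ℝ → ℝ} (w : ℝ) {ε : ℝ} (hε : 0 < ε)
    (hk : IntegrableOn k {u | ε < |u - w|}) :
    ∫ u in {u | ε < |u - w|}, k u = ∫ v in Ioi ε, (k (w - v) + k (w + v)) := by
  have hset : {u : ℝ | ε < |u - w|} = Iio (w - ε) ∪ Ioi (w + ε) := by
    ext u
    simp only [mem_ofPred_eq, lt_abs, mem_union, mem_Iio, mem_Ioi]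
    constructor
    · rintro (h | h)
      · right; linarith
      · left; linarith
    · rintro (h | h)
      · right; linarith
      · left; linarith
  have hdis : Disjoint (Iio (w - ε)) (Ioi (w + ε)) := by
    rw [Set.disjoint_left]; intro u h1 h2
    simp only [mem_Iio, mem_Ioi] at h1 h2; linarith
  rw [hset] at hk ⊢
  have hkl := hk.left_of_union
  have hkr := hk.right_of_union
  have e1 : ∀ F : ℝ → ℝ, (fun v => (Ioi ε).indicator (fun v => F (w + v)) v)
      = fun v => (Ioi (w + ε)).indicator F (v + w) := by
    intro F; ext v
    simp only [indicator, mem_Ioi, add_comm v w, add_lt_add_iff_left]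
  have e2 : ∀ F : ℝ → ℝ, (fun v => (Ioi ε).indicator (fun v => F (w - v)) v)
      = fun v => (Iio (w - ε)).indicator F (w - v) := by
    intro F; ext v
    simp only [indicator, mem_Ioi, mem_Iio, sub_lt_sub_iff_left]
  have il : IntegrableOn (fun v => k (w - v)) (Ioi ε) := by
    rw [← integrable_indicator_iff measurableSet_Ioi]
    change Integrable (fun v => (Ioi ε).indicator (fun v => k (w - v)) v)
    rw [e2]
    exact ((integrable_indicator_iff measurableSet_Iio).2 hkl).comp_sub_left w
  have ir : IntegrableOn (fun v => k (w + v)) (Ioi ε) := by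
    rw [← integrable_indicator_iff measurableSet_Ioi]
    change Integrable (fun v => (Ioi ε).indicator (fun v => k (w + v)) v)
    rw [e1]
    exact ((integrable_indicator_iff measurableSet_Ioi).2 hkr).comp_add_right w
  rw [setIntegral_union hdis measurableSet_Ioi hkl hkr, integral_add il ir]
  congr 1
  · rw [← integral_indicator measurableSet_Iio, ← integral_indicator measurableSet_Ioi]
    change _ = ∫ v, (fun v => (Ioi ε).indicator (fun v => k (w - v)) v) v
    rw [e2, integral_sub_left_eq_self (fun v => (Iio (w - ε)).indicator k v)]
  · rw [← integral_indicator measurableSet_Ioi, ← integral_indicator measurableSet_Ioi]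
    change _ = ∫ v, (fun v => (Ioi ε).indicator (fun v => k (w + v)) v) v
    rw [e1, integral_add_right_eq_self (fun v => (Ioi (w + ε)).indicator k v)]

/-- The principal value of the derivative of `q` divided by `w - u` is the integral of the
second difference quotient. -/
theorem pv_deriv_div_eq {q q' q'' : ℝ → ℝ} (hq : ∀ z, HasDerivAt q (q' z) z)
    (hq' : ∀ z, HasDerivAt q' (q'' z) z) {M : ℝ} (h0 : ∀ w, |q w| ≤ M)
    (h2 : ∀ w, |q'' w| ≤ M) (hInt : Integrable q') (w : ℝ) :
    pv (fun u => q' u / (w - u)) w = ∫ v in Ioi 0, symmDiffQuot q w v := by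
  have hM : 0 ≤ M := (abs_nonneg _).trans (h0 0)
  have hNint := integrableOn_symmDiffQuot hq hq' h0 h2 w
  set n : ℝ → ℝ := fun v => 2 * q w - q (w - v) - q (w + v) with hn
  have hnd : ∀ t, HasDerivAt n (q' (w - t) - q' (w + t)) t := by
    intro t
    have h1 : HasDerivAt (fun t => q (w - t)) (-q' (w - t)) t := by
      simpa using (hq (w - t)).comp_const_sub w t
    have h2 : HasDerivAt (fun t => q (w + t)) (q' (w + t)) t := by
      simpa using (hq (w + t)).comp_const_add w t
    convert! (h1.const_sub (2 * q w)).sub h2 using 1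
    ring
  have hnb : ∀ v, 0 < v → |n v| ≤ 2 * M * v ^ 2 := fun v hv =>
    abs_second_difference_le hq hq' hv.le fun w _ => h2 w
  have hnb' : ∀ v, |n v| ≤ 4 * M := fun v => by
    have a := abs_le.1 (h0 w)
    have b := abs_le.1 (h0 (w - v))
    have c := abs_le.1 (h0 (w + v))
    exact abs_le.2 ⟨by simp only [hn]; linarith, by simp only [hn]; linarith⟩
  have key : ∀ ε : ℝ, 0 < ε → ∫ u in {u | ε < |u - w|}, q' u / (w - u)
      = (∫ v in Ioi ε, symmDiffQuot q w v) - n ε / ε := by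
    intro ε hε
    have hms : MeasurableSet {u : ℝ | ε < |u - w|} :=
      measurableSet_lt measurable_const (by fun_prop)
    have hk : IntegrableOn (fun u => q' u / (w - u)) {u | ε < |u - w|} := by
      refine Integrable.mono' (hInt.norm.const_mul ε⁻¹).integrableOn
        ((hInt.1.restrict).mul (by fun_prop : Measurable fun u : ℝ => (w - u)⁻¹).aestronglyMeasurable) ?_
      filter_upwards [ae_restrict_mem hms] with u hu
      rw [norm_div, div_eq_inv_mul]
      have : ε ≤ ‖w - u‖ := by
        rw [Real.norm_eq_abs, abs_sub_comm]; exact hu.le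
      gcongr
    rw [integral_abs_sub_gt_eq w hε hk]
    have hk2 : IntegrableOn (fun v => (q' (w - v) - q' (w + v)) / v) (Ioi ε) := by
      have : Integrable (fun v => q' (w - v) - q' (w + v)) :=
        (hInt.comp_sub_left w).sub (by simpa [add_comm] using hInt.comp_add_left w)
      refine Integrable.mono' (this.norm.const_mul ε⁻¹).integrableOn
        ((this.1.restrict).mul (by fun_prop : Measurable fun u : ℝ => (u)⁻¹).aestronglyMeasurable) ?_
      filter_upwards [ae_restrict_mem measurableSet_Ioi] with u hu
      rw [norm_div, div_eq_inv_mul]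
      have : ε ≤ ‖u‖ := by
        rw [Real.norm_eq_abs]; exact (le_of_lt hu).trans (le_abs_self u)
      gcongr
    have hN2 : IntegrableOn (symmDiffQuot q w) (Ioi ε) :=
      hNint.mono_set (Ioi_subset_Ioi hε.le)
    have hF : ∫ v in Ioi ε, ((q' (w - v) - q' (w + v)) / v - symmDiffQuot q w v) = 0 - n ε / ε := by
      refine integral_Ioi_of_hasDerivAt_of_tendsto' (f := fun v => n v / v) ?_ (hk2.sub hN2) ?_
      · intro v hv
        have hv0 : v ≠ 0 := (hε.trans_le hv).ne'
        convert! (hnd v).div (hasDerivAt_id v) hv0 using 1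
        simp only [symmDiffQuot, id, hn]
        field_simp
      · refine squeeze_zero_norm' (a := fun v => 4 * M / v) ?_
          (tendsto_const_nhds.div_atTop tendsto_id)
        filter_upwards [eventually_gt_atTop 0] with v hv
        rw [norm_div, Real.norm_of_nonneg hv.le]
        gcongr
        exact hnb' v
    rw [integral_sub hk2 hN2] at hF
    have : ∫ v in Ioi ε, (q' (w - v) / (w - (w - v)) + q' (w + v) / (w - (w + v)))
        = ∫ v in Ioi ε, (q' (w - v) - q' (w + v)) / v := by
      refine setIntegral_congr_fun measurableSet_Ioi fun v hv => ?_
      simp only [sub_sub_cancel, sub_add_cancel_left, div_neg]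
      ring
    rw [this]; linarith
  unfold pv
  refine Tendsto.limUnder_eq ?_
  have hlim : Tendsto (fun ε : ℝ => 4 * M * ε) (𝓝[>] 0) (𝓝 0) := by
    have : Tendsto (fun ε : ℝ => 4 * M * ε) (𝓝 0) (𝓝 (4 * M * 0)) := tendsto_id.const_mul _
    rw [mul_zero] at this
    exact this.mono_left nhdsWithin_le_nhds
  rw [tendsto_iff_norm_sub_tendsto_zero]
  refine squeeze_zero' (Eventually.of_forall fun _ => norm_nonneg _) ?_ hlim
  filter_upwards [self_mem_nhdsWithin] with ε hε
  have hε : 0 < ε := hε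
  rw [key ε hε, ← Ioc_union_Ioi_eq_Ioi hε.le, setIntegral_union (by
    rw [Set.disjoint_left]; intro u h1 h2; exact absurd h1.2 (not_le.2 h2)) measurableSet_Ioi
    (hNint.mono_set Ioc_subset_Ioi_self) (hNint.mono_set (Ioi_subset_Ioi hε.le))]
  have hI : ‖∫ v in Ioc 0 ε, symmDiffQuot q w v‖ ≤ 2 * M * (volume.real (Ioc 0 ε)) := by
    refine norm_setIntegral_le_of_norm_le_const (by simp) fun v hv => ?_
    rw [symmDiffQuot, norm_div, Real.norm_of_nonneg (sq_nonneg v), div_le_iff₀ (by have := hv.1; positivity)]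
    exact hnb v hv.1
  have hvol : volume.real (Ioc 0 ε) = ε := by simp [hε.le]
  rw [hvol] at hI
  have h3 : ‖n ε / ε‖ ≤ 2 * M * ε := by
    rw [norm_div, Real.norm_of_nonneg hε.le, div_le_iff₀ hε]
    refine (hnb ε hε).trans (le_of_eq (by ring))
  calc _ = ‖-(n ε / ε) - ∫ v in Ioc 0 ε, symmDiffQuot q w v‖ := by congr 1; ring
    _ ≤ ‖-(n ε / ε)‖ + _ := norm_sub_le _ _
    _ ≤ _ := by rw [norm_neg]; linarith

/-- The kernel `(2 - 2 cos (b v)) / v ^ 2`. -/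
noncomputable def cosQuot (b v : ℝ) : ℝ := (2 - 2 * Real.cos (b * v)) / v ^ 2

theorem cosQuot_nonneg (b v : ℝ) : 0 ≤ cosQuot b v :=
  div_nonneg (by linarith [Real.cos_le_one (b * v)]) (sq_nonneg v)

theorem integrableOn_cosQuot (b : ℝ) : IntegrableOn (cosQuot b) (Ioi 0) := by
  have h := integrableOn_symmDiffQuot (g := fun z => Real.cos (b * z))
    (g' := fun z => -b * Real.sin (b * z)) (g'' := fun z => -b ^ 2 * Real.cos (b * z))
    (M := 1 + b ^ 2) (fun z => ?_) (fun z => ?_) (fun w => ?_) (fun w => ?_) 0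
  · refine h.congr_fun (fun v _ => ?_) measurableSet_Ioi
    simp only [symmDiffQuot, cosQuot, mul_zero, Real.cos_zero, zero_sub, mul_neg, Real.cos_neg,
      zero_add]
    ring
  · convert! (Real.hasDerivAt_cos (b * z)).comp z ((hasDerivAt_id z).const_mul b) using 1
    simp; ring
  · convert! ((Real.hasDerivAt_sin (b * z)).comp z ((hasDerivAt_id z).const_mul b)).const_mul (-b)
      using 1
    simp; ring
  · exact (Real.abs_cos_le_one _).trans (by nlinarith [sq_nonneg b])
  · rw [abs_mul, abs_neg, abs_of_nonneg (sq_nonneg b)]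
    nlinarith [Real.abs_cos_le_one (b * w), sq_nonneg b]

theorem integral_cosQuot_eq_abs_mul (b : ℝ) :
    ∫ v in Ioi 0, cosQuot b v = |b| * ∫ v in Ioi 0, cosQuot 1 v := by
  have habs : ∀ v, cosQuot b v = cosQuot |b| v := by
    intro v
    rcases abs_choice b with h | h <;> simp [cosQuot, h]
  simp_rw [habs]
  rcases (abs_nonneg b).eq_or_lt with h | h
  · rw [← h]; simp [cosQuot]
  · have := integral_comp_mul_left_Ioi (fun v => cosQuot 1 v) 0 h
    rw [mul_zero, smul_eq_mul] at this
    have e : ∀ v, cosQuot |b| v = |b| ^ 2 * cosQuot 1 (|b| * v) := by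
      intro v
      simp only [cosQuot, one_mul, mul_pow]
      rw [← mul_div_assoc, mul_div_mul_left _ _ (by positivity)]
    simp_rw [e]
    rw [integral_const_mul, this]
    field_simp

theorem integrable_mul_cosQuot {w : ℝ → ℂ} (hw : AEStronglyMeasurable w)
    (hi : Integrable fun ξ => |ξ| * ‖w ξ‖) :
    Integrable (fun p : ℝ × ℝ => w p.1 * (cosQuot (2 * Real.pi * p.1) p.2 : ℂ))
      (volume.prod (volume.restrict (Ioi 0))) := by
  have hm : AEStronglyMeasurable (fun p : ℝ × ℝ => w p.1 * (cosQuot (2 * Real.pi * p.1) p.2 : ℂ))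
      (volume.prod (volume.restrict (Ioi 0))) := by
    have h : Measurable fun p : ℝ × ℝ => cosQuot (2 * Real.pi * p.1) p.2 := by
      unfold cosQuot; fun_prop
    exact hw.comp_fst.mul h.complex_ofReal.aestronglyMeasurable
  refine (integrable_prod_iff hm).2 ⟨ae_of_all _ fun ξ => ?_, ?_⟩
  · exact (Integrable.ofReal (𝕜 := ℂ) (integrableOn_cosQuot (2 * Real.pi * ξ))).const_mul (w ξ)
  · have : ∀ ξ, ∫ v in Ioi 0, ‖w ξ * (cosQuot (2 * Real.pi * ξ) v : ℂ)‖
        = (2 * Real.pi * ∫ v in Ioi 0, cosQuot 1 v) * (|ξ| * ‖w ξ‖) := by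
      intro ξ
      simp_rw [norm_mul, Complex.norm_real, Real.norm_of_nonneg (cosQuot_nonneg _ _)]
      rw [integral_const_mul, integral_cosQuot_eq_abs_mul, abs_mul,
        abs_of_pos Real.two_pi_pos]
      ring
    simp_rw [this]
    exact hi.const_mul _

theorem integral_exp_mul_gaussian (a : ℝ) :
    ∫ t : ℝ, Complex.exp ((2 * Real.pi * a * t : ℝ) * Complex.I) * (Real.exp (-Real.pi * t ^ 2) : ℂ)
      = (Real.exp (-Real.pi * a ^ 2) : ℂ) := by
  have h := fourierIntegral_gaussian (b := (Real.pi : ℂ)) (by simpa using Real.pi_pos)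
    ((2 * Real.pi * a : ℝ) : ℂ)
  have hpi : (Real.pi : ℂ) ≠ 0 := by exact_mod_cast Real.pi_ne_zero
  rw [div_self hpi, Complex.one_cpow, one_mul] at h
  convert! h using 1
  · refine integral_congr_ae (ae_of_all _ fun t => ?_)
    push_cast
    congr 2
    ring
  · push_cast
    congr 1
    field_simp
    ring

theorem integral_gaussian_mul_cosQuot (v : ℝ) :
    ∫ ξ : ℝ, Real.exp (-Real.pi * ξ ^ 2) * cosQuot (2 * Real.pi * ξ) v
      = (2 - 2 * Real.exp (-Real.pi * v ^ 2)) / v ^ 2 := by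
  have hg := integrable_exp_neg_mul_sq Real.pi_pos
  have hc : ∫ ξ : ℝ, Real.cos (2 * Real.pi * v * ξ) * Real.exp (-Real.pi * ξ ^ 2)
      = Real.exp (-Real.pi * v ^ 2) := by
    have h := congrArg Complex.re (integral_exp_mul_gaussian v)
    rw [Complex.ofReal_re] at h
    rw [← h]
    have hInt : Integrable fun t : ℝ => Complex.exp ((2 * Real.pi * v * t : ℝ) * Complex.I) *
        (Real.exp (-Real.pi * t ^ 2) : ℂ) := by
      refine hg.ofReal.bdd_mul (c := 1) (by fun_prop) (ae_of_all _ fun t => ?_)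
      rw [Complex.norm_exp_ofReal_mul_I]
    change _ = RCLike.re (K := ℂ) _
    rw [← integral_re hInt]
    refine integral_congr_ae (ae_of_all _ fun t => ?_)
    simp only [RCLike.re_eq_complex_re]
    rw [Complex.re_mul_ofReal, Complex.exp_ofReal_mul_I_re]
  have hci : Integrable fun ξ : ℝ =>
      Real.cos (2 * Real.pi * v * ξ) * Real.exp (-Real.pi * ξ ^ 2) :=
    hg.bdd_mul (c := 1) (by fun_prop) (ae_of_all _ fun t => Real.abs_cos_le_one _)
  have h1 : ∫ ξ : ℝ, Real.exp (-Real.pi * ξ ^ 2) = 1 := by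
    rw [integral_gaussian, div_self Real.pi_ne_zero, Real.sqrt_one]
  calc _ = ∫ ξ : ℝ, (2 * Real.exp (-Real.pi * ξ ^ 2) -
        2 * (Real.cos (2 * Real.pi * v * ξ) * Real.exp (-Real.pi * ξ ^ 2))) / v ^ 2 := by
        refine integral_congr_ae (ae_of_all _ fun ξ => ?_)
        simp only [cosQuot]
        rw [mul_right_comm (2 * Real.pi) v ξ]
        ring
    _ = _ := by
        rw [integral_div, integral_sub (hg.const_mul 2) (hci.const_mul 2), integral_const_mul,
          integral_const_mul, hc, h1, mul_one]

theorem integral_abs_mul_gaussian :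
    ∫ ξ : ℝ, |ξ| * Real.exp (-Real.pi * ξ ^ 2) = 1 / Real.pi := by
  have h := integral_comp_abs (f := fun r : ℝ => r * Real.exp (-Real.pi * r ^ 2))
  simp only [sq_abs] at h
  rw [h]
  have h2 := integral_mul_cexp_neg_mul_sq (b := (Real.pi : ℂ)) (by simpa using Real.pi_pos)
  have : ∫ r in Ioi (0 : ℝ), r * Real.exp (-Real.pi * r ^ 2) = (2 * Real.pi)⁻¹ := by
    apply Complex.ofReal_injective
    rw [← integral_complex_ofReal]
    push_cast
    exact h2
  rw [this]
  field_simp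

theorem integral_one_sub_gaussian_div_sq :
    ∫ v in Ioi (0 : ℝ), (2 - 2 * Real.exp (-Real.pi * v ^ 2)) / v ^ 2 = 2 * Real.pi := by
  have hE : ∀ v : ℝ, HasDerivAt (fun v => Real.exp (-Real.pi * v ^ 2))
      (Real.exp (-Real.pi * v ^ 2) * (-2 * Real.pi * v)) v := by
    intro v
    convert! ((hasDerivAt_pow 2 v).const_mul (-Real.pi)).exp using 1
    push_cast; ring
  have hub : ∀ v : ℝ, |2 - 2 * Real.exp (-Real.pi * v ^ 2)| ≤ 2 * Real.pi * v ^ 2 := by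
    intro v
    have h1 := Real.add_one_le_exp (-Real.pi * v ^ 2)
    have h2 : Real.exp (-Real.pi * v ^ 2) ≤ 1 := Real.exp_le_one_iff.2 (by nlinarith [Real.pi_pos, sq_nonneg v])
    rw [abs_of_nonneg (by linarith)]
    linarith
  have hub' : ∀ v : ℝ, |2 - 2 * Real.exp (-Real.pi * v ^ 2)| ≤ 2 := by
    intro v
    have h1 := Real.exp_pos (-Real.pi * v ^ 2)
    have h2 : Real.exp (-Real.pi * v ^ 2) ≤ 1 := Real.exp_le_one_iff.2 (by nlinarith [Real.pi_pos, sq_nonneg v])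
    rw [abs_of_nonneg (by linarith)]
    linarith
  have i1 : IntegrableOn (fun v : ℝ => (2 - 2 * Real.exp (-Real.pi * v ^ 2)) / v ^ 2) (Ioi 0) := by
    refine Integrable.mono' ((integrableOn_inv_one_add_sq (Ioi 0)).const_mul (2 + 2 * Real.pi))
      (by fun_prop : Measurable fun v : ℝ =>
        (2 - 2 * Real.exp (-Real.pi * v ^ 2)) / v ^ 2).aestronglyMeasurable ?_
    filter_upwards [ae_restrict_mem measurableSet_Ioi] with v hv
    have hv : 0 < v := hv
    rw [norm_div, Real.norm_of_nonneg (sq_nonneg v), div_le_iff₀ (by positivity), mul_assoc,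
      ← div_eq_inv_mul, ← mul_div_assoc, le_div_iff₀ (by positivity), Real.norm_eq_abs]
    nlinarith [hub v, hub' v, sq_nonneg v]
  have i2 : IntegrableOn (fun v : ℝ => 4 * Real.pi * Real.exp (-Real.pi * v ^ 2)) (Ioi 0) :=
    ((integrable_exp_neg_mul_sq Real.pi_pos).const_mul _).integrableOn
  have h := integral_Ioi_of_hasDerivAt_of_tendsto (a := 0) (m := 0)
    (f := fun v : ℝ => -(2 - 2 * Real.exp (-Real.pi * v ^ 2)) / v)
    (f' := fun v => (2 - 2 * Real.exp (-Real.pi * v ^ 2)) / v ^ 2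
      - 4 * Real.pi * Real.exp (-Real.pi * v ^ 2)) ?_ ?_ (i1.sub i2) ?_
  · rw [integral_sub i1 i2, integral_const_mul, integral_gaussian_Ioi, div_self Real.pi_ne_zero,
      Real.sqrt_one] at h
    simp only [zero_sub, div_zero, neg_zero] at h
    linarith
  · rw [ContinuousWithinAt, div_zero, tendsto_zero_iff_norm_tendsto_zero]
    have hl : Tendsto (fun v : ℝ => 2 * Real.pi * |v|) (𝓝[Ici 0] 0) (𝓝 0) := by
      have : ContinuousWithinAt (fun v : ℝ => 2 * Real.pi * |v|) (Ici 0) 0 := by fun_prop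
      simpa [ContinuousWithinAt] using this
    refine squeeze_zero (fun _ => norm_nonneg _) (fun v => ?_) hl
    rcases eq_or_ne v 0 with rfl | hv
    · simp
    rw [norm_div, norm_neg, Real.norm_eq_abs, Real.norm_eq_abs, div_le_iff₀ (by positivity),
      mul_assoc, abs_mul_abs_self, ← sq]
    exact hub v
  · intro v hv
    have hv0 : v ≠ 0 := (show (0 : ℝ) < v from hv).ne'
    convert! (((hE v).const_mul 2).const_sub 2).neg.div (hasDerivAt_id v) hv0 using 1
    simp only [id, Pi.neg_apply]
    field_simp
    ring
  · refine squeeze_zero_norm' (a := fun v => 2 / v) ?_ (tendsto_const_nhds.div_atTop tendsto_id)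
    filter_upwards [eventually_gt_atTop 0] with v hv
    rw [norm_div, norm_neg, Real.norm_of_nonneg hv.le]
    gcongr
    exact hub' v

theorem integral_cosQuot_one : ∫ v in Ioi 0, cosQuot 1 v = Real.pi := by
  have hI := integrable_mul_cosQuot (w := fun ξ => (Real.exp (-Real.pi * ξ ^ 2) : ℂ))
    (by fun_prop) (by
      have := (integrable_mul_exp_neg_mul_sq Real.pi_pos).norm
      refine this.congr (ae_of_all _ fun ξ => ?_)
      simp only [norm_mul, Complex.norm_real, Real.norm_eq_abs])
  have hIr : Integrable (fun p : ℝ × ℝ => Real.exp (-Real.pi * p.1 ^ 2) *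
      cosQuot (2 * Real.pi * p.1) p.2) (volume.prod (volume.restrict (Ioi 0))) := by
    refine hI.re.congr (ae_of_all _ fun p => ?_)
    simp only [← Complex.ofReal_mul, RCLike.re_eq_complex_re, Complex.ofReal_re]
  have h := integral_integral_swap (f := fun ξ v : ℝ => Real.exp (-Real.pi * ξ ^ 2) *
      cosQuot (2 * Real.pi * ξ) v) hIr
  simp_rw [integral_gaussian_mul_cosQuot, integral_const_mul, integral_cosQuot_eq_abs_mul (2 * _ * _)] at h
  rw [integral_one_sub_gaussian_div_sq] at h
  have e : ∀ ξ : ℝ, Real.exp (-Real.pi * ξ ^ 2) * (|2 * Real.pi * ξ| * ∫ v in Ioi 0, cosQuot 1 v)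
      = (2 * Real.pi * ∫ v in Ioi 0, cosQuot 1 v) * (|ξ| * Real.exp (-Real.pi * ξ ^ 2)) := by
    intro ξ
    rw [abs_mul, abs_of_pos Real.two_pi_pos]; ring
  simp_rw [e] at h
  rw [integral_const_mul, integral_abs_mul_gaussian] at h
  have hpi := Real.pi_pos
  field_simp at h
  linarith

theorem integrable_gaussian : Integrable fun t : ℝ => Real.exp (-Real.pi * t ^ 2) :=
  integrable_exp_neg_mul_sq Real.pi_pos

theorem integral_gaussian_mul_comp {h : ℝ → ℝ} {H : ℝ → ℂ} (hH : Integrable H)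
    (hinv : ∀ z, (h z : ℂ) = ∫ ξ : ℝ, Complex.exp ((2 * Real.pi * ξ * z : ℝ) * Complex.I) * H ξ)
    (s z : ℝ) :
    ((∫ t : ℝ, Real.exp (-Real.pi * t ^ 2) * h (z + s * t) : ℝ) : ℂ)
      = ∫ ξ : ℝ, Complex.exp ((2 * Real.pi * ξ * z : ℝ) * Complex.I) * H ξ *
        (Real.exp (-Real.pi * (s * ξ) ^ 2) : ℂ) := by
  have hI : Integrable (Function.uncurry fun t ξ : ℝ =>
      Complex.exp ((2 * Real.pi * ξ * (z + s * t) : ℝ) * Complex.I) *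
        ((Real.exp (-Real.pi * t ^ 2) : ℂ) * H ξ)) (volume.prod volume) := by
    have := (integrable_gaussian.ofReal (𝕜 := ℂ)).mul_prod hH
    refine this.bdd_mul (c := 1) (by fun_prop) (ae_of_all _ fun p => ?_)
    rw [Complex.norm_exp_ofReal_mul_I]
  rw [← integral_complex_ofReal]
  calc _ = ∫ t : ℝ, ∫ ξ : ℝ, Complex.exp ((2 * Real.pi * ξ * (z + s * t) : ℝ) * Complex.I) *
        ((Real.exp (-Real.pi * t ^ 2) : ℂ) * H ξ) := by
        refine integral_congr_ae (ae_of_all _ fun t => ?_)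
        simp only
        rw [Complex.ofReal_mul, hinv, ← integral_const_mul]
        refine integral_congr_ae (ae_of_all _ fun ξ => ?_)
        simp only
        ring
    _ = _ := by
        rw [integral_integral_swap hI]
        refine integral_congr_ae (ae_of_all _ fun ξ => ?_)
        simp only
        rw [← integral_exp_mul_gaussian (s * ξ), ← integral_const_mul]
        refine integral_congr_ae (ae_of_all _ fun t => ?_)
        simp only
        have : Complex.exp ((2 * Real.pi * ξ * (z + s * t) : ℝ) * Complex.I)
            = Complex.exp ((2 * Real.pi * ξ * z : ℝ) * Complex.I) *
              Complex.exp ((2 * Real.pi * (s * ξ) * t : ℝ) * Complex.I) := by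
          rw [← Complex.exp_add]; congr 1; push_cast; ring
        rw [this]; ring

theorem integral_gaussian_mul_symmDiffQuot {h : ℝ → ℝ} (hc : Continuous h) {M : ℝ}
    (hM : ∀ z, |h z| ≤ M) {H : ℝ → ℂ} (hH : Integrable H)
    (hinv : ∀ z, (h z : ℂ) = ∫ ξ : ℝ, Complex.exp ((2 * Real.pi * ξ * z : ℝ) * Complex.I) * H ξ)
    (s y v : ℝ) :
    ((∫ t : ℝ, Real.exp (-Real.pi * t ^ 2) * symmDiffQuot h (y + s * t) v : ℝ) : ℂ)
      = ∫ ξ : ℝ, Complex.exp ((2 * Real.pi * ξ * y : ℝ) * Complex.I) * H ξ *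
        (cosQuot (2 * Real.pi * ξ) v : ℂ) * (Real.exp (-Real.pi * (s * ξ) ^ 2) : ℂ) := by
  have hi : ∀ z, Integrable fun t : ℝ => Real.exp (-Real.pi * t ^ 2) * h (z + s * t) := fun z =>
    integrable_gaussian.mul_bdd (c := M) (by fun_prop) (ae_of_all _ fun t => hM _)
  have hJ : ∀ z, Integrable fun ξ : ℝ => Complex.exp ((2 * Real.pi * ξ * z : ℝ) * Complex.I) * H ξ *
        (Real.exp (-Real.pi * (s * ξ) ^ 2) : ℂ) := fun z => by
    refine Integrable.mul_bdd (c := 1) (hH.bdd_mul (c := 1) (by fun_prop) (ae_of_all _ fun t => ?_))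
      (by fun_prop) (ae_of_all _ fun t => ?_)
    · rw [Complex.norm_exp_ofReal_mul_I]
    · rw [Complex.norm_real, Real.norm_of_nonneg (Real.exp_pos _).le]
      exact Real.exp_le_one_iff.2 (by nlinarith [Real.pi_pos, sq_nonneg (s * t)])
  have e1 : ∫ t : ℝ, Real.exp (-Real.pi * t ^ 2) * symmDiffQuot h (y + s * t) v
      = (2 * (∫ t : ℝ, Real.exp (-Real.pi * t ^ 2) * h (y + s * t))
        - (∫ t : ℝ, Real.exp (-Real.pi * t ^ 2) * h (y - v + s * t))
        - (∫ t : ℝ, Real.exp (-Real.pi * t ^ 2) * h (y + v + s * t))) / v ^ 2 := by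
    have hi2 : Integrable fun t : ℝ => 2 * (Real.exp (-Real.pi * t ^ 2) * h (y + s * t)) -
        Real.exp (-Real.pi * t ^ 2) * h (y - v + s * t) := ((hi y).const_mul 2).sub (hi _)
    rw [← integral_const_mul, ← integral_sub ((hi y).const_mul 2) (hi _),
      ← integral_sub hi2 (hi _), ← integral_div]
    refine integral_congr_ae (ae_of_all _ fun t => ?_)
    simp only [symmDiffQuot]
    rw [show y + s * t - v = y - v + s * t by ring, show y + s * t + v = y + v + s * t by ring]
    ring
  have hJ2 := ((hJ y).const_mul 2).sub (hJ (y - v))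
  simp only [Pi.sub_def] at hJ2
  rw [e1, Complex.ofReal_div, Complex.ofReal_sub, Complex.ofReal_sub, Complex.ofReal_mul,
    Complex.ofReal_pow, Complex.ofReal_ofNat]
  rw [integral_gaussian_mul_comp hH hinv, integral_gaussian_mul_comp hH hinv,
    integral_gaussian_mul_comp hH hinv, ← integral_const_mul,
    ← integral_sub ((hJ y).const_mul 2) (hJ _),
    ← integral_sub hJ2 (hJ _), ← integral_div]
  refine integral_congr_ae (ae_of_all _ fun ξ => ?_)
  simp only [cosQuot]
  have e2 : Complex.exp ((2 * Real.pi * ξ * (y - v) : ℝ) * Complex.I)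
      = Complex.exp ((2 * Real.pi * ξ * y : ℝ) * Complex.I) *
        Complex.exp (-((2 * Real.pi * ξ * v : ℝ) : ℂ) * Complex.I) := by
    rw [← Complex.exp_add]; congr 1; push_cast; ring
  have e3 : Complex.exp ((2 * Real.pi * ξ * (y + v) : ℝ) * Complex.I)
      = Complex.exp ((2 * Real.pi * ξ * y : ℝ) * Complex.I) *
        Complex.exp (((2 * Real.pi * ξ * v : ℝ) : ℂ) * Complex.I) := by
    rw [← Complex.exp_add]; congr 1; push_cast; ring
  have e4 : ((((2 - 2 * Real.cos (2 * Real.pi * ξ * v)) / v ^ 2 : ℝ)) : ℂ)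
      = (2 - (Complex.exp (((2 * Real.pi * ξ * v : ℝ) : ℂ) * Complex.I) +
        Complex.exp (-((2 * Real.pi * ξ * v : ℝ) : ℂ) * Complex.I))) / (v : ℂ) ^ 2 := by
    rw [← Complex.two_cos, ← Complex.ofReal_cos]
    push_cast; ring
  rw [e2, e3, e4]
  ring

/-- Reconstruction of `h y` from Gaussian averages of the second difference quotients of `h`. -/
theorem integral_gaussian_average {h : ℝ → ℝ} (hc : Continuous h) {M : ℝ}
    (hM : ∀ z, |h z| ≤ M) {H : ℝ → ℂ} (hH : Integrable H)
    (hinv : ∀ z, (h z : ℂ) = ∫ ξ : ℝ, Complex.exp ((2 * Real.pi * ξ * z : ℝ) * Complex.I) * H ξ)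
    (y : ℝ) :
    Integrable (fun s : ℝ => ∫ v in Ioi 0, ∫ t : ℝ,
      Real.exp (-Real.pi * t ^ 2) * symmDiffQuot h (y + s * t) v) ∧
    ∫ s : ℝ, ∫ v in Ioi 0, ∫ t : ℝ,
      Real.exp (-Real.pi * t ^ 2) * symmDiffQuot h (y + s * t) v = 2 * Real.pi ^ 2 * h y := by
  set E : ℝ → ℂ := fun ξ => Complex.exp ((2 * Real.pi * ξ * y : ℝ) * Complex.I) * H ξ with hE
  have hEi : Integrable E := hH.bdd_mul (c := 1) (by fun_prop) (ae_of_all _ fun t => by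
    rw [Complex.norm_exp_ofReal_mul_I])
  set Ψ : (ℝ × ℝ) × ℝ → ℂ := fun p => E p.1.1 * (cosQuot (2 * Real.pi * p.1.1) p.1.2 : ℂ) *
    (Real.exp (-Real.pi * (p.2 * p.1.1) ^ 2) : ℂ) with hΨ
  have hgs : ∀ ξ : ℝ, ξ ≠ 0 → Integrable fun s : ℝ => Real.exp (-Real.pi * (s * ξ) ^ 2) :=
    fun ξ hξ => integrable_gaussian.comp_mul_right' hξ
  have hgi : ∀ ξ : ℝ, ξ ≠ 0 → ∫ s : ℝ, Real.exp (-Real.pi * (s * ξ) ^ 2) = |ξ|⁻¹ := by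
    intro ξ _
    rw [Measure.integral_comp_mul_right (fun t => Real.exp (-Real.pi * t ^ 2)) ξ, integral_gaussian,
      div_self Real.pi_ne_zero, Real.sqrt_one, smul_eq_mul, mul_one, abs_inv]
  have hne : ∀ᵐ p : ℝ × ℝ ∂(volume.prod (volume.restrict (Ioi 0))), p.1 ≠ 0 :=
    Measure.quasiMeasurePreserving_fst.ae (p := fun ξ : ℝ => ξ ≠ 0) (by
      simp [ae_iff, measure_singleton])
  have hw : Integrable (fun p : ℝ × ℝ => (|p.1|⁻¹ : ℝ) * E p.1 *
      (cosQuot (2 * Real.pi * p.1) p.2 : ℂ)) (volume.prod (volume.restrict (Ioi 0))) := by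
    refine integrable_mul_cosQuot (w := fun ξ => (|ξ|⁻¹ : ℝ) * E ξ) ?_ ?_
    · exact (by fun_prop : Measurable fun ξ : ℝ => |ξ|⁻¹).complex_ofReal.aestronglyMeasurable.mul hEi.1
    · refine hEi.norm.congr ?_
      have : ∀ᵐ ξ : ℝ, ξ ≠ 0 := by simp [ae_iff, measure_singleton]
      filter_upwards [this] with ξ hξ
      rw [norm_mul (((|ξ|⁻¹ : ℝ)) : ℂ) (E ξ), Complex.norm_real, norm_inv, Real.norm_eq_abs, abs_abs, ← mul_assoc,
        mul_inv_cancel₀ (abs_ne_zero.2 hξ), one_mul]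
  have hΨm : AEStronglyMeasurable Ψ ((volume.prod (volume.restrict (Ioi 0))).prod volume) := by
    have h1 : Measurable fun p : ℝ × ℝ => cosQuot (2 * Real.pi * p.1) p.2 := by
      unfold cosQuot; fun_prop
    have h2 : AEStronglyMeasurable (fun p : ℝ × ℝ => E p.1 * (cosQuot (2 * Real.pi * p.1) p.2 : ℂ))
        (volume.prod (volume.restrict (Ioi 0))) :=
      hEi.1.comp_fst.mul h1.complex_ofReal.aestronglyMeasurable
    exact h2.comp_fst.mul (by fun_prop)
  have hΨi : Integrable Ψ ((volume.prod (volume.restrict (Ioi 0))).prod volume) := by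
    refine (integrable_prod_iff hΨm).2 ⟨?_, ?_⟩
    · filter_upwards [hne] with p hp
      exact ((hgs p.1 hp).ofReal (𝕜 := ℂ)).const_mul
        (E p.1 * (cosQuot (2 * Real.pi * p.1) p.2 : ℂ))
    · refine hw.norm.congr ?_
      filter_upwards [hne] with p hp
      simp only [hΨ, norm_mul, Complex.norm_real, Real.norm_of_nonneg (Real.exp_pos _).le]
      rw [integral_const_mul, hgi p.1 hp, norm_inv, Real.norm_eq_abs, abs_abs]
      ring
  have hG : ∀ᵐ s : ℝ, ∫ p, Ψ (p, s) ∂(volume.prod (volume.restrict (Ioi 0)))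
      = ((∫ v in Ioi 0, ∫ t : ℝ,
        Real.exp (-Real.pi * t ^ 2) * symmDiffQuot h (y + s * t) v : ℝ) : ℂ) := by
    filter_upwards [hΨi.prod_left_ae] with s hs
    rw [integral_prod_symm _ hs, ← integral_complex_ofReal]
    refine integral_congr_ae (ae_of_all _ fun v => ?_)
    exact (integral_gaussian_mul_symmDiffQuot hc hM hH hinv s y v).symm
  have hGi : Integrable fun s : ℝ => ((∫ v in Ioi 0, ∫ t : ℝ,
        Real.exp (-Real.pi * t ^ 2) * symmDiffQuot h (y + s * t) v : ℝ) : ℂ) :=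
    hΨi.integral_prod_right.congr hG
  refine ⟨?_, ?_⟩
  · exact hGi.re
  · apply Complex.ofReal_injective
    rw [← integral_complex_ofReal, ← integral_congr_ae hG, ← integral_prod_symm _ hΨi,
      integral_prod _ hΨi]
    have e1 : ∫ p : ℝ × ℝ, (∫ s : ℝ, Ψ (p, s)) ∂(volume.prod (volume.restrict (Ioi 0)))
        = ∫ p : ℝ × ℝ, (|p.1|⁻¹ : ℝ) * E p.1 * (cosQuot (2 * Real.pi * p.1) p.2 : ℂ)
          ∂(volume.prod (volume.restrict (Ioi 0))) := by
      refine integral_congr_ae ?_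
      filter_upwards [hne] with p hp
      simp only [hΨ]
      rw [integral_const_mul, integral_complex_ofReal, hgi p.1 hp]
      ring
    rw [e1, integral_prod _ hw]
    have e2 : ∀ᵐ ξ : ℝ, ∫ v in Ioi 0, ((|ξ|⁻¹ : ℝ) * E ξ * (cosQuot (2 * Real.pi * ξ) v : ℂ))
        = (2 * Real.pi ^ 2 : ℝ) * E ξ := by
      have : ∀ᵐ ξ : ℝ, ξ ≠ 0 := by simp [ae_iff, measure_singleton]
      filter_upwards [this] with ξ hξ
      rw [integral_const_mul, integral_complex_ofReal, integral_cosQuot_eq_abs_mul,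
        integral_cosQuot_one, abs_mul, abs_of_pos Real.two_pi_pos]
      have : ((|ξ| : ℝ) : ℂ) ≠ 0 := by exact_mod_cast abs_ne_zero.2 hξ
      push_cast
      field_simp
    rw [integral_congr_ae e2, integral_const_mul, ← hinv, ← Complex.ofReal_mul]

theorem SchwartzMap.exists_abs_le_inv_one_add_sq_mul (g : SchwartzMap (ℝ × ℝ) ℝ) :
    ∃ C, 0 ≤ C ∧ ∀ x z, |g (x, z)| ≤ C * (1 + x ^ 2)⁻¹ * (1 + z ^ 2)⁻¹ := by
  refine ⟨2 ^ 4 * ((Finset.Iic (4, 0)).sup fun m => SchwartzMap.seminorm ℝ m.1 m.2) g,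
    by positivity, fun x z => ?_⟩
  have h := SchwartzMap.one_add_le_sup_seminorm_apply (𝕜 := ℝ) (m := (4, 0)) (k := 4) (n := 0)
    le_rfl le_rfl g (x, z)
  simp only [norm_iteratedFDeriv_zero, Real.norm_eq_abs] at h
  have hx : |x| ≤ ‖(x, z)‖ := norm_fst_le (x, z)
  have hz : |z| ≤ ‖(x, z)‖ := norm_snd_le (x, z)
  set r := ‖(x, z)‖
  have hr : 0 ≤ r := norm_nonneg _
  have key : (1 + x ^ 2) * (1 + z ^ 2) ≤ (1 + r) ^ 4 := by
    have h1 : 1 + x ^ 2 ≤ (1 + r) ^ 2 := by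
      nlinarith [sq_abs x, abs_nonneg x, mul_self_le_mul_self (abs_nonneg x) hx]
    have h2 : 1 + z ^ 2 ≤ (1 + r) ^ 2 := by
      nlinarith [sq_abs z, abs_nonneg z, mul_self_le_mul_self (abs_nonneg z) hz]
    calc _ ≤ (1 + r) ^ 2 * (1 + r) ^ 2 := by gcongr
      _ = _ := by ring
  rw [mul_assoc, ← mul_inv, ← div_eq_mul_inv, le_div_iff₀ (by positivity)]
  calc |g (x, z)| * ((1 + x ^ 2) * (1 + z ^ 2)) ≤ |g (x, z)| * (1 + r) ^ 4 := by gcongr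
    _ = (1 + r) ^ 4 * |g (x, z)| := mul_comm _ _
    _ ≤ _ := h

theorem SchwartzMap.hasDerivAt_snd (g : SchwartzMap (ℝ × ℝ) ℝ) (x z : ℝ) :
    HasDerivAt (fun z => g (x, z)) ((∂_{((0 : ℝ), (1 : ℝ))} g : SchwartzMap (ℝ × ℝ) ℝ) (x, z)) z := by
  rw [SchwartzMap.lineDerivOp_apply_eq_fderiv]
  exact (g.hasFDerivAt (x := (x, z))).comp_hasDerivAt z
    ((hasDerivAt_const z x).prodMk (hasDerivAt_id z))

theorem SchwartzMap.hasDerivAt_fst (g : SchwartzMap (ℝ × ℝ) ℝ) (x z : ℝ) :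
    HasDerivAt (fun x => g (x, z)) ((∂_{((1 : ℝ), (0 : ℝ))} g : SchwartzMap (ℝ × ℝ) ℝ) (x, z)) x := by
  rw [SchwartzMap.lineDerivOp_apply_eq_fderiv]
  exact (g.hasFDerivAt (x := (x, z))).comp_hasDerivAt x
    ((hasDerivAt_id x).prodMk (hasDerivAt_const x z))

theorem SchwartzMap.exists_abs_sub_le (g : SchwartzMap (ℝ × ℝ) ℝ) :
    ∃ C, 0 ≤ C ∧ ∀ x x₀ z, |g (x, z) - g (x₀, z)| ≤ C * |x - x₀| * (1 + z ^ 2)⁻¹ := by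
  obtain ⟨C, hC, h⟩ :=
    (∂_{((1 : ℝ), (0 : ℝ))} g : SchwartzMap (ℝ × ℝ) ℝ).exists_abs_le_inv_one_add_sq_mul
  refine ⟨C, hC, fun x x₀ z => ?_⟩
  have := convex_univ.norm_image_sub_le_of_norm_hasDerivWithin_le (𝕜 := ℝ)
    (f := fun x => g (x, z)) (C := C * (1 + z ^ 2)⁻¹)
    (fun x _ => (g.hasDerivAt_fst x z).hasDerivWithinAt) (fun x _ => ?_) (mem_univ x₀) (mem_univ x)
  · simp only [Real.norm_eq_abs] at this
    linarith
  · refine (h x z).trans ?_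
    gcongr
    refine mul_le_of_le_one_right hC (inv_le_one_of_one_le₀ (by nlinarith [sq_nonneg x]))

theorem SchwartzMap.exists_fourier_slice (f : SchwartzMap (ℝ × ℝ) ℝ) (x₀ : ℝ) :
    ∃ H : ℝ → ℂ, Integrable H ∧ ∀ z, (f (x₀, z) : ℂ)
      = ∫ ξ : ℝ, Complex.exp ((2 * Real.pi * ξ * z : ℝ) * Complex.I) * H ξ := by
  have hgr : Function.HasTemperateGrowth fun z : ℝ => (x₀, z) := by
    have : (fun z : ℝ => (x₀, z)) = fun z => (x₀, 0) + ContinuousLinearMap.inr ℝ ℝ ℝ z := by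
      ext z <;> simp
    rw [this]
    fun_prop
  let h : SchwartzMap ℝ ℂ := SchwartzMap.postcompCLM (𝕜 := ℝ) Complex.ofRealCLM
    (SchwartzMap.compCLM ℝ hgr ⟨1, 1, fun z => by
      rw [pow_one, one_mul]
      have : ‖z‖ ≤ ‖(x₀, z)‖ := norm_snd_le (x₀, z)
      linarith⟩ f)
  have hh : ∀ z, h z = (f (x₀, z) : ℂ) := fun z => rfl
  refine ⟨(𝓕 h : SchwartzMap ℝ ℂ), (𝓕 h : SchwartzMap ℝ ℂ).integrable, fun z => ?_⟩
  rw [← hh, ← congrFun (h.continuous.fourierInv_fourier_eq h.integrable ?_) z, Real.fourierInv_eq']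
  · refine integral_congr_ae (ae_of_all _ fun ξ => ?_)
    simp only [SchwartzMap.fourier_coe, smul_eq_mul, RCLike.inner_apply, conj_trivial]
    congr 3
    push_cast
    ring
  · rw [← SchwartzMap.fourier_coe]
    exact (𝓕 h : SchwartzMap ℝ ℂ).integrable

theorem SchwartzMap.integrable_slice (g : SchwartzMap (ℝ × ℝ) ℝ) {b : ℝ → ℝ} (hb : Continuous b) :
    Integrable fun x => g (x, b x) := by
  obtain ⟨C, hC, h⟩ := g.exists_abs_le_inv_one_add_sq_mul
  refine (integrable_inv_one_add_sq.const_mul C).mono' (by fun_prop) (ae_of_all _ fun x => ?_)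
  refine (h x (b x)).trans (mul_le_of_le_one_right (by positivity) ?_)
  exact inv_le_one_of_one_le₀ (by nlinarith [sq_nonneg (b x)])

theorem SchwartzMap.exists_abs_integral_slice_le (g : SchwartzMap (ℝ × ℝ) ℝ) :
    ∃ M, ∀ b : ℝ → ℝ, |∫ x, g (x, b x)| ≤ M := by
  obtain ⟨C, hC, h⟩ := g.exists_abs_le_inv_one_add_sq_mul
  refine ⟨∫ x : ℝ, C * (1 + x ^ 2)⁻¹, fun b => ?_⟩
  rw [← Real.norm_eq_abs]
  refine norm_integral_le_of_norm_le (integrable_inv_one_add_sq.const_mul C)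
    (ae_of_all _ fun x => ?_)
  refine (h x (b x)).trans (mul_le_of_le_one_right (by positivity) ?_)
  exact inv_le_one_of_one_le₀ (by nlinarith [sq_nonneg (b x)])

theorem SchwartzMap.hasDerivAt_integral_slice (g : SchwartzMap (ℝ × ℝ) ℝ) {b : ℝ → ℝ}
    (hb : Continuous b) (u : ℝ) :
    HasDerivAt (fun u => ∫ x, g (x, b x + u))
      (∫ x, (∂_{((0 : ℝ), (1 : ℝ))} g : SchwartzMap (ℝ × ℝ) ℝ) (x, b x + u)) u := by
  obtain ⟨C, hC, h⟩ :=
    (∂_{((0 : ℝ), (1 : ℝ))} g : SchwartzMap (ℝ × ℝ) ℝ).exists_abs_le_inv_one_add_sq_mul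
  refine (hasDerivAt_integral_of_dominated_loc_of_deriv_le (s := univ)
    (bound := fun x => C * (1 + x ^ 2)⁻¹)
    (F' := fun u x => (∂_{((0 : ℝ), (1 : ℝ))} g : SchwartzMap (ℝ × ℝ) ℝ) (x, b x + u)) univ_mem
    (Eventually.of_forall fun u => ?_) (g.integrable_slice (by fun_prop)) (by fun_prop)
    (ae_of_all _ fun x u _ => ?_) (integrable_inv_one_add_sq.const_mul C)
    (ae_of_all _ fun x u _ => ?_)).2
  · fun_prop
  · refine (h x _).trans (mul_le_of_le_one_right (by positivity) ?_)
    exact inv_le_one_of_one_le₀ (by nlinarith [sq_nonneg (b x + u)])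
  · exact (g.hasDerivAt_snd x (b x + u)).comp_const_add (b x) u

theorem SchwartzMap.integrable_integral_slice (g : SchwartzMap (ℝ × ℝ) ℝ) {b : ℝ → ℝ}
    (hb : Continuous b) : Integrable fun u => ∫ x, g (x, b x + u) := by
  obtain ⟨C, hC, h⟩ := g.exists_abs_le_inv_one_add_sq_mul
  have hI : Integrable (fun p : ℝ × ℝ => g (p.1, b p.1 + p.2)) (volume.prod volume) := by
    have hsh : ∀ x, Integrable fun u : ℝ => (1 + (b x + u) ^ 2)⁻¹ := fun x =>
      integrable_inv_one_add_sq.comp_add_left (b x)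
    have hB : Integrable (fun p : ℝ × ℝ => C * (1 + p.1 ^ 2)⁻¹ * (1 + (b p.1 + p.2) ^ 2)⁻¹)
        (volume.prod volume) := by
      refine (integrable_prod_iff (Measurable.aestronglyMeasurable (by fun_prop))).2
        ⟨ae_of_all _ fun x => (hsh x).const_mul (C * (1 + x ^ 2)⁻¹), ?_⟩
      refine ((integrable_inv_one_add_sq.const_mul C).mul_const Real.pi).congr
        (ae_of_all _ fun x => ?_)
      have : ∀ u, ‖C * (1 + x ^ 2)⁻¹ * (1 + (b x + u) ^ 2)⁻¹‖
          = C * (1 + x ^ 2)⁻¹ * (1 + (b x + u) ^ 2)⁻¹ := fun u =>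
        Real.norm_of_nonneg (by positivity)
      simp only [this]
      rw [integral_const_mul, integral_add_left_eq_self (fun u : ℝ => (1 + u ^ 2)⁻¹),
        integral_univ_inv_one_add_sq]
    exact hB.mono' (by fun_prop) (ae_of_all _ fun p => h _ _)
  exact hI.integral_prod_right

theorem integral_symmDiffQuot_affine_eq_zero {D : ℝ → ℝ} (hD : Integrable D) (y v : ℝ) {a : ℝ}
    (ha : a ≠ 0) : ∫ s : ℝ, symmDiffQuot D (y + s * a) v = 0 := by
  have hi : ∀ z, Integrable fun s : ℝ => D (z + s * a) := fun z =>
    (hD.comp_add_left z).comp_mul_right' ha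
  have he : ∀ z, ∫ s : ℝ, D (z + s * a) = |a⁻¹| * ∫ t, D t := fun z => by
    rw [Measure.integral_comp_mul_right (fun t => D (z + t)) a, integral_add_left_eq_self,
      smul_eq_mul]
  have hi2 : Integrable fun s : ℝ => 2 * D (y + s * a) - D (y - v + s * a) :=
    ((hi y).const_mul 2).sub (hi _)
  calc _ = ∫ s : ℝ, (2 * D (y + s * a) - D (y - v + s * a) - D (y + v + s * a)) / v ^ 2 := by
        refine integral_congr_ae (ae_of_all _ fun s => ?_)
        simp only [symmDiffQuot]
        rw [show y + s * a - v = y - v + s * a by ring, show y + s * a + v = y + v + s * a by ring]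
    _ = 0 := by
        rw [integral_div, integral_sub hi2 (hi _), integral_sub ((hi y).const_mul 2) (hi _),
          integral_const_mul, he, he, he]
        ring

theorem integrable_symmDiffQuot_affine {D D' D'' : ℝ → ℝ} (hD : ∀ z, HasDerivAt D (D' z) z)
    (hD' : ∀ z, HasDerivAt D' (D'' z) z) {B : ℝ} (h0 : ∀ w, |D w| ≤ B * (1 + w ^ 2)⁻¹)
    (h2 : ∀ w, |D'' w| ≤ B * (1 + w ^ 2)⁻¹) (y v : ℝ) (hv : 0 < v) {a : ℝ} (ha : a ≠ 0) :
    Integrable (fun s : ℝ => symmDiffQuot D (y + s * a) v) ∧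
      ∫ s : ℝ, ‖symmDiffQuot D (y + s * a) v‖ ≤ 36 * Real.pi * (B / |a|) * (1 + v ^ 2)⁻¹ := by
  have hDc : Continuous D := continuous_iff_continuousAt.2 fun z => (hD z).continuousAt
  have hi : ∀ z, Integrable fun s : ℝ => (1 + (z + s * a) ^ 2)⁻¹ := fun z =>
    (integrable_inv_one_add_sq.comp_add_left z).comp_mul_right' ha
  have he : ∀ z, ∫ s : ℝ, (1 + (z + s * a) ^ 2)⁻¹ = |a|⁻¹ * Real.pi := fun z => by
    rw [Measure.integral_comp_mul_right (fun t => (1 + (z + t) ^ 2)⁻¹) a,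
      integral_add_left_eq_self (fun t : ℝ => (1 + t ^ 2)⁻¹), integral_univ_inv_one_add_sq,
      smul_eq_mul, abs_inv]
  have hi2 : Integrable fun s : ℝ => (1 + (y + s * a) ^ 2)⁻¹ + (1 + (y - v + s * a) ^ 2)⁻¹ :=
    (hi _).add (hi _)
  have hP : Integrable fun s : ℝ => 12 * B * (1 + v ^ 2)⁻¹ * ((1 + (y + s * a) ^ 2)⁻¹ +
      (1 + (y - v + s * a) ^ 2)⁻¹ + (1 + (y + v + s * a) ^ 2)⁻¹) :=
    (hi2.add (hi _)).const_mul _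
  have hle : ∀ s : ℝ, ‖symmDiffQuot D (y + s * a) v‖ ≤ 12 * B * (1 + v ^ 2)⁻¹ *
      ((1 + (y + s * a) ^ 2)⁻¹ + (1 + (y - v + s * a) ^ 2)⁻¹ + (1 + (y + v + s * a) ^ 2)⁻¹) := by
    intro s
    have := abs_symmDiffQuot_le_of_decay hD hD' h0 h2 (y + s * a) v hv
    rwa [show y + s * a - v = y - v + s * a by ring,
      show y + s * a + v = y + v + s * a by ring] at this
  have hInt : Integrable (fun s : ℝ => symmDiffQuot D (y + s * a) v) :=
    hP.mono' (by unfold symmDiffQuot; fun_prop) (ae_of_all _ hle)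
  refine ⟨hInt, (integral_mono hInt.norm hP hle).trans (le_of_eq ?_)⟩
  rw [integral_const_mul, integral_add hi2 (hi _), integral_add (hi _) (hi _), he, he, he]
  ring

theorem integrable_min_div_abs {a ρ : ℝ → ℝ} {x₀ a' ρ' : ℝ} (ha : StrictMono a) (ha0 : a x₀ = 0)
    (had : HasDerivAt a a' x₀) (ha' : a' ≠ 0) (hac : Continuous a) (hρc : Continuous ρ)
    (hρ : Integrable ρ) (hρ0 : ∀ x, 0 ≤ ρ x) (hρ1 : ρ x₀ = 1) (hρd : HasDerivAt ρ ρ' x₀) :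
    Integrable fun x => min (|x - x₀| + |1 - ρ x|) ((1 + x ^ 2)⁻¹ + ρ x) / |a x| := by
  have hO : (fun x => |x - x₀| + |1 - ρ x|) =O[𝓝 x₀] a := by
    have h1 : (fun x => x - x₀) =O[𝓝 x₀] a := by
      have := (had.isTheta_sub ha').2
      simpa [ha0, Function.comp_def] using this
    have h2 : (fun x => 1 - ρ x) =O[𝓝 x₀] fun x => x - x₀ := by
      have := hρd.isBigO_sub.neg_left
      simpa [hρ1] using this
    exact h1.norm_left.add (h2.trans h1).norm_left
  obtain ⟨L, hL0, hL⟩ := hO.exists_nonneg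
  obtain ⟨δ, hδ, hball⟩ := Metric.eventually_nhds_iff.1 hL.bound
  set m := min (a (x₀ + δ)) (-a (x₀ - δ)) with hm
  have hmpos : 0 < m := by
    have h1 : a x₀ < a (x₀ + δ) := ha (by linarith)
    have h2 : a (x₀ - δ) < a x₀ := ha (by linarith)
    exact lt_min (by linarith) (by linarith)
  have hbd : Integrable fun x => (Metric.ball x₀ δ).indicator (fun _ => L) x +
      ((1 + x ^ 2)⁻¹ + ρ x) / m := by
    refine Integrable.add ?_ ((integrable_inv_one_add_sq.add hρ).div_const m)
    exact (integrable_indicator_iff measurableSet_ball).2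
      (integrableOn_const measure_ball_lt_top.ne)
  have hdom0 : ∀ x, 0 ≤ (1 + x ^ 2)⁻¹ + ρ x := fun x => add_nonneg (by positivity) (hρ0 x)
  refine hbd.mono' (Measurable.aestronglyMeasurable (by fun_prop)) (ae_of_all _ fun x => ?_)
  have hmin0 : 0 ≤ min (|x - x₀| + |1 - ρ x|) ((1 + x ^ 2)⁻¹ + ρ x) :=
    le_min (by positivity) (hdom0 x)
  rw [Real.norm_of_nonneg (div_nonneg hmin0 (abs_nonneg _))]
  by_cases hx : x ∈ Metric.ball x₀ δ
  · rw [indicator_of_mem hx]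
    refine le_add_of_le_of_nonneg ?_ (div_nonneg (hdom0 x) hmpos.le)
    refine div_le_of_le_mul₀ (abs_nonneg _) hL0 ((min_le_left _ _).trans ?_)
    have := hball hx
    rwa [Real.norm_of_nonneg (by positivity), Real.norm_eq_abs] at this
  · rw [indicator_of_notMem hx, zero_add]
    have hma : m ≤ |a x| := by
      rw [Metric.mem_ball, Real.dist_eq, not_lt, le_abs] at hx
      rcases hx with hx | hx
      · exact (min_le_left _ _).trans ((ha.monotone (by linarith)).trans (le_abs_self _))
      · refine (min_le_right _ _).trans (le_trans ?_ (neg_le_abs _))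
        exact neg_le_neg (ha.monotone (by linarith))
    exact div_le_div₀ (hdom0 x) (min_le_right _ _) hmpos hma

theorem SchwartzMap.pv_deriv_integral_slice (f : SchwartzMap (ℝ × ℝ) ℝ) {b : ℝ → ℝ}
    (hb : Continuous b) (w : ℝ) :
    pv (fun u => deriv (fun u' => ∫ x, f (x, b x + u')) u / (w - u)) w
      = ∫ v in Ioi 0, ∫ x, symmDiffQuot (fun z => f (x, z)) (b x + w) v := by
  have hd : ∀ u, deriv (fun u' => ∫ x, f (x, b x + u')) u
      = ∫ x, (∂_{((0 : ℝ), (1 : ℝ))} f : SchwartzMap (ℝ × ℝ) ℝ) (x, b x + u) := fun u =>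
    (f.hasDerivAt_integral_slice hb u).deriv
  simp only [hd]
  obtain ⟨M₀, h0⟩ := f.exists_abs_integral_slice_le
  obtain ⟨M₂, h2⟩ := (∂_{((0 : ℝ), (1 : ℝ))} (∂_{((0 : ℝ), (1 : ℝ))} f :
    SchwartzMap (ℝ × ℝ) ℝ) : SchwartzMap (ℝ × ℝ) ℝ).exists_abs_integral_slice_le
  rw [pv_deriv_div_eq (M := max M₀ M₂) (f.hasDerivAt_integral_slice hb)
    (SchwartzMap.hasDerivAt_integral_slice _ hb) (fun _ => (h0 _).trans (le_max_left _ _))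
    (fun _ => (h2 _).trans (le_max_right _ _)) (SchwartzMap.integrable_integral_slice _ hb)]
  refine integral_congr_ae (ae_of_all _ fun v => ?_)
  have hi : ∀ z, Integrable fun x => f (x, b x + z) := fun z => f.integrable_slice (by fun_prop)
  have hi2 : Integrable fun x => 2 * f (x, b x + w) - f (x, b x + (w - v)) :=
    ((hi w).const_mul 2).sub (hi _)
  simp only [symmDiffQuot, add_sub_assoc, add_assoc]
  rw [integral_div, ← integral_const_mul, ← integral_sub ((hi w).const_mul 2) (hi _),
    ← integral_sub hi2 (hi _)]

theorem integrable_prod_of_abs_le_mul_inv {k : ℝ × ℝ → ℝ} {w : ℝ → ℝ}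
    (hk : AEStronglyMeasurable k (volume.prod (volume.restrict (Ioi 0)))) (hw : Integrable w)
    (h : ∀ᵐ x, ∀ v, 0 < v → |k (x, v)| ≤ w x * (1 + v ^ 2)⁻¹) :
    Integrable k (volume.prod (volume.restrict (Ioi 0))) := by
  refine (hw.mul_prod (integrableOn_inv_one_add_sq (Ioi 0))).mono' hk ?_
  filter_upwards [Measure.quasiMeasurePreserving_fst.ae h,
    Measure.quasiMeasurePreserving_snd.ae (ae_restrict_mem measurableSet_Ioi)] with p hp hv
  exact hp p.2 hv

theorem SchwartzMap.exists_abs_sub_mul_le (f : SchwartzMap (ℝ × ℝ) ℝ) :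
    ∃ C, 0 ≤ C ∧ ∀ x x₀ r z, 0 ≤ r → |f (x, z) - r * f (x₀, z)|
      ≤ C * min (|x - x₀| + |1 - r|) ((1 + x ^ 2)⁻¹ + r) * (1 + z ^ 2)⁻¹ := by
  obtain ⟨C₁, h1, hC₁⟩ := f.exists_abs_le_inv_one_add_sq_mul
  obtain ⟨C₂, h2, hC₂⟩ := f.exists_abs_sub_le
  refine ⟨max C₁ C₂, h1.trans (le_max_left _ _), fun x x₀ r z hr => ?_⟩
  have hC1 := le_max_left C₁ C₂
  have hC2 := le_max_right C₁ C₂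
  have hb : ∀ x, |f (x, z)| ≤ max C₁ C₂ * (1 + x ^ 2)⁻¹ * (1 + z ^ 2)⁻¹ := fun x =>
    (hC₁ x z).trans (by gcongr)
  have hb1 : |f (x₀, z)| ≤ max C₁ C₂ * (1 + z ^ 2)⁻¹ := by
    refine (hb x₀).trans ?_
    gcongr
    exact mul_le_of_le_one_right (h1.trans hC1)
      (inv_le_one_of_one_le₀ (by nlinarith [sq_nonneg x₀]))
  have hl : |f (x, z) - f (x₀, z)| ≤ max C₁ C₂ * |x - x₀| * (1 + z ^ 2)⁻¹ :=
    (hC₂ x x₀ z).trans (by gcongr)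
  rw [mul_min_of_nonneg _ _ (h1.trans hC1), min_mul_of_nonneg _ _ (by positivity)]
  refine le_min ?_ ?_
  · calc |f (x, z) - r * f (x₀, z)| = |(f (x, z) - f (x₀, z)) + (1 - r) * f (x₀, z)| := by
          congr 1; ring
      _ ≤ |f (x, z) - f (x₀, z)| + |1 - r| * |f (x₀, z)| := by
          rw [← abs_mul]; exact abs_add_le _ _
      _ ≤ max C₁ C₂ * |x - x₀| * (1 + z ^ 2)⁻¹ +
            |1 - r| * (max C₁ C₂ * (1 + z ^ 2)⁻¹) := by gcongr
      _ = _ := by ring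
  · calc |f (x, z) - r * f (x₀, z)| ≤ |f (x, z)| + r * |f (x₀, z)| := by
          rw [← abs_of_nonneg hr, ← abs_mul, abs_of_nonneg hr]; exact abs_sub _ _
      _ ≤ max C₁ C₂ * (1 + x ^ 2)⁻¹ * (1 + z ^ 2)⁻¹ + r * (max C₁ C₂ * (1 + z ^ 2)⁻¹) := by
          gcongr; exact hb x
      _ = _ := by ring

theorem SchwartzMap.exists_abs_symmDiffQuot_slice_le (f : SchwartzMap (ℝ × ℝ) ℝ) :
    ∃ C, ∀ x z v, 0 < v →
      |symmDiffQuot (fun z => f (x, z)) z v| ≤ C * (1 + x ^ 2)⁻¹ * (1 + v ^ 2)⁻¹ := by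
  set f₁ : SchwartzMap (ℝ × ℝ) ℝ := ∂_{((0 : ℝ), (1 : ℝ))} f
  set f₂ : SchwartzMap (ℝ × ℝ) ℝ := ∂_{((0 : ℝ), (1 : ℝ))} f₁
  obtain ⟨C₀, h0, hC₀⟩ := f.exists_abs_le_inv_one_add_sq_mul
  obtain ⟨C₂, h2, hC₂⟩ := f₂.exists_abs_le_inv_one_add_sq_mul
  have hone : ∀ w : ℝ, (1 + w ^ 2)⁻¹ ≤ 1 := fun w =>
    inv_le_one_of_one_le₀ (by nlinarith [sq_nonneg w])
  refine ⟨8 * max C₀ C₂, fun x z v hv => ?_⟩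
  rw [mul_assoc 8]
  refine abs_symmDiffQuot_le (f.hasDerivAt_snd x) (f₁.hasDerivAt_snd x) (fun w => ?_)
    (fun w => ?_) _ v hv
  · refine (hC₀ x w).trans ((mul_le_of_le_one_right (by positivity) (hone w)).trans ?_)
    gcongr; exact le_max_left _ _
  · refine (hC₂ x w).trans ((mul_le_of_le_one_right (by positivity) (hone w)).trans ?_)
    gcongr; exact le_max_right _ _

theorem SchwartzMap.integrable_symmDiffQuot_slice (f : SchwartzMap (ℝ × ℝ) ℝ) {b : ℝ → ℝ}
    (hb : Continuous b) :
    Integrable (fun p : ℝ × ℝ => symmDiffQuot (fun z => f (p.1, z)) (b p.1) p.2)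
      (volume.prod (volume.restrict (Ioi 0))) := by
  obtain ⟨C, hC⟩ := f.exists_abs_symmDiffQuot_slice_le
  refine integrable_prod_of_abs_le_mul_inv ?_ (integrable_inv_one_add_sq.const_mul C)
    (ae_of_all _ fun x v hv => hC x _ v hv)
  unfold symmDiffQuot
  exact Measurable.aestronglyMeasurable (by fun_prop)

theorem SchwartzMap.integrable_mul_symmDiffQuot_slice (f : SchwartzMap (ℝ × ℝ) ℝ) {b ρ : ℝ → ℝ}
    (hb : Continuous b) (hρc : Continuous ρ) (hρ : Integrable ρ) (x₀ : ℝ) :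
    Integrable (fun p : ℝ × ℝ => ρ p.1 * symmDiffQuot (fun z => f (x₀, z)) (b p.1) p.2)
      (volume.prod (volume.restrict (Ioi 0))) := by
  obtain ⟨C, hC⟩ := f.exists_abs_symmDiffQuot_slice_le
  refine integrable_prod_of_abs_le_mul_inv (w := fun x => |ρ x| * (C * (1 + x₀ ^ 2)⁻¹)) ?_
    (hρ.abs.mul_const _) (ae_of_all _ fun x v hv => ?_)
  · unfold symmDiffQuot
    exact Measurable.aestronglyMeasurable (by fun_prop)
  · rw [abs_mul, mul_assoc]
    exact mul_le_mul_of_nonneg_left (hC x₀ _ v hv) (abs_nonneg _)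

/-- The part of the double integral in which the weight vanishes at the zero of `a` has
integral zero over all slopes. -/
theorem SchwartzMap.integral_symmDiffQuot_remainder (f : SchwartzMap (ℝ × ℝ) ℝ) {a ρ : ℝ → ℝ}
    {x₀ a' ρ' : ℝ} (ha : StrictMono a) (ha0 : a x₀ = 0) (had : HasDerivAt a a' x₀) (ha' : a' ≠ 0)
    (hac : Continuous a) (hρc : Continuous ρ) (hρ : Integrable ρ) (hρ0 : ∀ x, 0 ≤ ρ x)
    (hρ1 : ρ x₀ = 1) (hρd : HasDerivAt ρ ρ' x₀) (y : ℝ) :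
    Integrable (fun s : ℝ => ∫ p : ℝ × ℝ,
      symmDiffQuot (fun z => f (p.1, z) - ρ p.1 * f (x₀, z)) (y + s * a p.1) p.2
        ∂(volume.prod (volume.restrict (Ioi 0)))) ∧
    ∫ s : ℝ, ∫ p : ℝ × ℝ,
      symmDiffQuot (fun z => f (p.1, z) - ρ p.1 * f (x₀, z)) (y + s * a p.1) p.2
        ∂(volume.prod (volume.restrict (Ioi 0))) = 0 := by
  set f₁ : SchwartzMap (ℝ × ℝ) ℝ := ∂_{((0 : ℝ), (1 : ℝ))} f
  set f₂ : SchwartzMap (ℝ × ℝ) ℝ := ∂_{((0 : ℝ), (1 : ℝ))} f₁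
  obtain ⟨C₀, h0, hC₀⟩ := f.exists_abs_sub_mul_le
  obtain ⟨C₂, h2, hC₂⟩ := f₂.exists_abs_sub_mul_le
  set β : ℝ → ℝ := fun x => min (|x - x₀| + |1 - ρ x|) ((1 + x ^ 2)⁻¹ + ρ x) with hβ
  have hβ0 : ∀ x, 0 ≤ β x := fun x =>
    le_min (by positivity) (add_nonneg (by positivity) (hρ0 x))
  have hβi : Integrable fun x => β x / |a x| :=
    integrable_min_div_abs ha ha0 had ha' hac hρc hρ hρ0 hρ1 hρd
  set C := max C₀ C₂
  have hb0 : ∀ x z, |f (x, z) - ρ x * f (x₀, z)| ≤ C * β x * (1 + z ^ 2)⁻¹ := fun x z => by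
    refine (hC₀ x x₀ (ρ x) z (hρ0 x)).trans ?_
    have := hβ0 x
    gcongr; exact le_max_left _ _
  have hb2 : ∀ x z, |f₂ (x, z) - ρ x * f₂ (x₀, z)| ≤ C * β x * (1 + z ^ 2)⁻¹ := fun x z => by
    refine (hC₂ x x₀ (ρ x) z (hρ0 x)).trans ?_
    have := hβ0 x
    gcongr; exact le_max_right _ _
  have hne : ∀ᵐ x : ℝ, a x ≠ 0 := by
    have : ∀ᵐ x : ℝ, x ≠ x₀ := by simp [ae_iff, measure_singleton]
    filter_upwards [this] with x hx h
    exact hx (ha.injective (h.trans ha0.symm))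
  have hkey : ∀ x v, 0 < v → a x ≠ 0 →
      Integrable (fun s : ℝ =>
        symmDiffQuot (fun z => f (x, z) - ρ x * f (x₀, z)) (y + s * a x) v) ∧
      ∫ s : ℝ, ‖symmDiffQuot (fun z => f (x, z) - ρ x * f (x₀, z)) (y + s * a x) v‖
        ≤ 36 * Real.pi * C * (β x / |a x|) * (1 + v ^ 2)⁻¹ := fun x v hv hx => by
    have := integrable_symmDiffQuot_affine
      (fun z => (f.hasDerivAt_snd x z).sub ((f.hasDerivAt_snd x₀ z).const_mul (ρ x)))
      (fun z => (f₁.hasDerivAt_snd x z).sub ((f₁.hasDerivAt_snd x₀ z).const_mul (ρ x)))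
      (hb0 x) (hb2 x) y v hv hx
    refine ⟨this.1, this.2.trans_eq (by ring)⟩
  set μ : Measure (ℝ × ℝ) := volume.prod (volume.restrict (Ioi 0)) with hμ
  have hae : ∀ᵐ p : ℝ × ℝ ∂μ, a p.1 ≠ 0 ∧ 0 < p.2 := by
    filter_upwards [Measure.quasiMeasurePreserving_fst.ae hne,
      Measure.quasiMeasurePreserving_snd.ae (ae_restrict_mem measurableSet_Ioi)] with p hp hv
    exact ⟨hp, hv⟩
  set Θ : (ℝ × ℝ) × ℝ → ℝ := fun q =>
    symmDiffQuot (fun z => f (q.1.1, z) - ρ q.1.1 * f (x₀, z)) (y + q.2 * a q.1.1) q.1.2 with hΘ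
  have hΘm : AEStronglyMeasurable Θ (μ.prod volume) := by
    simp only [hΘ]
    unfold symmDiffQuot
    exact Measurable.aestronglyMeasurable (by fun_prop)
  have hΘi : Integrable Θ (μ.prod volume) := by
    refine (integrable_prod_iff hΘm).2 ⟨?_, ?_⟩
    · filter_upwards [hae] with p hp
      exact (hkey p.1 p.2 hp.2 hp.1).1
    · refine ((hβi.const_mul (36 * Real.pi * C)).mul_prod
        (integrableOn_inv_one_add_sq (Ioi 0))).mono' hΘm.norm.integral_prod_right' ?_
      filter_upwards [hae] with p hp
      rw [Real.norm_of_nonneg (integral_nonneg fun _ => norm_nonneg _)]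
      exact (hkey p.1 p.2 hp.2 hp.1).2
  refine ⟨hΘi.integral_prod_right, ?_⟩
  calc _ = ∫ q, Θ q ∂(μ.prod volume) := (integral_prod_symm _ hΘi).symm
    _ = ∫ p, (∫ s : ℝ, Θ (p, s)) ∂μ := integral_prod _ hΘi
    _ = ∫ p, (0 : ℝ) ∂μ := by
        refine integral_congr_ae ?_
        filter_upwards [hae] with p hp
        have hDi : Integrable fun z => f (p.1, z) - ρ p.1 * f (x₀, z) :=
          (integrable_inv_one_add_sq.const_mul _).mono' (by fun_prop) (ae_of_all _ (hb0 p.1))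
        exact integral_symmDiffQuot_affine_eq_zero hDi y p.2 hp.1
    _ = 0 := integral_zero _ _

theorem integral_comp_mul_deriv_of_bijective {a a' : ℝ → ℝ} (had : ∀ x, HasDerivAt a (a' x) x)
    (ha : Function.Bijective a) (ha0 : ∀ x, 0 ≤ a' x) (k : ℝ → ℝ) :
    ∫ x, a' x * k (a x) = ∫ t, k t := by
  have := integral_image_eq_integral_abs_deriv_smul MeasurableSet.univ
    (fun x _ => (had x).hasDerivWithinAt) ha.injective.injOn k
  simp only [image_univ, ha.surjective.range_eq, Measure.restrict_univ, abs_of_nonneg (ha0 _),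
    smul_eq_mul] at this
  exact this.symm

theorem integrable_comp_mul_deriv_of_bijective {a a' : ℝ → ℝ} (had : ∀ x, HasDerivAt a (a' x) x)
    (ha : Function.Bijective a) (ha0 : ∀ x, 0 ≤ a' x) {k : ℝ → ℝ} (hk : Integrable k) :
    Integrable fun x => a' x * k (a x) := by
  have := integrableOn_image_iff_integrableOn_abs_deriv_smul MeasurableSet.univ
    (fun x _ => (had x).hasDerivWithinAt) ha.injective.injOn k
  simp only [image_univ, ha.surjective.range_eq, integrableOn_univ, abs_of_nonneg (ha0 _),
    smul_eq_mul] at this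
  exact this.1 hk

/-- Inversion of the Radon-type transform along the curves `x ↦ (x, s φ(x) + u)`. -/
theorem SchwartzMap.integral_pv_deriv_phase (f : SchwartzMap (ℝ × ℝ) ℝ) {φ φ' : ℝ → ℝ}
    (hφ : ∀ x, HasDerivAt φ (φ' x) x) (hmono : StrictMono φ) (hsurj : Function.Surjective φ)
    (hφc : Continuous φ') (hφ0 : ∀ x, 0 ≤ φ' x) {x₀ φ'' : ℝ} (hpos : 0 < φ' x₀)
    (hφd : HasDerivAt φ' φ'' x₀) (y : ℝ) :
    ∫ s : ℝ, pv (fun u => deriv (fun u' => ∫ x, f (x, s * φ x + u')) u / (y - s * φ x₀ - u))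
      (y - s * φ x₀) = 2 * Real.pi ^ 2 * f (x₀, y) / φ' x₀ := by
  have hφcont : Continuous φ := continuous_iff_continuousAt.2 fun x => (hφ x).continuousAt
  set a : ℝ → ℝ := fun x => φ x - φ x₀ with ha
  have had : ∀ x, HasDerivAt a (φ' x) x := fun x => (hφ x).sub_const _
  have hac : Continuous a := by fun_prop
  have hamono : StrictMono a := fun x z h => sub_lt_sub_right (hmono h) _
  have habij : Function.Bijective a := ⟨hamono.injective, fun t => by
    obtain ⟨x, hx⟩ := hsurj (t + φ x₀)
    exact ⟨x, by simp [ha, hx]⟩⟩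
  have ha0 : a x₀ = 0 := sub_self _
  set ρ : ℝ → ℝ := fun x => (φ' x * Real.exp (-Real.pi * a x ^ 2)) / φ' x₀ with hρdef
  have hρc : Continuous ρ := by fun_prop
  have hρ : Integrable ρ :=
    (integrable_comp_mul_deriv_of_bijective had habij hφ0 integrable_gaussian).div_const _
  have hρ0 : ∀ x, 0 ≤ ρ x := fun x =>
    div_nonneg (mul_nonneg (hφ0 x) (Real.exp_pos _).le) hpos.le
  have hρ1 : ρ x₀ = 1 := by simp [hρdef, ha0, hpos.ne']
  have hρd := (hφd.mul ((((had x₀).pow 2).const_mul (-Real.pi)).exp)).div_const (φ' x₀)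
  obtain ⟨hEi, hE⟩ := f.integral_symmDiffQuot_remainder hamono ha0 (had x₀) hpos.ne' hac hρc hρ
    hρ0 hρ1 hρd y
  obtain ⟨H, hH, hinv⟩ := f.exists_fourier_slice x₀
  obtain ⟨C, hC, hfC⟩ := f.exists_abs_le_inv_one_add_sq_mul
  have hbd : ∀ z, |f (x₀, z)| ≤ C * (1 + x₀ ^ 2)⁻¹ := fun z =>
    (hfC x₀ z).trans (mul_le_of_le_one_right (by positivity)
      (inv_le_one_of_one_le₀ (by nlinarith [sq_nonneg z])))
  obtain ⟨hGi, hG⟩ := integral_gaussian_average (h := fun z => f (x₀, z)) (by fun_prop) hbd hH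
    hinv y
  have hsplit : ∀ s : ℝ,
      pv (fun u => deriv (fun u' => ∫ x, f (x, s * φ x + u')) u / (y - s * φ x₀ - u))
        (y - s * φ x₀)
      = (∫ p : ℝ × ℝ, symmDiffQuot (fun z => f (p.1, z) - ρ p.1 * f (x₀, z)) (y + s * a p.1) p.2
        ∂(volume.prod (volume.restrict (Ioi 0)))) +
        (∫ v in Ioi 0, ∫ t : ℝ, Real.exp (-Real.pi * t ^ 2) *
          symmDiffQuot (fun z => f (x₀, z)) (y + s * t) v) / φ' x₀ := by
    intro s
    have hF := f.integrable_symmDiffQuot_slice (b := fun x => y + s * a x) (by fun_prop)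
    have hR := f.integrable_mul_symmDiffQuot_slice (b := fun x => y + s * a x) (by fun_prop)
      hρc hρ x₀
    have e1 : (∫ v in Ioi 0, ∫ t : ℝ, Real.exp (-Real.pi * t ^ 2) *
          symmDiffQuot (fun z => f (x₀, z)) (y + s * t) v) / φ' x₀
        = ∫ p : ℝ × ℝ, ρ p.1 * symmDiffQuot (fun z => f (x₀, z)) (y + s * a p.1) p.2
          ∂(volume.prod (volume.restrict (Ioi 0))) := by
      rw [integral_prod_symm _ hR, ← integral_div]
      refine integral_congr_ae (ae_of_all _ fun v => ?_)
      simp only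
      rw [← integral_comp_mul_deriv_of_bijective had habij hφ0, ← integral_div]
      refine integral_congr_ae (ae_of_all _ fun x => ?_)
      simp only [hρdef]
      ring
    have hD : ∀ p : ℝ × ℝ,
        symmDiffQuot (fun z => f (p.1, z) - ρ p.1 * f (x₀, z)) (y + s * a p.1) p.2
        = symmDiffQuot (fun z => f (p.1, z)) (y + s * a p.1) p.2 -
          ρ p.1 * symmDiffQuot (fun z => f (x₀, z)) (y + s * a p.1) p.2 := fun p => by
      unfold symmDiffQuot; ring
    rw [e1]
    simp only [hD]
    rw [integral_sub hF hR, sub_add_cancel, integral_prod_symm _ hF,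
      f.pv_deriv_integral_slice (b := fun x => s * φ x) (by fun_prop)]
    refine integral_congr_ae (ae_of_all _ fun v => integral_congr_ae (ae_of_all _ fun x => ?_))
    simp only [ha]
    congr 1
    ring
  simp only [hsplit]
  rw [integral_add hEi (hGi.div_const _), hE, integral_div, hG, zero_add]

theorem hasDerivAt_abs_rpow_of_ne_zero {p x : ℝ} (hx : x ≠ 0) :
    HasDerivAt (fun x : ℝ => |x| ^ p) (SignType.sign x * p * |x| ^ (p - 1)) x :=
  (hasDerivAt_abs hx).rpow_const (Or.inl (abs_ne_zero.2 hx))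

theorem hasDerivAt_mul_abs_rpow {p : ℝ} (hp : 0 < p) (x : ℝ) :
    HasDerivAt (fun x : ℝ => x * |x| ^ p) ((p + 1) * |x| ^ p) x := by
  rcases eq_or_ne x 0 with rfl | hx
  · rw [abs_zero, Real.zero_rpow hp.ne', mul_zero, hasDerivAt_iff_tendsto_slope_zero]
    have hc : Tendsto (fun t : ℝ => |t| ^ p) (𝓝[≠] 0) (𝓝 0) := by
      have : Continuous fun t : ℝ => |t| ^ p := continuous_abs.rpow_const fun _ => Or.inr hp.le
      simpa [Real.zero_rpow hp.ne'] using (this.tendsto 0).mono_left nhdsWithin_le_nhds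
    refine hc.congr' ?_
    filter_upwards [self_mem_nhdsWithin] with t ht
    simp only [zero_add, zero_mul, sub_zero, smul_eq_mul]
    rw [← mul_assoc, inv_mul_cancel₀ ht, one_mul]
  · refine ((hasDerivAt_id x).mul (hasDerivAt_abs_rpow_of_ne_zero (p := p) hx)).congr_deriv ?_
    have h1 : |x| ^ p = |x| * |x| ^ (p - 1) := by
      rw [Real.rpow_sub_one (abs_ne_zero.2 hx), mul_div_cancel₀ _ (abs_ne_zero.2 hx)]
    have h2 : x * (SignType.sign x : ℝ) = |x| := self_mul_sign x
    rw [id, one_mul, ← mul_assoc, ← mul_assoc, h2, h1]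
    ring

theorem strictMono_mul_abs_rpow {p : ℝ} (hp : 0 < p) : StrictMono fun x : ℝ => x * |x| ^ p := by
  refine strictMono_of_odd_strictMonoOn_nonneg (fun x => by simp) fun x hx z hz h => ?_
  simp only [abs_of_nonneg (mem_Ici.1 hx), abs_of_nonneg (mem_Ici.1 hz)]
  exact mul_lt_mul'' h (Real.rpow_lt_rpow hx h hp) hx (Real.rpow_nonneg hx p)

theorem surjective_mul_abs_rpow {p : ℝ} (hp : 0 < p) :
    Function.Surjective fun x : ℝ => x * |x| ^ p := by
  have hc : Continuous fun x : ℝ => x * |x| ^ p :=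
    continuous_id.mul (continuous_abs.rpow_const fun _ => Or.inr hp.le)
  refine hc.surjective ?_ ?_
  · refine tendsto_atTop_mono' _ ?_ tendsto_id
    filter_upwards [eventually_ge_atTop 1] with x hx
    exact le_mul_of_one_le_right (by simp; linarith)
      (Real.one_le_rpow (hx.trans (le_abs_self x)) hp.le)
  · refine tendsto_atBot_mono' _ ?_ tendsto_id
    filter_upwards [eventually_le_atBot (-1)] with x hx
    have : 1 ≤ |x| ^ p := Real.one_le_rpow (by rw [le_abs]; right; linarith) hp.le
    simp only [id]
    nlinarith

end

/-- Inversion formula for the generalized odd-power Radon transform `Q_α`. -/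
theorem Qalpha_inversion (α c : ℝ) (hα : 1 < α) (m : ℕ) (hm : (m : ℝ) ≥ α - 2)
    (f : SchwartzMap (ℝ × ℝ) ℝ)
    (hvan : ∀ k ≤ m, ∀ y : ℝ, iteratedDeriv k (fun x : ℝ => f (x, y)) c = 0)
    (Q : ℝ → ℝ → ℝ)
    (hQ : ∀ s u : ℝ, Q s u = ∫ x : ℝ, f (x + c, s * x * |x| ^ (α - 1) + u)) :
    ∀ x y : ℝ, x ≠ c →
      f (x, y) = α * |x - c| ^ (α - 1) / (2 * Real.pi ^ 2) *
        ∫ s : ℝ, pv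
          (fun u : ℝ => deriv (fun u' : ℝ => Q s u') u /
            (y - s * (x - c) * |x - c| ^ (α - 1) - u))
          (y - s * (x - c) * |x - c| ^ (α - 1)) := by
  intro x y hx
  have hp : 0 < α - 1 := by linarith
  have hxc : x - c ≠ 0 := sub_ne_zero.2 hx
  have hQ' : ∀ s, (fun u => Q s u)
      = fun u => ∫ x : ℝ, f (x, s * ((x - c) * |x - c| ^ (α - 1)) + u) := fun s => by
    ext u
    rw [hQ, ← integral_add_right_eq_self
      (fun x : ℝ => f (x, s * ((x - c) * |x - c| ^ (α - 1)) + u)) c]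
    simp only [add_sub_cancel_right, mul_assoc]
  have hpos : 0 < α * |x - c| ^ (α - 1) := by
    have := abs_pos.2 hxc
    positivity
  have key := f.integral_pv_deriv_phase (φ := fun x => (x - c) * |x - c| ^ (α - 1))
    (φ' := fun x => α * |x - c| ^ (α - 1)) (x₀ := x)
    (fun x => by
      simpa using (hasDerivAt_mul_abs_rpow hp (x - c)).comp_sub_const x c)
    (fun x z h => strictMono_mul_abs_rpow hp (sub_lt_sub_right h c))
    ((surjective_mul_abs_rpow hp).comp fun t => ⟨t + c, add_sub_cancel_right t c⟩)
    (continuous_const.mul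
      ((continuous_id.sub continuous_const).abs.rpow_const fun _ => Or.inr hp.le))
    (fun x => by positivity) hpos
    (((hasDerivAt_abs_rpow_of_ne_zero hxc).comp_sub_const x c).const_mul α) y
  simp only [hQ', mul_assoc] at key ⊢
  rw [key]
  have : α * |x - c| ^ (α - 1) ≠ 0 := hpos.ne'
  have := Real.pi_ne_zero
  field_simp
end

section
/- Let α > 1, c ∈ ℝ, and f ∈ 𝒮(ℝ²) with f(x+c,y)=f(-x+c,y) and (∂^k f/∂x^k)(c,y)=0 for k=0,…,m, m ≥ α - 2. Define P_α f(s,u) = ∫_ℝ f(x+c, s|x|^α + u) dx. Then for all (x,y) with x ≠ c: f(x,y) = (α|x-c|^{α-1}/(4π²)) ∫_ℝ ( p.v. ∫_ℝ (∂_u P_α f)(s,u)/(y - s|x-c|^α - u) du ) ds. -/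
open MeasureTheory Filter

open scoped SchwartzMap LineDeriv FourierTransform

/-- The integral `∫_{w > 0} (h (v - w) - h (v + w)) / w dw`, that is `π` times the Hilbert
transform of `h` at `v`. -/
noncomputable def hilbertInt (h : ℝ → ℝ) (v : ℝ) : ℝ :=
  ∫ w in Set.Ioi (0 : ℝ), w⁻¹ * (h (v - w) - h (v + w))

lemma abs_inv_mul_sin_le {w : ℝ} (hw : 0 < w) (b : ℝ) : |w⁻¹ * Real.sin (b * w)| ≤ |b| := by
  rw [abs_mul, abs_inv, abs_of_pos hw, inv_mul_le_iff₀ hw]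
  calc |Real.sin (b * w)| ≤ |b * w| := Real.abs_sin_le_abs
    _ = w * |b| := by rw [abs_mul, abs_of_pos hw, mul_comm]

lemma integral_exp_neg_mul_cos {ε : ℝ} (hε : 0 < ε) (b : ℝ) :
    ∫ w in Set.Ioi (0 : ℝ), Real.exp (-ε * w) * Real.cos (b * w) = ε / (ε ^ 2 + b ^ 2) := by
  have ha : ((-ε : ℂ) + b * Complex.I).re < 0 := by simp [hε]
  have h := integral_exp_mul_complex_Ioi ha 0
  have h2 := congrArg Complex.re h
  have hI := integrableOn_exp_mul_complex_Ioi ha 0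
  have h3 := integral_re (𝕜 := ℂ) hI
  simp only [RCLike.re_to_complex] at h3
  rw [← h3] at h2
  have e1 : ∀ w : ℝ, (Complex.exp (((-ε : ℂ) + b * Complex.I) * w)).re
      = Real.exp (-ε * w) * Real.cos (b * w) := by
    intro w
    rw [Complex.exp_re]
    simp
  simp only [e1] at h2
  rw [h2]
  simp [Complex.div_re, Complex.normSq_apply]
  ring

lemma integral_exp_neg_mul_inv_mul_sin {ε : ℝ} (hε : 0 < ε) (b : ℝ) :
    ∫ w in Set.Ioi (0 : ℝ), Real.exp (-ε * w) * (w⁻¹ * Real.sin (b * w)) =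
      Real.arctan (b / ε) := by
  have hexp : IntegrableOn (fun w : ℝ => Real.exp (-ε * w)) (Set.Ioi 0) :=
    integrableOn_exp_mul_Ioi (by linarith) 0
  have hd : ∀ b : ℝ, HasDerivAt (fun b : ℝ => ∫ w in Set.Ioi (0 : ℝ),
      Real.exp (-ε * w) * (w⁻¹ * Real.sin (b * w))) (ε / (ε ^ 2 + b ^ 2)) b := by
    intro b
    rw [← integral_exp_neg_mul_cos hε b]
    refine (hasDerivAt_integral_of_dominated_loc_of_deriv_le
      (F := fun b w : ℝ => Real.exp (-ε * w) * (w⁻¹ * Real.sin (b * w)))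
      (F' := fun b w : ℝ => Real.exp (-ε * w) * Real.cos (b * w))
      (bound := fun w => Real.exp (-ε * w)) (s := Set.univ) Filter.univ_mem
      ?_ ?_ ?_ ?_ hexp ?_).2
    · exact Eventually.of_forall fun b => Measurable.aestronglyMeasurable (by fun_prop)
    · refine (hexp.mul_const |b|).mono' (Measurable.aestronglyMeasurable (by fun_prop)) ?_
      filter_upwards [ae_restrict_mem measurableSet_Ioi] with w hw
      rw [Real.norm_eq_abs, abs_mul, Real.abs_exp]
      exact mul_le_mul_of_nonneg_left (abs_inv_mul_sin_le hw b) (Real.exp_nonneg _)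
    · exact Measurable.aestronglyMeasurable (by fun_prop)
    · refine Eventually.of_forall fun w b _ => ?_
      rw [Real.norm_eq_abs, abs_mul, Real.abs_exp]
      exact mul_le_of_le_one_right (Real.exp_nonneg _) (Real.abs_cos_le_one _)
    · filter_upwards [ae_restrict_mem measurableSet_Ioi] with w hw b _
      have hw0 : w ≠ 0 := ne_of_gt hw
      have := (((hasDerivAt_id b).mul_const w).sin.const_mul w⁻¹).const_mul (Real.exp (-ε * w))
      convert! this using 1
      simp
      field_simp
  have hd2 : ∀ b : ℝ, HasDerivAt (fun b : ℝ => Real.arctan (b / ε)) (ε / (ε ^ 2 + b ^ 2)) b := by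
    intro b
    convert! ((hasDerivAt_id b).div_const ε).arctan using 1
    simp only [id]
    field_simp
  have h0 : ∀ b : ℝ, HasDerivAt (fun b : ℝ => (∫ w in Set.Ioi (0 : ℝ),
      Real.exp (-ε * w) * (w⁻¹ * Real.sin (b * w))) - Real.arctan (b / ε)) 0 b := fun b => by
    simpa only [sub_self] using! (hd b).sub (hd2 b)
  have := is_const_of_deriv_eq_zero (fun b => (h0 b).differentiableAt) (fun b => (h0 b).deriv) b 0
  simp only [zero_mul, Real.sin_zero, mul_zero, integral_zero, zero_div, Real.arctan_zero,
    sub_zero] at this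
  linarith

lemma tendsto_arctan_mul_natCast (x : ℝ) :
    Tendsto (fun n : ℕ => Real.arctan (x / (1 / ((n : ℝ) + 1)))) atTop
      (nhds (Real.pi / 2 * SignType.sign x)) := by
  have hn : Tendsto (fun n : ℕ => (n : ℝ) + 1) atTop atTop :=
    tendsto_atTop_add_const_right _ _ tendsto_natCast_atTop_atTop
  simp only [div_div_eq_mul_div, div_one]
  rcases lt_trichotomy x 0 with hx | rfl | hx
  · simp only [hx, sign_neg, SignType.coe_neg_one, mul_neg, mul_one]
    exact (Real.tendsto_arctan_atBot.mono_right nhdsWithin_le_nhds).comp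
      (hn.const_mul_atTop_of_neg hx)
  · simp
  · simp only [hx, sign_pos, SignType.coe_one, mul_one]
    exact (Real.tendsto_arctan_atTop.mono_right nhdsWithin_le_nhds).comp
      (hn.const_mul_atTop hx)

lemma exp_sub_exp_eq_sin (A B : ℝ) :
    Complex.exp (((A - B : ℝ) : ℂ) * Complex.I) - Complex.exp (((A + B : ℝ) : ℂ) * Complex.I) =
      -2 * Complex.I * Complex.exp ((A : ℂ) * Complex.I) * (Real.sin B : ℂ) := by
  push_cast
  rw [sub_mul, add_mul, sub_eq_add_neg (_ * _), ← neg_mul, Complex.exp_add, Complex.exp_add,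
    Complex.exp_mul_I (B : ℂ), Complex.exp_mul_I (-(B : ℂ)), Complex.cos_neg, Complex.sin_neg]
  ring

lemma norm_mul_exp_ofReal_mul_I (z : ℂ) (A : ℝ) :
    ‖z * Complex.exp ((A : ℂ) * Complex.I)‖ = ‖z‖ := by
  rw [norm_mul, Complex.norm_exp_ofReal_mul_I, mul_one]

/-- The Hilbert transform acts on the Fourier side as multiplication by `-i sign`. -/
lemma hilbertInt_eq_re_integral {φ : ℝ → ℂ} (hφ : Integrable φ)
    (hφ' : Integrable (fun ξ : ℝ => (ξ : ℂ) * φ ξ)) {h : ℝ → ℝ}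
    (hh : ∀ v, h v = (∫ ξ : ℝ, φ ξ * Complex.exp (((2 * Real.pi * ξ * v : ℝ) : ℂ) * Complex.I)).re)
    (v : ℝ) (hint : IntegrableOn (fun w => w⁻¹ * (h (v - w) - h (v + w))) (Set.Ioi 0)) :
    hilbertInt h v = (∫ ξ : ℝ, (-Complex.I * (Real.pi * SignType.sign ξ : ℝ) * φ ξ) *
      Complex.exp (((2 * Real.pi * ξ * v : ℝ) : ℂ) * Complex.I)).re := by
  set ψ : ℝ → ℂ := fun ξ => -2 * Complex.I *
    (φ ξ * Complex.exp (((2 * Real.pi * ξ * v : ℝ) : ℂ) * Complex.I)) with hψdef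
  have hE : ∀ v : ℝ, Integrable
      (fun ξ : ℝ => φ ξ * Complex.exp (((2 * Real.pi * ξ * v : ℝ) : ℂ) * Complex.I)) := by
    intro v
    refine hφ.norm.mono' (hφ.1.mul (Continuous.aestronglyMeasurable (by fun_prop))) ?_
    exact Eventually.of_forall fun ξ => (norm_mul_exp_ofReal_mul_I _ _).le
  have hψ : Integrable ψ := (hE v).const_mul _
  have hψn : ∀ ξ, ‖ψ ξ‖ = 2 * ‖φ ξ‖ := by
    intro ξ
    simp only [hψdef]
    rw [norm_mul, norm_mul_exp_ofReal_mul_I]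
    simp
  have hdiff : ∀ w : ℝ, h (v - w) - h (v + w) =
      (∫ ξ : ℝ, ψ ξ * (Real.sin (2 * Real.pi * ξ * w) : ℂ)).re := by
    intro w
    rw [hh, hh, ← Complex.sub_re, ← integral_sub (hE _) (hE _)]
    congr 2
    funext ξ
    rw [← mul_sub, show 2 * Real.pi * ξ * (v - w) = 2 * Real.pi * ξ * v - 2 * Real.pi * ξ * w by
      ring, show 2 * Real.pi * ξ * (v + w) = 2 * Real.pi * ξ * v + 2 * Real.pi * ξ * w by ring,
      exp_sub_exp_eq_sin]
    simp only [hψdef]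
    ring
  have hreg : ∀ ε : ℝ, 0 < ε →
      ∫ w in Set.Ioi (0 : ℝ), Real.exp (-ε * w) * (w⁻¹ * (h (v - w) - h (v + w))) =
        (∫ ξ : ℝ, ψ ξ * (Real.arctan (2 * Real.pi * ξ / ε) : ℂ)).re := by
    intro ε hε
    have hexp : IntegrableOn (fun w : ℝ => Real.exp (-ε * w)) (Set.Ioi 0) :=
      integrableOn_exp_mul_Ioi (by linarith) 0
    have hK : Integrable (Function.uncurry fun (ξ w : ℝ) => ψ ξ *
        ((Real.exp (-ε * w) * (w⁻¹ * Real.sin (2 * Real.pi * ξ * w)) : ℝ) : ℂ))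
        (volume.prod (volume.restrict (Set.Ioi 0))) := by
      have hb : Integrable (fun p : ℝ × ℝ => (4 * Real.pi * ‖(p.1 : ℂ) * φ p.1‖) *
          Real.exp (-ε * p.2)) (volume.prod (volume.restrict (Set.Ioi 0))) :=
        (hφ'.norm.const_mul _).mul_prod hexp
      refine hb.mono' ?_ ?_
      · refine hψ.1.comp_fst.mul (Measurable.aestronglyMeasurable ?_)
        fun_prop
      · have : ∀ᵐ p : ℝ × ℝ ∂(volume.prod (volume.restrict (Set.Ioi 0))), 0 < p.2 :=
          Measure.quasiMeasurePreserving_snd.ae (ae_restrict_mem measurableSet_Ioi)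
        filter_upwards [this] with p hp
        simp only [Function.uncurry]
        rw [norm_mul, hψn, Complex.norm_real, Real.norm_eq_abs, abs_mul, Real.abs_exp, norm_mul,
          Complex.norm_real, Real.norm_eq_abs]
        have h1 := abs_inv_mul_sin_le hp (2 * Real.pi * p.1)
        rw [abs_mul (2 * Real.pi), abs_of_pos (by positivity : 0 < 2 * Real.pi)] at h1
        calc 2 * ‖φ p.1‖ * (Real.exp (-ε * p.2) * |p.2⁻¹ * Real.sin (2 * Real.pi * p.1 * p.2)|)
            ≤ 2 * ‖φ p.1‖ * (Real.exp (-ε * p.2) * (2 * Real.pi * |p.1|)) := by gcongr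
          _ = _ := by ring
    calc ∫ w in Set.Ioi (0 : ℝ), Real.exp (-ε * w) * (w⁻¹ * (h (v - w) - h (v + w)))
        = ∫ w in Set.Ioi (0 : ℝ), RCLike.re (∫ ξ : ℝ, ψ ξ *
          ((Real.exp (-ε * w) * (w⁻¹ * Real.sin (2 * Real.pi * ξ * w)) : ℝ) : ℂ)) := by
          congr 1
          funext w
          rw [hdiff, ← mul_assoc, RCLike.re_to_complex, ← Complex.re_ofReal_mul,
            ← integral_const_mul]
          congr 2
          funext ξ
          push_cast
          ring
      _ = (∫ w in Set.Ioi (0 : ℝ), ∫ ξ : ℝ, ψ ξ *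
          ((Real.exp (-ε * w) * (w⁻¹ * Real.sin (2 * Real.pi * ξ * w)) : ℝ) : ℂ)).re :=
          integral_re hK.integral_prod_right
      _ = (∫ ξ : ℝ, ∫ w in Set.Ioi (0 : ℝ), ψ ξ *
          ((Real.exp (-ε * w) * (w⁻¹ * Real.sin (2 * Real.pi * ξ * w)) : ℝ) : ℂ)).re := by
          rw [integral_integral_swap hK]
      _ = _ := by
          congr 2
          funext ξ
          rw [integral_const_mul, integral_complex_ofReal, integral_exp_neg_mul_inv_mul_sin hε]
  have hlim1 : Tendsto (fun n : ℕ => ∫ w in Set.Ioi (0 : ℝ),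
      Real.exp (-(1 / ((n : ℝ) + 1)) * w) * (w⁻¹ * (h (v - w) - h (v + w)))) atTop
      (nhds (hilbertInt h v)) := by
    refine tendsto_integral_of_dominated_convergence
      (fun w => ‖w⁻¹ * (h (v - w) - h (v + w))‖) (fun n => ?_) hint.norm (fun n => ?_) ?_
    · exact (Continuous.aestronglyMeasurable (by fun_prop)).mul hint.1
    · filter_upwards [ae_restrict_mem measurableSet_Ioi] with w hw
      rw [norm_mul, Real.norm_eq_abs, Real.abs_exp]
      refine mul_le_of_le_one_left (norm_nonneg _) (Real.exp_le_one_iff.2 ?_)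
      have : 0 ≤ 1 / ((n : ℝ) + 1) * w := mul_nonneg (by positivity) (le_of_lt hw)
      linarith
    · refine Eventually.of_forall fun w => ?_
      have h1 : Tendsto (fun n : ℕ => Real.exp (-(1 / ((n : ℝ) + 1)) * w)) atTop
          (nhds (Real.exp (-0 * w))) :=
        (Real.continuous_exp.tendsto _).comp
          ((tendsto_one_div_add_atTop_nhds_zero_nat).neg.mul_const w)
      simpa using h1.mul_const (w⁻¹ * (h (v - w) - h (v + w)))
  have hlim2 : Tendsto (fun n : ℕ => ∫ ξ : ℝ, ψ ξ *
      (Real.arctan (2 * Real.pi * ξ / (1 / ((n : ℝ) + 1))) : ℂ)) atTop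
      (nhds (∫ ξ : ℝ, ψ ξ * ((Real.pi / 2 * SignType.sign ξ : ℝ) : ℂ))) := by
    refine tendsto_integral_of_dominated_convergence
      (fun ξ => ‖ψ ξ‖ * (Real.pi / 2)) (fun n => ?_) (hψ.norm.mul_const _) (fun n => ?_) ?_
    · exact hψ.1.mul (Measurable.aestronglyMeasurable (by fun_prop))
    · refine Eventually.of_forall fun ξ => ?_
      rw [norm_mul, Complex.norm_real]
      refine mul_le_mul_of_nonneg_left ?_ (norm_nonneg _)
      exact abs_le.2 ⟨(Real.neg_pi_div_two_lt_arctan _).le, (Real.arctan_lt_pi_div_two _).le⟩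
    · refine Eventually.of_forall fun ξ => ?_
      have h1 := tendsto_arctan_mul_natCast (2 * Real.pi * ξ)
      have h2 : SignType.sign (2 * Real.pi * ξ) = SignType.sign ξ := by
        rw [sign_mul, sign_pos (by positivity), one_mul]
      rw [h2] at h1
      exact ((Complex.continuous_ofReal.tendsto _).comp h1).const_mul _
  have hlim3 := (Complex.continuous_re.tendsto _).comp hlim2
  refine tendsto_nhds_unique hlim1 ?_
  convert hlim3 using 1
  · funext n
    exact hreg _ (by positivity)
  · congr 2
    refine congrArg _ (funext fun ξ => ?_)
    simp only [hψdef]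
    push_cast
    ring

lemma hilbertInt_hilbertInt {φ : ℝ → ℂ} (hφ : Integrable φ)
    (hφ' : Integrable (fun ξ : ℝ => (ξ : ℂ) * φ ξ)) {h : ℝ → ℝ}
    (hh : ∀ v, h v = (∫ ξ : ℝ, φ ξ * Complex.exp (((2 * Real.pi * ξ * v : ℝ) : ℂ) * Complex.I)).re)
    (hint : ∀ v, IntegrableOn (fun w => w⁻¹ * (h (v - w) - h (v + w))) (Set.Ioi 0))
    (v : ℝ) (hint' : IntegrableOn
      (fun w => w⁻¹ * (hilbertInt h (v - w) - hilbertInt h (v + w))) (Set.Ioi 0)) :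
    hilbertInt (hilbertInt h) v = -Real.pi ^ 2 * h v := by
  have hsign : ∀ ξ : ℝ, ‖-Complex.I * ((Real.pi * SignType.sign ξ : ℝ) : ℂ)‖ ≤ Real.pi := by
    intro ξ
    rw [norm_mul, norm_neg, Complex.norm_I, one_mul, Complex.norm_real, norm_mul, Real.norm_eq_abs,
      abs_of_pos Real.pi_pos]
    refine mul_le_of_le_one_right Real.pi_pos.le ?_
    rcases lt_trichotomy ξ 0 with hx | rfl | hx <;> simp [*]
  have hmeas : Measurable fun ξ : ℝ => -Complex.I * ((Real.pi * SignType.sign ξ : ℝ) : ℂ) := by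
    have : Measurable fun ξ : ℝ => ((SignType.sign ξ : SignType) : ℝ) := by
      have h1 : (fun ξ : ℝ => ((SignType.sign ξ : SignType) : ℝ)) =
          fun ξ : ℝ => if 0 < ξ then 1 else if ξ < 0 then -1 else 0 := by
        funext ξ
        rcases lt_trichotomy ξ 0 with hx | rfl | hx
        · simp [hx, hx.not_gt]
        · simp
        · simp [hx]
      rw [h1]
      exact Measurable.ite measurableSet_Ioi measurable_const
        (Measurable.ite measurableSet_Iio measurable_const measurable_const)
    fun_prop
  have hφ2 : Integrable fun ξ : ℝ => -Complex.I * (Real.pi * SignType.sign ξ : ℝ) * φ ξ :=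
    hφ.bdd_mul hmeas.aestronglyMeasurable (Eventually.of_forall hsign)
  have hφ2' : Integrable fun ξ : ℝ =>
      (ξ : ℂ) * (-Complex.I * (Real.pi * SignType.sign ξ : ℝ) * φ ξ) := by
    convert hφ'.bdd_mul hmeas.aestronglyMeasurable (Eventually.of_forall hsign) using 2
    ring
  rw [hilbertInt_eq_re_integral hφ2 hφ2' (fun v => hilbertInt_eq_re_integral hφ hφ' hh v (hint v))
    v hint', hh v, ← Complex.re_ofReal_mul, ← integral_const_mul]
  congr 1
  refine integral_congr_ae ?_
  filter_upwards [compl_mem_ae_iff.2 (measure_singleton (0 : ℝ))] with ξ hξ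
  have h1 : ((SignType.sign ξ : SignType) : ℝ) ^ 2 = 1 := by
    rcases lt_or_gt_of_ne hξ with hx | hx <;> simp [hx]
  have h2 : (((SignType.sign ξ : SignType) : ℝ) : ℂ) ^ 2 = 1 := by exact_mod_cast h1
  push_cast
  linear_combination (Real.pi ^ 2 * φ ξ * Complex.exp (2 * Real.pi * ξ * v * Complex.I)) *
    (((SignType.sign ξ : ℝ) : ℂ) ^ 2 * Complex.I_sq - h2)

/-- Quadratic decay and Lipschitz continuity of `h`, both with the constant `N`. -/
structure DecayLip (N : ℝ) (h : ℝ → ℝ) : Prop where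
  decay : ∀ w, |h w| ≤ N * (1 + w ^ 2)⁻¹
  lip : ∀ a b, |h a - h b| ≤ N * |a - b|

/-- An integrable majorant of the integrand of `hilbertInt`. -/
noncomputable def hilbertMajorant (v w : ℝ) : ℝ :=
  Set.indicator (Set.Ioc 0 1) (fun _ => 2) w + ((1 + (v - w) ^ 2)⁻¹ + (1 + (v + w) ^ 2)⁻¹)

lemma integrable_inv_one_add_sq_sub (v : ℝ) : Integrable fun w : ℝ => (1 + (v - w) ^ 2)⁻¹ :=
  integrable_inv_one_add_sq.comp_sub_left v

lemma integrable_inv_one_add_sq_add (v : ℝ) : Integrable fun w : ℝ => (1 + (v + w) ^ 2)⁻¹ :=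
  integrable_inv_one_add_sq.comp_add_left v

lemma integrable_indicator_Ioc_two :
    Integrable (Set.indicator (Set.Ioc (0 : ℝ) 1) (fun _ => (2 : ℝ))) :=
  (integrable_indicator_iff measurableSet_Ioc).2 (integrableOn_const (by simp) (by simp))

lemma integrable_hilbertMajorant (v : ℝ) : Integrable (hilbertMajorant v) :=
  integrable_indicator_Ioc_two.add
    ((integrable_inv_one_add_sq_sub v).add (integrable_inv_one_add_sq_add v))

lemma hilbertMajorant_nonneg (v w : ℝ) : 0 ≤ hilbertMajorant v w := by
  have : 0 ≤ Set.indicator (Set.Ioc (0 : ℝ) 1) (fun _ => (2 : ℝ)) w :=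
    Set.indicator_nonneg (fun _ _ => by norm_num) w
  unfold hilbertMajorant
  positivity

lemma integral_hilbertMajorant (v : ℝ) : ∫ w, hilbertMajorant v w = 2 + 2 * Real.pi := by
  unfold hilbertMajorant
  have hsum : Integrable fun w : ℝ => (1 + (v - w) ^ 2)⁻¹ + (1 + (v + w) ^ 2)⁻¹ :=
    (integrable_inv_one_add_sq_sub v).add (integrable_inv_one_add_sq_add v)
  rw [integral_add integrable_indicator_Ioc_two hsum,
    integral_add (integrable_inv_one_add_sq_sub v) (integrable_inv_one_add_sq_add v),
    integral_indicator measurableSet_Ioc,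
    integral_sub_left_eq_self (fun w : ℝ => (1 + w ^ 2)⁻¹) volume v,
    integral_add_left_eq_self (fun w : ℝ => (1 + w ^ 2)⁻¹) v, integral_univ_inv_one_add_sq]
  simp
  ring

lemma setIntegral_hilbertMajorant_le (v : ℝ) :
    ∫ w in Set.Ioi (0 : ℝ), hilbertMajorant v w ≤ 2 + 2 * Real.pi := by
  rw [← integral_hilbertMajorant v]
  exact setIntegral_le_integral (integrable_hilbertMajorant v)
    (Eventually.of_forall (hilbertMajorant_nonneg v))

namespace DecayLip

variable {N : ℝ} {h : ℝ → ℝ}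

lemma nonneg (hh : DecayLip N h) : 0 ≤ N := by
  have := (abs_nonneg _).trans (hh.decay 0)
  simpa using this

lemma continuous (hh : DecayLip N h) : Continuous h :=
  (LipschitzWith.of_dist_le_mul (K := ⟨N, hh.nonneg⟩) fun a b => by
    rw [Real.dist_eq, Real.dist_eq]
    exact hh.lip a b).continuous

lemma integrable (hh : DecayLip N h) : Integrable h :=
  (integrable_inv_one_add_sq.const_mul N).mono' hh.continuous.aestronglyMeasurable
    (Eventually.of_forall hh.decay)

lemma abs_integral_le (hh : DecayLip N h) : |∫ w, h w| ≤ N * Real.pi := by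
  rw [← integral_univ_inv_one_add_sq, ← integral_const_mul]
  exact norm_integral_le_of_norm_le (f := h) (integrable_inv_one_add_sq.const_mul N)
    (Eventually.of_forall hh.decay)

lemma mono {N' : ℝ} (hh : DecayLip N h) (hN : N ≤ N') : DecayLip N' h where
  decay w := (hh.decay w).trans (by gcongr)
  lip a b := (hh.lip a b).trans (by gcongr)

lemma abs_integrand_le (hh : DecayLip N h) (v : ℝ) {w : ℝ} (hw : 0 < w) :
    |w⁻¹ * (h (v - w) - h (v + w))| ≤ N * hilbertMajorant v w := by
  have hN := hh.nonneg
  rw [abs_mul, abs_inv, abs_of_pos hw, inv_mul_le_iff₀ hw]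
  unfold hilbertMajorant
  by_cases h1 : w ≤ 1
  · rw [Set.indicator_of_mem (show w ∈ Set.Ioc (0 : ℝ) 1 from ⟨hw, h1⟩)]
    have := hh.lip (v - w) (v + w)
    rw [show v - w - (v + w) = -(2 * w) by ring, abs_neg,
      abs_of_pos (by positivity : 0 < 2 * w)] at this
    calc _ ≤ N * (2 * w) := this
      _ = w * (N * (2 + 0)) := by ring
      _ ≤ w * (N * (2 + ((1 + (v - w) ^ 2)⁻¹ + (1 + (v + w) ^ 2)⁻¹))) := by
        gcongr
        positivity
  · rw [Set.indicator_of_notMem (fun h => h1 h.2), zero_add]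
    calc _ ≤ |h (v - w)| + |h (v + w)| := abs_sub _ _
      _ ≤ N * (1 + (v - w) ^ 2)⁻¹ + N * (1 + (v + w) ^ 2)⁻¹ := by
        gcongr <;> exact hh.decay _
      _ = 1 * (N * ((1 + (v - w) ^ 2)⁻¹ + (1 + (v + w) ^ 2)⁻¹)) := by ring
      _ ≤ _ := by gcongr; linarith

lemma ae_abs_integrand_le (hh : DecayLip N h) (v : ℝ) :
    ∀ᵐ w ∂volume.restrict (Set.Ioi (0 : ℝ)),
      ‖w⁻¹ * (h (v - w) - h (v + w))‖ ≤ N * hilbertMajorant v w := by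
  filter_upwards [ae_restrict_mem measurableSet_Ioi] with w hw
  exact hh.abs_integrand_le v hw

lemma integrableOn (hh : DecayLip N h) (v : ℝ) :
    IntegrableOn (fun w => w⁻¹ * (h (v - w) - h (v + w))) (Set.Ioi 0) := by
  have := hh.continuous.measurable
  refine ((integrable_hilbertMajorant v).integrableOn.const_mul N).mono'
    (Measurable.aestronglyMeasurable (by fun_prop)) (hh.ae_abs_integrand_le v)

lemma integral_norm_le (hh : DecayLip N h) (v : ℝ) :
    ∫ w in Set.Ioi (0 : ℝ), ‖w⁻¹ * (h (v - w) - h (v + w))‖ ≤ N * (2 + 2 * Real.pi) :=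
  calc _ ≤ ∫ w in Set.Ioi (0 : ℝ), N * hilbertMajorant v w :=
        integral_mono_ae (hh.integrableOn v).norm
          ((integrable_hilbertMajorant v).integrableOn.const_mul N) (hh.ae_abs_integrand_le v)
    _ ≤ _ := by
        rw [integral_const_mul]
        exact mul_le_mul_of_nonneg_left (setIntegral_hilbertMajorant_le v) hh.nonneg

lemma abs_hilbertInt_le (hh : DecayLip N h) (v : ℝ) :
    |hilbertInt h v| ≤ N * (2 + 2 * Real.pi) :=
  (norm_integral_le_integral_norm _).trans (hh.integral_norm_le v)

lemma hilbertInt_sub {N' : ℝ} {h' : ℝ → ℝ} (hh : DecayLip N h) (hh' : DecayLip N' h') (v : ℝ) :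
    hilbertInt (fun w => h w - h' w) v = hilbertInt h v - hilbertInt h' v := by
  unfold hilbertInt
  rw [← integral_sub (hh.integrableOn v) (hh'.integrableOn v)]
  congr 1
  funext w
  ring

lemma mul_hilbertInt {N' : ℝ} (hh : DecayLip N h) (hh' : DecayLip N' fun w => w * h w) (v : ℝ) :
    v * hilbertInt h v = (∫ w, h w) + hilbertInt (fun w => w * h w) v := by
  have hi1 : IntegrableOn (fun w => h (v - w)) (Set.Ioi 0) :=
    (hh.integrable.comp_sub_left v).integrableOn
  have hi2 : IntegrableOn (fun w => h (v + w)) (Set.Ioi 0) :=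
    (hh.integrable.comp_add_left v).integrableOn
  have h0 : ∫ w, h w = (∫ w in Set.Ioi 0, h (v - w)) + ∫ w in Set.Ioi 0, h (v + w) := by
    rw [← integral_add_left_eq_self h v, ← integral_add_compl (measurableSet_Ioi (a := (0 : ℝ)))
      (hh.integrable.comp_add_left v), Set.compl_Ioi, add_comm,
      ← neg_zero, ← integral_comp_neg_Ioi]
    simp [sub_eq_add_neg]
  have hi12 : IntegrableOn (fun w => h (v - w) + h (v + w)) (Set.Ioi 0) := hi1.add hi2
  unfold hilbertInt
  rw [h0, ← integral_add hi1 hi2, ← integral_add hi12 (hh'.integrableOn v),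
    ← integral_const_mul]
  refine setIntegral_congr_fun measurableSet_Ioi fun w hw => ?_
  have hw0 : w ≠ 0 := ne_of_gt hw
  field_simp
  ring

lemma abs_hilbertInt_le_inv (hh : DecayLip N h) (hh' : DecayLip N fun w => w * h w) (v : ℝ) :
    |hilbertInt h v| ≤ N * (4 + 5 * Real.pi) * (1 + |v|)⁻¹ := by
  rw [← div_eq_mul_inv, le_div_iff₀ (by positivity)]
  have h1 : |v| * |hilbertInt h v| ≤ N * Real.pi + N * (2 + 2 * Real.pi) := by
    rw [← abs_mul, hh.mul_hilbertInt hh']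
    exact (abs_add_le _ _).trans (add_le_add hh.abs_integral_le (hh'.abs_hilbertInt_le v))
  linarith [hh.abs_hilbertInt_le v]

lemma abs_hilbertInt_le_inv_sq (hh : DecayLip N h) (hh' : DecayLip N fun w => w * h w)
    (hh'' : DecayLip N fun w => w * (w * h w)) (h0 : ∫ w, h w = 0) (v : ℝ) :
    |hilbertInt h v| ≤ N * (4 + 5 * Real.pi) * (1 + v ^ 2)⁻¹ := by
  rw [← div_eq_mul_inv, le_div_iff₀ (by positivity)]
  have h1 : v ^ 2 * |hilbertInt h v| ≤ N * Real.pi + N * (2 + 2 * Real.pi) := by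
    rw [← abs_of_nonneg (sq_nonneg v), ← abs_mul, sq, mul_assoc, hh.mul_hilbertInt hh', h0,
      zero_add, hh'.mul_hilbertInt hh'']
    exact (abs_add_le _ _).trans (add_le_add hh'.abs_integral_le (hh''.abs_hilbertInt_le v))
  linarith [hh.abs_hilbertInt_le v]

end DecayLip

lemma inv_one_add_sq_le_of_abs_sub_le {a b : ℝ} (hab : |a - b| ≤ 1) :
    (1 + a ^ 2)⁻¹ ≤ 3 * (1 + b ^ 2)⁻¹ := by
  have := abs_le.1 hab
  rw [← div_eq_mul_inv, le_div_iff₀ (by positivity), inv_mul_le_iff₀ (by positivity)]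
  nlinarith [sq_nonneg (2 * a - b), sq_nonneg a]

/-- Differentiation commutes with `hilbertInt`. -/
lemma hasDerivAt_hilbertInt {N N' : ℝ} {h h' : ℝ → ℝ} (hh : DecayLip N h) (hh' : DecayLip N' h')
    (hd : ∀ w, HasDerivAt h (h' w) w) (v : ℝ) :
    HasDerivAt (hilbertInt h) (hilbertInt h' v) v := by
  have hm := hh.continuous.measurable
  have hm' := hh'.continuous.measurable
  have hN' := hh'.nonneg
  refine (hasDerivAt_integral_of_dominated_loc_of_deriv_le
    (F := fun v w : ℝ => w⁻¹ * (h (v - w) - h (v + w)))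
    (F' := fun v w : ℝ => w⁻¹ * (h' (v - w) - h' (v + w)))
    (bound := fun w => 3 * (N' * hilbertMajorant v w)) (Metric.ball_mem_nhds v one_pos)
    ?_ (hh.integrableOn v) ?_ ?_ ?_ ?_).2
  · exact Eventually.of_forall fun b => Measurable.aestronglyMeasurable (by fun_prop)
  · exact Measurable.aestronglyMeasurable (by fun_prop)
  · filter_upwards [ae_restrict_mem measurableSet_Ioi] with w hw x hx
    rw [Metric.mem_ball, Real.dist_eq] at hx
    refine (hh'.abs_integrand_le x hw).trans ?_
    have h1 := inv_one_add_sq_le_of_abs_sub_le (a := x - w) (b := v - w)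
      (by rw [sub_sub_sub_cancel_right]; exact hx.le)
    have h2 := inv_one_add_sq_le_of_abs_sub_le (a := x + w) (b := v + w)
      (by rw [add_sub_add_right_eq_sub]; exact hx.le)
    have h3 : 0 ≤ Set.indicator (Set.Ioc (0 : ℝ) 1) (fun _ => (2 : ℝ)) w :=
      Set.indicator_nonneg (fun _ _ => by norm_num) w
    rw [← mul_assoc, mul_comm 3, mul_assoc]
    refine mul_le_mul_of_nonneg_left ?_ hN'
    unfold hilbertMajorant
    linarith
  · exact ((integrable_hilbertMajorant v).integrableOn.const_mul N').const_mul 3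
  · refine Eventually.of_forall fun w x _ => ?_
    have h1 := (hd (x - w)).comp x ((hasDerivAt_id x).sub_const w)
    have h2 := (hd (x + w)).comp x ((hasDerivAt_id x).add_const w)
    simpa using! (h1.sub h2).const_mul w⁻¹

lemma measurable_hilbertInt {G : ℝ → ℝ → ℝ} (hG : Continuous (Function.uncurry G)) :
    Measurable fun p : ℝ × ℝ => hilbertInt (G p.1) p.2 := by
  have h1 : Measurable (Function.uncurry G) := hG.measurable
  have : StronglyMeasurable fun q : (ℝ × ℝ) × ℝ =>
      q.2⁻¹ * (G q.1.1 (q.1.2 - q.2) - G q.1.1 (q.1.2 + q.2)) := by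
    refine Measurable.stronglyMeasurable ?_
    have h2 : Measurable fun q : (ℝ × ℝ) × ℝ => G q.1.1 (q.1.2 - q.2) :=
      h1.comp (by fun_prop : Measurable fun q : (ℝ × ℝ) × ℝ => (q.1.1, q.1.2 - q.2))
    have h3 : Measurable fun q : (ℝ × ℝ) × ℝ => G q.1.1 (q.1.2 + q.2) :=
      h1.comp (by fun_prop : Measurable fun q : (ℝ × ℝ) × ℝ => (q.1.1, q.1.2 + q.2))
    exact (measurable_snd.inv).mul (h2.sub h3)
  exact (this.integral_prod_right' (ν := volume.restrict (Set.Ioi 0))).measurable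

lemma measurable_hilbertInt_slice {h : ℝ → ℝ} (hh : Continuous h) : Measurable (hilbertInt h) :=
  (measurable_hilbertInt (G := fun _ => h) (by fun_prop)).comp
    (measurable_const.prodMk measurable_id : Measurable fun v : ℝ => ((0 : ℝ), v))

lemma tendsto_zero_of_abs_le_inv {L : ℝ → ℝ} {C : ℝ} (hL : ∀ v, |L v| ≤ C * (1 + |v|)⁻¹) :
    Tendsto L atBot (nhds 0) ∧ Tendsto L atTop (nhds 0) := by
  have h1 : ∀ l : Filter ℝ, Tendsto (fun v : ℝ => |v|) l atTop → Tendsto L l (nhds 0) := by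
    intro l hl
    refine squeeze_zero_norm hL ?_
    have := (tendsto_inv_atTop_zero.comp (tendsto_atTop_add_const_left l 1 hl)).const_mul C
    simpa using this
  exact ⟨h1 _ tendsto_abs_atBot_atTop, h1 _ tendsto_abs_atTop_atTop⟩

lemma integral_hilbertInt_eq_zero {N : ℝ} {h h' : ℝ → ℝ} (hh : DecayLip N h)
    (hwh : DecayLip N fun w => w * h w) (hh' : DecayLip N h') (hd : ∀ w, HasDerivAt h (h' w) w)
    (hint : Integrable (hilbertInt h')) : ∫ v, hilbertInt h' v = 0 := by
  have h0 := tendsto_zero_of_abs_le_inv (hh.abs_hilbertInt_le_inv hwh)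
  rw [integral_of_hasDerivAt_of_tendsto (hasDerivAt_hilbertInt hh hh' hd) hint h0.1 h0.2, sub_zero]

lemma abs_sub_le_of_hasDerivAt {g g' : ℝ → ℝ} {C : ℝ} (hd : ∀ w, HasDerivAt g (g' w) w)
    (hC : ∀ w, |g' w| ≤ C) (a b : ℝ) : |g a - g b| ≤ C * |a - b| :=
  convex_univ.norm_image_sub_le_of_norm_hasDerivWithin_le
    (fun w _ => (hd w).hasDerivWithinAt) (fun w _ => hC w) (Set.mem_univ b) (Set.mem_univ a)

lemma inv_one_add_abs_le (v : ℝ) {w : ℝ} (hw : w ≠ 0) :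
    (1 + |v + w|)⁻¹ ≤ (1 + |v|) * |w|⁻¹ := by
  have hw' : 0 < |w| := abs_pos.2 hw
  rw [← div_eq_mul_inv, le_div_iff₀ hw', inv_mul_le_iff₀ (by positivity)]
  have : |w| ≤ |v + w| + |v| := by
    calc |w| = |v + w - v| := by rw [add_sub_cancel_left]
      _ ≤ _ := abs_sub _ _
  nlinarith [abs_nonneg v, abs_nonneg (v + w)]

/-- Integrability of difference quotients of functions with Lipschitz and `1 / |v|` bounds. -/
lemma integrable_inv_mul_sub {L : ℝ → ℝ} {C : ℝ} (hC : 0 ≤ C) (hL : Measurable L)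
    (hdec : ∀ v, |L v| ≤ C * (1 + |v|)⁻¹) (hlip : ∀ a b, |L a - L b| ≤ C * |a - b|) (v : ℝ) :
    Integrable fun w : ℝ => w⁻¹ * (L (v - w) - L (v + w)) := by
  refine (integrable_inv_one_add_sq.const_mul (4 * C * (1 + |v|))).mono'
    (Measurable.aestronglyMeasurable (by fun_prop)) (Eventually.of_forall fun w => ?_)
  rcases eq_or_ne w 0 with rfl | hw
  · simp only [inv_zero, zero_mul, norm_zero]
    positivity
  have hw' : 0 < |w| := abs_pos.2 hw
  rw [Real.norm_eq_abs, abs_mul, abs_inv, inv_mul_le_iff₀ hw']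
  rw [← div_eq_mul_inv, ← mul_div_assoc, le_div_iff₀ (by positivity)]
  have h1 : |L (v - w) - L (v + w)| ≤ C * (2 * |w|) := by
    have := hlip (v - w) (v + w)
    rwa [show v - w - (v + w) = -(2 * w) by ring, abs_neg, abs_mul, abs_two] at this
  have h2 : |L (v - w) - L (v + w)| * w ^ 2 ≤ 2 * C * (1 + |v|) * |w| := by
    have e1 := inv_one_add_abs_le v (neg_ne_zero.2 hw)
    have e2 := inv_one_add_abs_le v hw
    rw [abs_neg, ← sub_eq_add_neg] at e1
    have e3 : |L (v - w) - L (v + w)| ≤ 2 * C * (1 + |v|) * |w|⁻¹ :=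
      calc _ ≤ |L (v - w)| + |L (v + w)| := abs_sub _ _
        _ ≤ C * ((1 + |v|) * |w|⁻¹) + C * ((1 + |v|) * |w|⁻¹) := by
          gcongr
          · exact (hdec _).trans (mul_le_mul_of_nonneg_left e1 hC)
          · exact (hdec _).trans (mul_le_mul_of_nonneg_left e2 hC)
        _ = _ := by ring
    calc _ ≤ 2 * C * (1 + |v|) * |w|⁻¹ * w ^ 2 := by gcongr
      _ = _ := by
        rw [← sq_abs w]
        field_simp
  have h3 : C * (2 * |w|) ≤ 2 * C * (1 + |v|) * |w| := by
    have : 0 ≤ C * |w| * |v| := by positivity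
    linarith
  linarith

lemma integral_inv_mul_sub_eq (L : ℝ → ℝ) (v : ℝ) {T : ℝ} (hT : 0 < T) :
    ∫ s : ℝ, s⁻¹ * (L (v + s * T) - L (v - s * T)) = -2 * hilbertInt L v := by
  have h1 : ∀ s : ℝ, s⁻¹ * (L (v + s * T) - L (v - s * T)) =
      (fun s : ℝ => s⁻¹ * (L (v + s * T) - L (v - s * T))) |s| := by
    intro s
    rcases abs_choice s with hs | hs <;> rw [hs]
    simp only [neg_mul, inv_neg, sub_neg_eq_add, ← sub_eq_add_neg]
    ring
  have h2 : ∀ s : ℝ, s⁻¹ * (L (v + s * T) - L (v - s * T)) =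
      -T * (fun w : ℝ => w⁻¹ * (L (v - w) - L (v + w))) (T * s) := by
    intro s
    simp only [mul_inv, mul_comm T s]
    field_simp
    ring
  calc _ = 2 * ∫ s in Set.Ioi (0 : ℝ), s⁻¹ * (L (v + s * T) - L (v - s * T)) := by
        rw [← integral_comp_abs]
        exact integral_congr_ae (Eventually.of_forall h1)
    _ = _ := by
        simp_rw [h2]
        rw [integral_const_mul, integral_comp_mul_left_Ioi
          (fun w : ℝ => w⁻¹ * (L (v - w) - L (v + w))) 0 hT]
        simp only [mul_zero, smul_eq_mul, hilbertInt]
        field_simp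

lemma integrable_inv_mul_sub_comp {L : ℝ → ℝ} {C : ℝ} (hC : 0 ≤ C) (hL : Measurable L)
    (hdec : ∀ v, |L v| ≤ C * (1 + |v|)⁻¹) (hlip : ∀ a b, |L a - L b| ≤ C * |a - b|) (v : ℝ)
    {T : ℝ} (hT : 0 < T) :
    Integrable fun s : ℝ => s⁻¹ * (L (v + s * T) - L (v - s * T)) := by
  have h1 := ((integrable_inv_mul_sub hC hL hdec hlip v).comp_mul_left' hT.ne').const_mul (-T)
  refine h1.congr (Eventually.of_forall fun s => ?_)
  simp only [mul_inv, mul_comm T s]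
  field_simp
  ring

namespace SchwartzMap

lemma exists_abs_le_inv_mul_inv (G : 𝓢(ℝ × ℝ, ℝ)) :
    ∃ C, ∀ x w, |G (x, w)| ≤ C * (1 + x ^ 2)⁻¹ * (1 + w ^ 2)⁻¹ := by
  refine ⟨2 ^ 4 * (Finset.Iic ((4 : ℕ), (0 : ℕ))).sup (fun m => SchwartzMap.seminorm ℝ m.1 m.2) G,
    fun x w => ?_⟩
  · have h := one_add_le_sup_seminorm_apply (𝕜 := ℝ) (m := (4, 0)) le_rfl le_rfl G (x, w)
    rw [norm_iteratedFDeriv_zero, Real.norm_eq_abs] at h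
    rw [← div_eq_mul_inv, ← div_eq_mul_inv, le_div_iff₀ (by positivity),
      le_div_iff₀ (by positivity)]
    refine le_trans ?_ h
    have hx : |x| ≤ ‖(x, w)‖ := norm_fst_le (x, w)
    have hw : |w| ≤ ‖(x, w)‖ := norm_snd_le (x, w)
    have h1 : ∀ t : ℝ, |t| ≤ ‖(x, w)‖ → 1 + t ^ 2 ≤ (1 + ‖(x, w)‖) ^ 2 := by
      intro t ht
      rw [← sq_abs]
      nlinarith [abs_nonneg t]
    calc |G (x, w)| * (1 + w ^ 2) * (1 + x ^ 2)
        ≤ |G (x, w)| * (1 + ‖(x, w)‖) ^ 2 * (1 + ‖(x, w)‖) ^ 2 := by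
          gcongr
          · exact h1 w hw
          · exact h1 x hx
      _ = _ := by ring

lemma hasDerivAt_snd_s13 (G : 𝓢(ℝ × ℝ, ℝ)) (x w : ℝ) :
    HasDerivAt (fun w => G (x, w)) ((∂_{((0 : ℝ), (1 : ℝ))} G : 𝓢(ℝ × ℝ, ℝ)) (x, w)) w := by
  rw [lineDerivOp_apply_eq_fderiv]
  exact (G.hasFDerivAt (x, w)).comp_hasDerivAt w ((hasDerivAt_const w x).prodMk (hasDerivAt_id w))

lemma hasDerivAt_fst_s13 (G : 𝓢(ℝ × ℝ, ℝ)) (x w : ℝ) :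
    HasDerivAt (fun x => G (x, w)) ((∂_{((1 : ℝ), (0 : ℝ))} G : 𝓢(ℝ × ℝ, ℝ)) (x, w)) x := by
  rw [lineDerivOp_apply_eq_fderiv]
  exact (G.hasFDerivAt (x, w)).comp_hasDerivAt x ((hasDerivAt_id x).prodMk (hasDerivAt_const x w))

lemma exists_decayLip (G : 𝓢(ℝ × ℝ, ℝ)) :
    ∃ C, 0 ≤ C ∧ (∀ x, DecayLip (C * (1 + x ^ 2)⁻¹) fun w => G (x, w)) ∧
      ∀ x x', DecayLip (C * |x - x'|) fun w => G (x, w) - G (x', w) := by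
  obtain ⟨C₀, h₀⟩ := G.exists_abs_le_inv_mul_inv
  obtain ⟨C₁, h₁⟩ := (∂_{((0 : ℝ), (1 : ℝ))} G : 𝓢(ℝ × ℝ, ℝ)).exists_abs_le_inv_mul_inv
  obtain ⟨C₂, h₂⟩ := (∂_{((1 : ℝ), (0 : ℝ))} G : 𝓢(ℝ × ℝ, ℝ)).exists_abs_le_inv_mul_inv
  obtain ⟨C₃, h₃⟩ := (∂_{((1 : ℝ), (0 : ℝ))} (∂_{((0 : ℝ), (1 : ℝ))} G : 𝓢(ℝ × ℝ, ℝ)) :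
    𝓢(ℝ × ℝ, ℝ)).exists_abs_le_inv_mul_inv
  have pos : ∀ {C : ℝ} {G : 𝓢(ℝ × ℝ, ℝ)},
      (∀ x w, |G (x, w)| ≤ C * (1 + x ^ 2)⁻¹ * (1 + w ^ 2)⁻¹) → 0 ≤ C := by
    intro C G h
    simpa using (abs_nonneg _).trans (h 0 0)
  have p₀ := pos h₀
  have p₁ := pos h₁
  have p₂ := pos h₂
  have p₃ := pos h₃
  have inv_le : ∀ t : ℝ, (1 + t ^ 2)⁻¹ ≤ 1 := fun t =>
    inv_le_one_of_one_le₀ (by nlinarith [sq_nonneg t])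
  set C := C₀ + C₁ + C₂ + C₃ with hC
  refine ⟨C, by positivity, fun x => ⟨fun w => ?_, ?_⟩, fun x x' => ⟨fun w => ?_, ?_⟩⟩
  · refine (h₀ x w).trans ?_
    gcongr
    linarith
  · refine abs_sub_le_of_hasDerivAt (G.hasDerivAt_snd_s13 x) fun w => (h₁ x w).trans ?_
    calc C₁ * (1 + x ^ 2)⁻¹ * (1 + w ^ 2)⁻¹ ≤ C * (1 + x ^ 2)⁻¹ * 1 := by
          gcongr
          · linarith
          · exact inv_le w
      _ = _ := mul_one _
  · have h := abs_sub_le_of_hasDerivAt (C := C * (1 + w ^ 2)⁻¹) (fun x => G.hasDerivAt_fst_s13 x w)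
      (fun x => (h₂ x w).trans ?_) x x'
    · rwa [mul_right_comm] at h
    · calc C₂ * (1 + x ^ 2)⁻¹ * (1 + w ^ 2)⁻¹ ≤ C * 1 * (1 + w ^ 2)⁻¹ := by
            gcongr
            · linarith
            · exact inv_le x
        _ = _ := by rw [mul_one]
  · refine abs_sub_le_of_hasDerivAt
      (fun w => (G.hasDerivAt_snd_s13 x w).sub (G.hasDerivAt_snd_s13 x' w)) fun w => ?_
    refine abs_sub_le_of_hasDerivAt (fun x => hasDerivAt_fst_s13 (∂_{((0 : ℝ), (1 : ℝ))} G) x w)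
      (fun x => (h₃ x w).trans ?_) x x'
    calc C₃ * (1 + x ^ 2)⁻¹ * (1 + w ^ 2)⁻¹ ≤ C * 1 * 1 := by
          gcongr
          · linarith
          · exact inv_le x
          · exact inv_le w
      _ = _ := by ring

/-- Multiplication of a Schwartz function on the plane by the second coordinate. -/
noncomputable def sndMul (G : 𝓢(ℝ × ℝ, ℝ)) : 𝓢(ℝ × ℝ, ℝ) :=
  smulLeftCLM ℝ (fun p : ℝ × ℝ => p.2) G

lemma sndMul_apply (G : 𝓢(ℝ × ℝ, ℝ)) (x w : ℝ) : G.sndMul (x, w) = w * G (x, w) :=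
  smulLeftCLM_apply_apply (ContinuousLinearMap.snd ℝ ℝ ℝ).hasTemperateGrowth G (x, w)

/-- The complexified restriction of a Schwartz function on the plane to a vertical line. -/
lemma exists_slice (G : 𝓢(ℝ × ℝ, ℝ)) (x : ℝ) : ∃ g : 𝓢(ℝ, ℂ), ∀ w, g w = (G (x, w) : ℂ) := by
  have hg : Function.HasTemperateGrowth fun w : ℝ => ((x, w) : ℝ × ℝ) := by
    have h1 : (fun w : ℝ => ((x, w) : ℝ × ℝ)) =
        (fun _ : ℝ => ((x, 0) : ℝ × ℝ)) + ContinuousLinearMap.inr ℝ ℝ ℝ := by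
      funext w
      simp
    rw [h1]
    exact (Function.HasTemperateGrowth.const _).add (ContinuousLinearMap.hasTemperateGrowth _)
  refine ⟨postcompCLM (𝕜 := ℝ) Complex.ofRealCLM (compCLM ℝ hg ⟨1, 1, fun w => ?_⟩ G), fun w => ?_⟩
  · have : ‖w‖ ≤ ‖(x, w)‖ := norm_snd_le (x, w)
    linarith
  · simp

lemma exists_fourier_slice_s13 (G : 𝓢(ℝ × ℝ, ℝ)) (x : ℝ) : ∃ φ : ℝ → ℂ, Integrable φ ∧
    Integrable (fun ξ : ℝ => (ξ : ℂ) * φ ξ) ∧ ∀ v, G (x, v) =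
      (∫ ξ : ℝ, φ ξ * Complex.exp (((2 * Real.pi * ξ * v : ℝ) : ℂ) * Complex.I)).re := by
  obtain ⟨g, hg⟩ := G.exists_slice x
  refine ⟨⇑(𝓕 g : 𝓢(ℝ, ℂ)), (𝓕 g : 𝓢(ℝ, ℂ)).integrable, ?_, fun v => ?_⟩
  · have h1 := (𝓕 g : 𝓢(ℝ, ℂ)).integrable_pow_mul volume 1
    refine (integrable_norm_iff (Complex.continuous_ofReal.mul
      (𝓕 g : 𝓢(ℝ, ℂ)).continuous).aestronglyMeasurable).1 ?_
    simpa using h1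
  · have h1 : (𝓕⁻ (𝓕 g) : 𝓢(ℝ, ℂ)) v = g v := by rw [FourierTransform.fourierInv_fourier_eq]
    rw [fourierInv_coe, Real.fourierInv_eq', hg] at h1
    have h2 := congrArg Complex.re h1
    rw [Complex.ofReal_re] at h2
    rw [← h2]
    congr 2
    funext ξ
    simp only [smul_eq_mul, RCLike.inner_apply, conj_trivial]
    rw [mul_comm]
    congr 4
    ring

end SchwartzMap

lemma integrableOn_div_of_le_abs {q : ℝ → ℝ} (hq : Integrable q) {ε : ℝ} (hε : 0 < ε) {S : Set ℝ}
    (hS : MeasurableSet S) (hle : ∀ w ∈ S, ε ≤ |w|) : IntegrableOn (fun w => q w / w) S := by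
  refine (hq.norm.const_mul ε⁻¹).integrableOn.mono'
    (hq.aestronglyMeasurable.aemeasurable.restrict.div aemeasurable_id).aestronglyMeasurable ?_
  filter_upwards [ae_restrict_mem hS] with w hw
  rw [norm_div, div_eq_inv_mul, Real.norm_eq_abs w]
  gcongr
  exact hle w hw

lemma setIntegral_lt_abs_sub_eq {Q : ℝ → ℝ} (hQ : Integrable Q) (a : ℝ) {ε : ℝ} (hε : 0 < ε) :
    ∫ u in {u : ℝ | ε < |u - a|}, Q u / (a - u) =
      ∫ w in Set.Ioi ε, w⁻¹ * (Q (a - w) - Q (a + w)) := by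
  have hset : {u : ℝ | ε < |u - a|} = (fun u => u - a) ⁻¹' (Set.Iio (-ε) ∪ Set.Ioi ε) := by
    ext u
    simp only [Set.mem_ofPred_eq, Set.mem_preimage, Set.mem_union, Set.mem_Iio, Set.mem_Ioi, lt_abs]
    constructor <;> rintro (h | h)
    · exact Or.inr h
    · exact Or.inl (by linarith)
    · exact Or.inr (by linarith)
    · exact Or.inl h
  have hsub : ∫ u in {u : ℝ | ε < |u - a|}, Q u / (a - u) =
      ∫ w in Set.Iio (-ε) ∪ Set.Ioi ε, -(Q (a + w) / w) := by
    rw [hset, ← (measurePreserving_sub_right volume a).setIntegral_preimage_emb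
      (measurableEmbedding_subRight a) (fun w => -(Q (a + w) / w))]
    refine integral_congr_ae (ae_of_all _ fun u => ?_)
    simp only [add_sub_cancel, ← div_neg, neg_sub]
  have hplus := hQ.comp_add_left a
  have hpos : IntegrableOn (fun w => -(Q (a + w) / w)) (Set.Ioi ε) :=
    (integrableOn_div_of_le_abs hplus hε measurableSet_Ioi
      fun w hw => hw.le.trans (le_abs_self w)).neg
  have hneg : IntegrableOn (fun w => -(Q (a + w) / w)) (Set.Iio (-ε)) :=
    (integrableOn_div_of_le_abs hplus hε measurableSet_Iio fun w (hw : w < -ε) =>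
      (le_neg.1 hw.le).trans (neg_le_abs w)).neg
  have hminus : IntegrableOn (fun w => Q (a - w) / w) (Set.Ioi ε) :=
    integrableOn_div_of_le_abs (hQ.comp_sub_left a) hε measurableSet_Ioi
      fun w hw => hw.le.trans (le_abs_self w)
  have hdisj : Disjoint (Set.Iio (-ε)) (Set.Ioi ε) :=
    Set.disjoint_left.2 fun w (h1 : w < -ε) (h2 : ε < w) => by linarith
  rw [hsub, setIntegral_union hdisj measurableSet_Ioi hneg hpos,
    ← integral_Iic_eq_integral_Iio, ← integral_comp_neg_Ioi, ← integral_add ?_ hpos]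
  · refine integral_congr_ae (ae_of_all _ fun w => ?_)
    simp only [← sub_eq_add_neg, div_neg, neg_neg]
    ring
  · refine hminus.congr (ae_of_all _ fun w => ?_)
    simp only [← sub_eq_add_neg, div_neg, neg_neg]

lemma pv_eq_hilbertInt {Q : ℝ → ℝ} (hQ : Integrable Q) (a : ℝ)
    (hint : IntegrableOn (fun w => w⁻¹ * (Q (a - w) - Q (a + w))) (Set.Ioi 0)) :
    pv (fun u => Q u / (a - u)) a = hilbertInt Q a := by
  refine Tendsto.limUnder_eq ?_
  have hcov : AECover (volume.restrict (Set.Ioi (0 : ℝ))) (nhdsWithin (0 : ℝ) (Set.Ioi 0))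
      fun ε => Set.Ioi ε := aecover_Ioi_of_Ioi (tendsto_id'.2 nhdsWithin_le_nhds)
  refine (hcov.integral_tendsto_of_countably_generated hint).congr' ?_
  filter_upwards [self_mem_nhdsWithin] with ε (hε : 0 < ε)
  rw [setIntegral_lt_abs_sub_eq hQ a hε, Measure.restrict_restrict measurableSet_Ioi,
    Set.inter_eq_left.2 (Set.Ioi_subset_Ioi hε.le)]

section VerticalIntegral

variable {G : ℝ → ℝ → ℝ} {C : ℝ} {r : ℝ → ℝ}

lemma integrable_comp_curve (hG : Continuous (Function.uncurry G))
    (hd : ∀ x, DecayLip (C * (1 + x ^ 2)⁻¹) (G x)) (hr : Continuous r) :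
    Integrable fun x => G x (r x) := by
  refine (integrable_inv_one_add_sq.const_mul C).mono'
    (hG.comp (continuous_id.prodMk hr)).aestronglyMeasurable (ae_of_all _ fun x => ?_)
  refine ((hd x).decay (r x)).trans (mul_le_of_le_one_right (hd x).nonneg ?_)
  exact inv_le_one_of_one_le₀ (by nlinarith [sq_nonneg (r x)])

lemma integrable_integral_comp_curve (hG : Continuous (Function.uncurry G))
    (hd : ∀ x, DecayLip (C * (1 + x ^ 2)⁻¹) (G x)) (hr : Continuous r) :
    Integrable fun u => ∫ x, G x (r x + u) := by
  have hcont : Continuous fun p : ℝ × ℝ => G p.1 (r p.1 + p.2) := by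
    exact hG.comp (continuous_fst.prodMk ((hr.comp continuous_fst).add continuous_snd))
  refine Integrable.integral_prod_right (f := fun p : ℝ × ℝ => G p.1 (r p.1 + p.2)) ?_
  refine (integrable_prod_iff hcont.aestronglyMeasurable).2
    ⟨ae_of_all _ fun x => (hd x).integrable.comp_add_left (r x), ?_⟩
  refine (integrable_inv_one_add_sq.const_mul (C * Real.pi)).mono'
    hcont.aestronglyMeasurable.norm.integral_prod_right' (ae_of_all _ fun x => ?_)
  rw [Real.norm_of_nonneg (integral_nonneg fun _ => norm_nonneg _),
    integral_add_left_eq_self (fun u => ‖G x u‖) (r x)]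
  calc ∫ u, ‖G x u‖ ≤ ∫ u, C * (1 + x ^ 2)⁻¹ * (1 + u ^ 2)⁻¹ :=
        integral_mono (hd x).integrable.norm (integrable_inv_one_add_sq.const_mul _) (hd x).decay
    _ = _ := by rw [integral_const_mul, integral_univ_inv_one_add_sq]; ring

lemma integrable_hilbertInt_integrand_prod (hG : Continuous (Function.uncurry G))
    (hd : ∀ x, DecayLip (C * (1 + x ^ 2)⁻¹) (G x)) (hr : Continuous r) :
    Integrable (fun p : ℝ × ℝ => p.2⁻¹ * (G p.1 (r p.1 - p.2) - G p.1 (r p.1 + p.2)))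
      (volume.prod (volume.restrict (Set.Ioi 0))) := by
  have hmeas : AEStronglyMeasurable
      (fun p : ℝ × ℝ => p.2⁻¹ * (G p.1 (r p.1 - p.2) - G p.1 (r p.1 + p.2)))
      (volume.prod (volume.restrict (Set.Ioi 0))) := by
    refine (measurable_snd.inv.mul (Measurable.sub ?_ ?_)).aestronglyMeasurable
    · exact (hG.comp (continuous_fst.prodMk
        ((hr.comp continuous_fst).sub continuous_snd))).measurable
    · exact (hG.comp (continuous_fst.prodMk
        ((hr.comp continuous_fst).add continuous_snd))).measurable
  refine (integrable_prod_iff hmeas).2 ⟨ae_of_all _ fun x => (hd x).integrableOn (r x), ?_⟩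
  refine (integrable_inv_one_add_sq.const_mul (C * (2 + 2 * Real.pi))).mono'
    hmeas.norm.integral_prod_right' (ae_of_all _ fun x => ?_)
  rw [Real.norm_of_nonneg (integral_nonneg fun _ => norm_nonneg _)]
  exact ((hd x).integral_norm_le (r x)).trans_eq (by ring)

lemma pv_integral_comp_curve (hG : Continuous (Function.uncurry G))
    (hd : ∀ x, DecayLip (C * (1 + x ^ 2)⁻¹) (G x)) (hr : Continuous r) (a : ℝ) :
    pv (fun u => (∫ x, G x (r x + u)) / (a - u)) a = ∫ x, hilbertInt (G x) (r x + a) := by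
  have hprod := integrable_hilbertInt_integrand_prod hG hd (hr.add_const a)
  have hint : ∀ u, Integrable fun x => G x (r x + u) := fun u =>
    integrable_comp_curve hG hd (hr.add_const u)
  have hinner : ∀ w, ∫ x, w⁻¹ * (G x (r x + a - w) - G x (r x + a + w)) =
      w⁻¹ * ((∫ x, G x (r x + (a - w))) - ∫ x, G x (r x + (a + w))) := by
    intro w
    simp only [add_sub_assoc, add_assoc]
    rw [integral_const_mul, integral_sub (hint _) (hint _)]
  rw [pv_eq_hilbertInt (Q := fun u => ∫ x, G x (r x + u)) (integrable_integral_comp_curve hG hd hr)]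
  · unfold hilbertInt
    rw [integral_integral_swap hprod]
    exact integral_congr_ae (ae_of_all _ fun w => (hinner w).symm)
  · exact (integrable_congr (ae_of_all _ hinner)).1 hprod.integral_prod_right

end VerticalIntegral

namespace SchwartzMap

lemma exists_decayLip_sndMul (G : 𝓢(ℝ × ℝ, ℝ)) :
    ∃ C, 0 ≤ C ∧
      (∀ x, DecayLip (C * (1 + x ^ 2)⁻¹) (fun w => G (x, w)) ∧
        DecayLip (C * (1 + x ^ 2)⁻¹) (fun w => w * G (x, w)) ∧
        DecayLip (C * (1 + x ^ 2)⁻¹) (fun w => w * (w * G (x, w)))) ∧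
      ∀ x x', DecayLip (C * |x - x'|) (fun w => G (x, w) - G (x', w)) ∧
        DecayLip (C * |x - x'|) (fun w => w * (G (x, w) - G (x', w))) ∧
        DecayLip (C * |x - x'|) (fun w => w * (w * (G (x, w) - G (x', w)))) := by
  obtain ⟨C₀, p₀, h₀, h₀'⟩ := G.exists_decayLip
  obtain ⟨C₁, p₁, h₁, h₁'⟩ := G.sndMul.exists_decayLip
  obtain ⟨C₂, p₂, h₂, h₂'⟩ := G.sndMul.sndMul.exists_decayLip
  simp only [sndMul_apply, ← mul_sub] at h₁ h₁' h₂ h₂'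
  have l₀ : C₀ ≤ C₀ + C₁ + C₂ := by linarith
  have l₁ : C₁ ≤ C₀ + C₁ + C₂ := by linarith
  have l₂ : C₂ ≤ C₀ + C₁ + C₂ := by linarith
  exact ⟨C₀ + C₁ + C₂, by positivity,
    fun x => ⟨(h₀ x).mono (by gcongr), (h₁ x).mono (by gcongr), (h₂ x).mono (by gcongr)⟩,
    fun x x' => ⟨(h₀' x x').mono (by gcongr), (h₁' x x').mono (by gcongr),
      (h₂' x x').mono (by gcongr)⟩⟩

lemma integral_lineDerivOp_snd_eq_zero (F : 𝓢(ℝ × ℝ, ℝ)) (x : ℝ) :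
    ∫ w, (∂_{((0 : ℝ), (1 : ℝ))} F : 𝓢(ℝ × ℝ, ℝ)) (x, w) = 0 := by
  obtain ⟨_, -, h, -⟩ := F.exists_decayLip
  obtain ⟨_, -, h', -⟩ := (∂_{((0 : ℝ), (1 : ℝ))} F : 𝓢(ℝ × ℝ, ℝ)).exists_decayLip
  exact integral_eq_zero_of_hasDerivAt_of_integrable (F.hasDerivAt_snd_s13 x) (h' x).integrable
    (h x).integrable

/-- The Hilbert transform, in the second variable, of the second partial derivative. -/
noncomputable def hilbertSnd (F : 𝓢(ℝ × ℝ, ℝ)) (x v : ℝ) : ℝ :=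
  hilbertInt (fun w => (∂_{((0 : ℝ), (1 : ℝ))} F : 𝓢(ℝ × ℝ, ℝ)) (x, w)) v

lemma measurable_hilbertSnd (F : 𝓢(ℝ × ℝ, ℝ)) : Measurable fun p : ℝ × ℝ => F.hilbertSnd p.1 p.2 :=
  measurable_hilbertInt
    (G := fun x w => (∂_{((0 : ℝ), (1 : ℝ))} F : 𝓢(ℝ × ℝ, ℝ)) (x, w)) (SchwartzMap.continuous _)

lemma exists_hilbertSnd_bound (F : 𝓢(ℝ × ℝ, ℝ)) :
    ∃ C, 0 ≤ C ∧ (∀ x v, |F.hilbertSnd x v| ≤ C * (1 + x ^ 2)⁻¹ * (1 + v ^ 2)⁻¹) ∧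
      ∀ x x' v, |F.hilbertSnd x v - F.hilbertSnd x' v| ≤ C * |x - x'| * (1 + v ^ 2)⁻¹ := by
  obtain ⟨C, hC, h, h'⟩ :=
    (∂_{((0 : ℝ), (1 : ℝ))} F : 𝓢(ℝ × ℝ, ℝ)).exists_decayLip_sndMul
  refine ⟨C * (4 + 5 * Real.pi), by positivity, fun x v => ?_, fun x x' v => ?_⟩
  · refine ((h x).1.abs_hilbertInt_le_inv_sq (h x).2.1 (h x).2.2
      (F.integral_lineDerivOp_snd_eq_zero x) v).trans_eq (by ring)
  · unfold hilbertSnd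
    rw [← (h x).1.hilbertInt_sub (h x').1]
    refine ((h' x x').1.abs_hilbertInt_le_inv_sq (h' x x').2.1 (h' x x').2.2 ?_ v).trans_eq
      (by ring)
    rw [integral_sub (h x).1.integrable (h x').1.integrable, F.integral_lineDerivOp_snd_eq_zero,
      F.integral_lineDerivOp_snd_eq_zero, sub_zero]

lemma hasDerivAt_hilbertInt_slice (F : 𝓢(ℝ × ℝ, ℝ)) (x v : ℝ) :
    HasDerivAt (hilbertInt fun w => F (x, w)) (F.hilbertSnd x v) v := by
  obtain ⟨_, -, h, -⟩ := F.exists_decayLip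
  obtain ⟨_, -, h', -⟩ := (∂_{((0 : ℝ), (1 : ℝ))} F : 𝓢(ℝ × ℝ, ℝ)).exists_decayLip
  exact hasDerivAt_hilbertInt (h x) (h' x) (F.hasDerivAt_snd_s13 x) v

lemma continuous_hilbertSnd (F : 𝓢(ℝ × ℝ, ℝ)) (x : ℝ) : Continuous (F.hilbertSnd x) :=
  continuous_iff_continuousAt.2 fun v =>
    (hasDerivAt_hilbertInt_slice (∂_{((0 : ℝ), (1 : ℝ))} F) x v).continuousAt

lemma integrable_hilbertSnd (F : 𝓢(ℝ × ℝ, ℝ)) (x : ℝ) : Integrable (F.hilbertSnd x) := by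
  obtain ⟨_, -, h, -⟩ := F.exists_hilbertSnd_bound
  exact (integrable_inv_one_add_sq.const_mul _).mono'
    (F.continuous_hilbertSnd x).aestronglyMeasurable (ae_of_all _ (h x))

lemma integral_hilbertSnd_eq_zero (F : 𝓢(ℝ × ℝ, ℝ)) (x : ℝ) : ∫ v, F.hilbertSnd x v = 0 := by
  obtain ⟨C, p, h, -⟩ := F.exists_decayLip_sndMul
  obtain ⟨C', p', h', -⟩ := (∂_{((0 : ℝ), (1 : ℝ))} F : 𝓢(ℝ × ℝ, ℝ)).exists_decayLip
  have l : C ≤ C + C' := by linarith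
  have l' : C' ≤ C + C' := by linarith
  exact integral_hilbertInt_eq_zero (N := (C + C') * (1 + x ^ 2)⁻¹) ((h x).1.mono (by gcongr))
    ((h x).2.1.mono (by gcongr)) ((h' x).mono (by gcongr)) (F.hasDerivAt_snd_s13 x)
    (F.integrable_hilbertSnd x)

lemma exists_hilbertInt_slice_bound (F : 𝓢(ℝ × ℝ, ℝ)) (x : ℝ) :
    ∃ C, 0 ≤ C ∧ (∀ v, |hilbertInt (fun w => F (x, w)) v| ≤ C * (1 + |v|)⁻¹) ∧
      ∀ a b, |hilbertInt (fun w => F (x, w)) a - hilbertInt (fun w => F (x, w)) b|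
        ≤ C * |a - b| := by
  obtain ⟨C, p, h, -⟩ := F.exists_decayLip_sndMul
  obtain ⟨C', p', h', -⟩ := (∂_{((0 : ℝ), (1 : ℝ))} F : 𝓢(ℝ × ℝ, ℝ)).exists_decayLip
  have q := (h x).1.nonneg
  have q' := (h' x).nonneg
  refine ⟨C * (1 + x ^ 2)⁻¹ * (4 + 5 * Real.pi) + C' * (1 + x ^ 2)⁻¹ * (2 + 2 * Real.pi),
    by positivity, fun v => ?_,
    abs_sub_le_of_hasDerivAt (F.hasDerivAt_hilbertInt_slice x) fun v => ?_⟩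
  · refine ((h x).1.abs_hilbertInt_le_inv (h x).2.1 v).trans ?_
    gcongr
    exact le_add_of_nonneg_right (by positivity)
  · exact ((h' x).abs_hilbertInt_le v).trans (le_add_of_nonneg_left (by positivity))

lemma hilbertInt_hilbertInt_slice (F : 𝓢(ℝ × ℝ, ℝ)) (x v : ℝ) :
    hilbertInt (hilbertInt fun w => F (x, w)) v = -Real.pi ^ 2 * F (x, v) := by
  obtain ⟨φ, hφ, hφ', hF⟩ := F.exists_fourier_slice_s13 x
  obtain ⟨_, -, h, -⟩ := F.exists_decayLip
  obtain ⟨C, hC, hdec, hlip⟩ := F.exists_hilbertInt_slice_bound x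
  exact hilbertInt_hilbertInt hφ hφ' hF (h x).integrableOn v
    (integrable_inv_mul_sub hC (measurable_hilbertInt_slice (h x).continuous) hdec hlip
      v).integrableOn

end SchwartzMap

lemma mul_abs_sub_le_abs_rpow_sub {α X x : ℝ} (hα : 1 < α) (hX : 0 < X) (hx : 0 ≤ x) :
    X ^ (α - 1) * |x - X| ≤ |x ^ α - X ^ α| ∧
      X * |x ^ (α - 1) - X ^ (α - 1)| ≤ |x ^ α - X ^ α| := by
  have hpow : ∀ {t : ℝ}, 0 ≤ t → t ^ α = t * t ^ (α - 1) := fun {t} ht => by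
    rw [← Real.rpow_one_add' ht (by linarith)]
    ring_nf
  have hα' : 0 ≤ α - 1 := by linarith
  have hq : 0 ≤ X ^ (α - 1) := by positivity
  have hp : 0 ≤ x ^ (α - 1) := by positivity
  rw [hpow hx, hpow hX.le]
  rcases le_total X x with h | h
  · have hpq := Real.rpow_le_rpow hX.le h hα'
    have hprod := mul_le_mul h hpq hq hx
    rw [abs_of_nonneg (sub_nonneg.2 h), abs_of_nonneg (sub_nonneg.2 hpq),
      abs_of_nonneg (sub_nonneg.2 hprod)]
    constructor <;> nlinarith
  · have hpq := Real.rpow_le_rpow hx h hα'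
    have hprod := mul_le_mul h hpq hp hX.le
    rw [abs_of_nonpos (sub_nonpos.2 h), abs_of_nonpos (sub_nonpos.2 hpq),
      abs_of_nonpos (sub_nonpos.2 hprod)]
    constructor <;> nlinarith

section ShearIntegral

variable {μ : Measure ℝ} {D : ℝ → ℝ → ℝ} {φ M : ℝ → ℝ}

lemma integrable_shear_prod [SFinite μ] (hD : Measurable (Function.uncurry D)) (hφ : Measurable φ)
    (hM : Integrable M μ) (hφ0 : ∀ᵐ x ∂μ, φ x ≠ 0)
    (hbound : ∀ᵐ x ∂μ, ∀ v, |D x v| ≤ |φ x| * M x * (1 + v ^ 2)⁻¹) (y : ℝ) :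
    Integrable (fun p : ℝ × ℝ => D p.1 (y + p.2 * φ p.1)) (μ.prod volume) := by
  have hmeas : Measurable fun p : ℝ × ℝ => D p.1 (y + p.2 * φ p.1) := by
    exact hD.comp (measurable_fst.prodMk
      ((measurable_snd.mul (hφ.comp measurable_fst)).const_add y))
  have hkernel : ∀ {t : ℝ}, t ≠ 0 → Integrable fun s => (1 + (y + s * t) ^ 2)⁻¹ := fun {t} ht =>
    (integrable_inv_one_add_sq.comp_add_left y).comp_mul_right' ht
  have hslice : ∀ᵐ x ∂μ, Integrable fun s => D x (y + s * φ x) := by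
    filter_upwards [hφ0, hbound] with x h0 hb
    exact ((hkernel h0).const_mul _).mono'
      (hmeas.comp (measurable_const.prodMk measurable_id)).aestronglyMeasurable
      (ae_of_all _ fun s => hb _)
  refine (integrable_prod_iff hmeas.aestronglyMeasurable).2 ⟨hslice, ?_⟩
  refine (hM.const_mul Real.pi).mono'
    hmeas.aestronglyMeasurable.norm.integral_prod_right' ?_
  filter_upwards [hφ0, hbound, hslice] with x h0 hb hs
  rw [Real.norm_of_nonneg (integral_nonneg fun _ => norm_nonneg _)]
  calc ∫ s, ‖D x (y + s * φ x)‖ ≤ ∫ s, |φ x| * M x * (1 + (y + s * φ x) ^ 2)⁻¹ :=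
        integral_mono hs.norm ((hkernel h0).const_mul _) fun s => hb _
    _ = |φ x| * M x * (|(φ x)⁻¹| * Real.pi) := by
        rw [integral_const_mul,
          Measure.integral_comp_mul_right (fun t => (1 + (y + t) ^ 2)⁻¹) (φ x),
          integral_add_left_eq_self (fun t : ℝ => (1 + t ^ 2)⁻¹) y, integral_univ_inv_one_add_sq,
          smul_eq_mul]
    _ = Real.pi * M x := by
        rw [abs_inv]
        field_simp

lemma integral_integral_shear_eq_zero [SFinite μ] (hD : Measurable (Function.uncurry D))
    (hφ : Measurable φ) (hM : Integrable M μ) (hφ0 : ∀ᵐ x ∂μ, φ x ≠ 0)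
    (hbound : ∀ᵐ x ∂μ, ∀ v, |D x v| ≤ |φ x| * M x * (1 + v ^ 2)⁻¹)
    (hzero : ∀ x, ∫ v, D x v = 0) (y : ℝ) :
    ∫ s, ∫ x, D x (y + s * φ x) ∂μ = 0 := by
  have hint := integrable_shear_prod hD hφ hM hφ0 hbound y
  rw [← integral_integral_swap (f := fun x s => D x (y + s * φ x)) hint]
  refine integral_eq_zero_of_ae (ae_of_all _ fun x => ?_)
  simp only [Pi.zero_apply]
  rw [Measure.integral_comp_mul_right (fun t => D x (y + t)) (φ x),
    integral_add_left_eq_self (D x) y, hzero, smul_zero]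

end ShearIntegral

/-- The upper endpoint `b` of the interval on which `shearWeight` lives: `b ^ α = 2 * X ^ α`. -/
noncomputable def shearEndpoint (α X : ℝ) : ℝ := (2 * X ^ α) ^ α⁻¹

/-- The weight `(x / X) ^ (α - 1)`, cut off to the interval where `|x ^ α - X ^ α| ≤ X ^ α`. -/
noncomputable def shearWeight (α X : ℝ) : ℝ → ℝ :=
  Set.indicator (Set.Ioc 0 (shearEndpoint α X)) fun x => x ^ (α - 1) / X ^ (α - 1)

lemma shearEndpoint_nonneg (α : ℝ) {X : ℝ} (hX : 0 < X) : 0 ≤ shearEndpoint α X := by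
  unfold shearEndpoint
  positivity

lemma shearEndpoint_rpow {α X : ℝ} (hα : 1 < α) (hX : 0 < X) : shearEndpoint α X ^ α = 2 * X ^ α :=
  Real.rpow_inv_rpow (by positivity) (by linarith)

lemma measurable_shearWeight (α X : ℝ) : Measurable (shearWeight α X) :=
  ((measurable_id.pow_const _).div_const _).indicator measurableSet_Ioc

lemma ae_rpow_sub_ne_zero {α X : ℝ} (hα : 1 < α) (hX : 0 < X) :
    ∀ᵐ x ∂volume.restrict (Set.Ioi (0 : ℝ)), x ^ α - X ^ α ≠ 0 := by
  filter_upwards [ae_restrict_mem measurableSet_Ioi,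
    ae_restrict_of_ae (compl_mem_ae_iff.2 (measure_singleton X))] with x (hx : 0 < x) hxX h
  exact hxX ((Real.rpow_left_inj hx.le hX.le (by linarith)).1 (sub_eq_zero.1 h))

namespace SchwartzMap

lemma exists_abs_hilbertSnd_sub_le (F : 𝓢(ℝ × ℝ, ℝ)) {α X : ℝ} (hα : 1 < α) (hX : 0 < X) :
    ∃ K, ∀ x, 0 < x → ∀ v, |F.hilbertSnd x v - shearWeight α X x * F.hilbertSnd X v| ≤
      |x ^ α - X ^ α| * (K * (1 + x ^ 2)⁻¹) * (1 + v ^ 2)⁻¹ := by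
  obtain ⟨C, hC, hdec, hlip⟩ := F.exists_hilbertSnd_bound
  set b := shearEndpoint α X with hb
  have hb0 : 0 ≤ b := shearEndpoint_nonneg α hX
  set q := X ^ (α - 1) with hq
  set T := X ^ α with hT
  have hq0 : 0 < q := Real.rpow_pos_of_pos hX _
  have hT0 : 0 < T := Real.rpow_pos_of_pos hX _
  refine ⟨C * (q⁻¹ + X⁻¹ * q⁻¹) * (1 + b ^ 2) + C * T⁻¹, fun x hx v => ?_⟩
  have hV : 0 ≤ (1 + v ^ 2)⁻¹ := by positivity
  by_cases hxb : x ≤ b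
  · have hw : shearWeight α X x = x ^ (α - 1) / q :=
      Set.indicator_of_mem (Set.mem_Ioc.2 ⟨hx, hxb⟩) _
    obtain ⟨h1, h2⟩ := mul_abs_sub_le_abs_rpow_sub hα hX hx.le
    rw [← hq, ← hT] at h1 h2
    have h1' : |x - X| ≤ q⁻¹ * |x ^ α - T| := by
      rwa [inv_mul_eq_div, le_div_iff₀ hq0, mul_comm]
    have h2' : |1 - x ^ (α - 1) / q| ≤ X⁻¹ * q⁻¹ * |x ^ α - T| := by
      rw [one_sub_div hq0.ne', abs_div, abs_of_pos hq0, abs_sub_comm, div_eq_inv_mul,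
        mul_comm X⁻¹, mul_assoc]
      gcongr
      rwa [inv_mul_eq_div, le_div_iff₀ hX, mul_comm]
    have hk : |F.hilbertSnd X v| ≤ C * (1 + v ^ 2)⁻¹ := by
      refine (hdec X v).trans ?_
      gcongr
      exact mul_le_of_le_one_right hC (inv_le_one_of_one_le₀ (by nlinarith [sq_nonneg X]))
    have hone : 1 ≤ (1 + b ^ 2) * (1 + x ^ 2)⁻¹ := by
      rw [← div_eq_mul_inv, one_le_div (by positivity)]
      gcongr
    calc |F.hilbertSnd x v - shearWeight α X x * F.hilbertSnd X v|
        = |(F.hilbertSnd x v - F.hilbertSnd X v) + (1 - x ^ (α - 1) / q) * F.hilbertSnd X v| := by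
          rw [hw]
          ring_nf
      _ ≤ |F.hilbertSnd x v - F.hilbertSnd X v| + |1 - x ^ (α - 1) / q| * |F.hilbertSnd X v| := by
          rw [← abs_mul]
          exact abs_add_le _ _
      _ ≤ C * (q⁻¹ * |x ^ α - T|) * (1 + v ^ 2)⁻¹ +
          X⁻¹ * q⁻¹ * |x ^ α - T| * (C * (1 + v ^ 2)⁻¹) := by
          gcongr
          exact (hlip x X v).trans (by gcongr)
      _ = |x ^ α - T| * (C * (q⁻¹ + X⁻¹ * q⁻¹) * 1) * (1 + v ^ 2)⁻¹ := by ring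
      _ ≤ |x ^ α - T| * (C * (q⁻¹ + X⁻¹ * q⁻¹) * ((1 + b ^ 2) * (1 + x ^ 2)⁻¹)) *
          (1 + v ^ 2)⁻¹ := by gcongr
      _ = |x ^ α - T| * (C * (q⁻¹ + X⁻¹ * q⁻¹) * (1 + b ^ 2) * (1 + x ^ 2)⁻¹) *
          (1 + v ^ 2)⁻¹ := by ring
      _ ≤ |x ^ α - T| * ((C * (q⁻¹ + X⁻¹ * q⁻¹) * (1 + b ^ 2) + C * T⁻¹) * (1 + x ^ 2)⁻¹) *
          (1 + v ^ 2)⁻¹ := by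
          gcongr
          exact le_add_of_nonneg_right (by positivity)
  · have hw : shearWeight α X x = 0 := by
      unfold shearWeight
      exact Set.indicator_of_notMem (fun h => hxb h.2) _
    push Not at hxb
    have hlarge : T ≤ |x ^ α - T| := by
      have h1 : b ^ α ≤ x ^ α := Real.rpow_le_rpow hb0 hxb.le (by linarith)
      rw [shearEndpoint_rpow hα hX] at h1
      exact (by linarith : T ≤ x ^ α - T).trans (le_abs_self _)
    rw [hw, zero_mul, sub_zero]
    calc |F.hilbertSnd x v| ≤ C * (1 + x ^ 2)⁻¹ * (1 + v ^ 2)⁻¹ := hdec x v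
      _ = T * (C * T⁻¹ * (1 + x ^ 2)⁻¹) * (1 + v ^ 2)⁻¹ := by field_simp
      _ ≤ |x ^ α - T| * ((C * (q⁻¹ + X⁻¹ * q⁻¹) * (1 + b ^ 2) + C * T⁻¹) * (1 + x ^ 2)⁻¹) *
          (1 + v ^ 2)⁻¹ := by
          gcongr
          exact le_add_of_nonneg_left (by positivity)

lemma integral_hilbertSnd_sub_shear (F : 𝓢(ℝ × ℝ, ℝ)) {α X : ℝ} (hα : 1 < α) (hX : 0 < X) (y : ℝ) :
    Integrable (fun s => ∫ x in Set.Ioi 0, (F.hilbertSnd x (y + s * (x ^ α - X ^ α)) -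
      shearWeight α X x * F.hilbertSnd X (y + s * (x ^ α - X ^ α)))) ∧
    ∫ s, ∫ x in Set.Ioi 0, (F.hilbertSnd x (y + s * (x ^ α - X ^ α)) -
      shearWeight α X x * F.hilbertSnd X (y + s * (x ^ α - X ^ α))) = 0 := by
  obtain ⟨K, hK⟩ := F.exists_abs_hilbertSnd_sub_le hα hX
  have hD : Measurable (Function.uncurry fun x v =>
      F.hilbertSnd x v - shearWeight α X x * F.hilbertSnd X v) :=
    F.measurable_hilbertSnd.sub (((measurable_shearWeight α X).comp measurable_fst).mul
      ((F.continuous_hilbertSnd X).measurable.comp measurable_snd))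
  have hφ : Measurable fun x : ℝ => x ^ α - X ^ α := (measurable_id.pow_const α).sub_const _
  have hM : IntegrableOn (fun x : ℝ => K * (1 + x ^ 2)⁻¹) (Set.Ioi 0) :=
    (integrable_inv_one_add_sq.const_mul K).integrableOn
  have hbound := (ae_restrict_iff' measurableSet_Ioi).2 (ae_of_all volume hK)
  have hφ0 := ae_rpow_sub_ne_zero hα hX
  refine ⟨(integrable_shear_prod hD hφ hM hφ0 hbound y).integral_prod_right,
    integral_integral_shear_eq_zero hD hφ hM hφ0 hbound (fun x => ?_) y⟩
  rw [integral_sub (F.integrable_hilbertSnd x) ((F.integrable_hilbertSnd X).const_mul _),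
    integral_const_mul, F.integral_hilbertSnd_eq_zero, F.integral_hilbertSnd_eq_zero]
  simp

lemma continuous_weight_mul_hilbertSnd (F : 𝓢(ℝ × ℝ, ℝ)) {α : ℝ} (hα : 1 < α) (X y s : ℝ) :
    Continuous fun x : ℝ =>
      x ^ (α - 1) / X ^ (α - 1) * F.hilbertSnd X (y + s * (x ^ α - X ^ α)) := by
  refine ((Real.continuous_rpow_const (by linarith)).div_const _).mul
    ((F.continuous_hilbertSnd X).comp ?_)
  exact continuous_const.add (continuous_const.mul
    ((Real.continuous_rpow_const (by linarith)).sub continuous_const))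

lemma shearWeight_mul_eq_indicator (F : 𝓢(ℝ × ℝ, ℝ)) (α X y s : ℝ) :
    (fun x => shearWeight α X x * F.hilbertSnd X (y + s * (x ^ α - X ^ α))) =
      Set.indicator (Set.Ioc 0 (shearEndpoint α X)) fun x =>
        x ^ (α - 1) / X ^ (α - 1) * F.hilbertSnd X (y + s * (x ^ α - X ^ α)) :=
  funext fun x => by
    simp only [shearWeight, Set.indicator_apply, ite_mul, zero_mul]

lemma integrableOn_shearWeight_mul (F : 𝓢(ℝ × ℝ, ℝ)) {α : ℝ} (hα : 1 < α) (X y s : ℝ) :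
    IntegrableOn (fun x => shearWeight α X x * F.hilbertSnd X (y + s * (x ^ α - X ^ α)))
      (Set.Ioi 0) := by
  rw [shearWeight_mul_eq_indicator]
  exact ((F.continuous_weight_mul_hilbertSnd hα X y s).integrableOn_Ioc.integrable_indicator
    measurableSet_Ioc).integrableOn

lemma integral_shearWeight_mul (F : 𝓢(ℝ × ℝ, ℝ)) {α X : ℝ} (hα : 1 < α) (hX : 0 < X) (y : ℝ) {s : ℝ}
    (hs : s ≠ 0) :
    ∫ x in Set.Ioi 0, shearWeight α X x * F.hilbertSnd X (y + s * (x ^ α - X ^ α)) =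
      (α * X ^ (α - 1))⁻¹ * (s⁻¹ * (hilbertInt (fun w => F (X, w)) (y + s * X ^ α) -
        hilbertInt (fun w => F (X, w)) (y - s * X ^ α))) := by
  set L := hilbertInt fun w => F (X, w) with hL
  have hb := shearEndpoint_nonneg α hX
  have hcont := F.continuous_weight_mul_hilbertSnd hα X y s
  have hα0 : α ≠ 0 := by linarith
  have hq := (Real.rpow_pos_of_pos hX (α - 1)).ne'
  have hderiv : ∀ x : ℝ, HasDerivAt
      (fun x => (α * X ^ (α - 1))⁻¹ * (s⁻¹ * L (y + s * (x ^ α - X ^ α))))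
      (x ^ (α - 1) / X ^ (α - 1) * F.hilbertSnd X (y + s * (x ^ α - X ^ α))) x := by
    intro x
    have h1 := (((Real.hasDerivAt_rpow_const (x := x) (Or.inr hα.le)).sub_const
      (X ^ α)).const_mul s).const_add y
    have h2 := (((F.hasDerivAt_hilbertInt_slice X _).comp x h1).const_mul s⁻¹).const_mul
      (α * X ^ (α - 1))⁻¹
    refine h2.congr_deriv ?_
    field_simp
  rw [shearWeight_mul_eq_indicator, setIntegral_indicator measurableSet_Ioc,
    Set.inter_eq_right.2 Set.Ioc_subset_Ioi_self, ← intervalIntegral.integral_of_le hb,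
    intervalIntegral.integral_eq_sub_of_hasDerivAt (fun x _ => hderiv x)
      (hcont.intervalIntegrable _ _), shearEndpoint_rpow hα hX, Real.zero_rpow hα0, ← mul_sub,
    ← mul_sub]
  congr 4 <;> ring

lemma integrableOn_hilbertSnd_shear (F : 𝓢(ℝ × ℝ, ℝ)) (α X y s : ℝ) :
    IntegrableOn (fun x => F.hilbertSnd x (y + s * (x ^ α - X ^ α))) (Set.Ioi 0) := by
  obtain ⟨C, hC, hdec, -⟩ := F.exists_hilbertSnd_bound
  have hmeas : Measurable fun x : ℝ => F.hilbertSnd x (y + s * (x ^ α - X ^ α)) :=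
    F.measurable_hilbertSnd.comp (measurable_id.prodMk
      ((((measurable_id.pow_const α).sub_const _).const_mul s).const_add y))
  refine Integrable.integrableOn ((integrable_inv_one_add_sq.const_mul C).mono'
    hmeas.aestronglyMeasurable (ae_of_all _ fun x => (hdec x _).trans ?_))
  refine mul_le_of_le_one_right (by positivity) (inv_le_one_of_one_le₀ ?_)
  exact le_add_of_nonneg_right (sq_nonneg _)

/-- Integrating the transformed derivative over all shears recovers the function. -/
lemma integral_integral_hilbertSnd_shear (F : 𝓢(ℝ × ℝ, ℝ)) {α X : ℝ} (hα : 1 < α) (hX : 0 < X)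
    (y : ℝ) :
    ∫ s, ∫ x in Set.Ioi 0, F.hilbertSnd x (y + s * (x ^ α - X ^ α)) =
      2 * Real.pi ^ 2 / (α * X ^ (α - 1)) * F (X, y) := by
  obtain ⟨hint, hzero⟩ := F.integral_hilbertSnd_sub_shear hα hX y
  obtain ⟨C, hC, hdec, hlip⟩ := F.exists_hilbertInt_slice_bound X
  obtain ⟨_, -, hF, -⟩ := F.exists_decayLip
  have hT := Real.rpow_pos_of_pos hX α
  have hint' := (integrable_inv_mul_sub_comp hC (measurable_hilbertInt_slice (hF X).continuous)
    hdec hlip y hT).const_mul (α * X ^ (α - 1))⁻¹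
  have hsplit : ∀ᵐ s : ℝ, ∫ x in Set.Ioi 0, F.hilbertSnd x (y + s * (x ^ α - X ^ α)) =
      (∫ x in Set.Ioi 0, (F.hilbertSnd x (y + s * (x ^ α - X ^ α)) -
        shearWeight α X x * F.hilbertSnd X (y + s * (x ^ α - X ^ α)))) +
      (α * X ^ (α - 1))⁻¹ * (s⁻¹ * (hilbertInt (fun w => F (X, w)) (y + s * X ^ α) -
        hilbertInt (fun w => F (X, w)) (y - s * X ^ α))) := by
    filter_upwards [compl_mem_ae_iff.2 (measure_singleton (0 : ℝ))] with s hs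
    rw [integral_sub (F.integrableOn_hilbertSnd_shear α X y s)
      (F.integrableOn_shearWeight_mul hα X y s), F.integral_shearWeight_mul hα hX y hs]
    ring
  rw [integral_congr_ae hsplit, integral_add hint hint', hzero, integral_const_mul,
    integral_inv_mul_sub_eq _ y hT, F.hilbertInt_hilbertInt_slice]
  ring

lemma hasDerivAt_integral_comp_curve (F : 𝓢(ℝ × ℝ, ℝ)) {r : ℝ → ℝ} (hr : Continuous r) (u : ℝ) :
    HasDerivAt (fun u => ∫ x, F (x, r x + u))
      (∫ x, (∂_{((0 : ℝ), (1 : ℝ))} F : 𝓢(ℝ × ℝ, ℝ)) (x, r x + u)) u := by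
  obtain ⟨C, hC, h, -⟩ := F.exists_decayLip
  obtain ⟨C', hC', h', -⟩ := (∂_{((0 : ℝ), (1 : ℝ))} F : 𝓢(ℝ × ℝ, ℝ)).exists_decayLip
  have hcurve : ∀ (G : 𝓢(ℝ × ℝ, ℝ)) (t : ℝ), Continuous fun x => G (x, r x + t) := fun G t =>
    G.continuous.comp (continuous_id.prodMk (hr.add_const t))
  refine (hasDerivAt_integral_of_dominated_loc_of_deriv_le
    (F' := fun t x => (∂_{((0 : ℝ), (1 : ℝ))} F : 𝓢(ℝ × ℝ, ℝ)) (x, r x + t)) univ_mem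
    (.of_forall fun t => (hcurve F t).aestronglyMeasurable)
    (integrable_comp_curve (G := fun x w => F (x, w)) F.continuous h (hr.add_const u))
    (hcurve _ u).aestronglyMeasurable (bound := fun x => C' * (1 + x ^ 2)⁻¹)
    (ae_of_all _ fun x t _ => ?_) (integrable_inv_one_add_sq.const_mul C')
    (ae_of_all _ fun x t _ => ?_)).2
  · refine ((h' x).decay _).trans (mul_le_of_le_one_right (h' x).nonneg ?_)
    exact inv_le_one_of_one_le₀ (le_add_of_nonneg_right (sq_nonneg _))
  · exact (F.hasDerivAt_snd_s13 x (r x + t)).comp_const_add (r x) t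

lemma hilbertSnd_abs {F : 𝓢(ℝ × ℝ, ℝ)} (heven : ∀ x w, F (-x, w) = F (x, w)) (x v : ℝ) :
    F.hilbertSnd |x| v = F.hilbertSnd x v := by
  have hneg : ∀ x, F.hilbertSnd (-x) v = F.hilbertSnd x v := fun x => by
    unfold hilbertSnd
    congr 1
    funext w
    refine (F.hasDerivAt_snd_s13 (-x) w).unique ?_
    simpa only [heven] using F.hasDerivAt_snd_s13 x w
  rcases abs_choice x with h | h <;> rw [h]
  exact hneg x

lemma pv_deriv_integral_eq {F : 𝓢(ℝ × ℝ, ℝ)} (heven : ∀ x w, F (-x, w) = F (x, w)) {α : ℝ}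
    (hα : 1 < α) (X y s : ℝ) :
    pv (fun u => deriv (fun u' => ∫ x, F (x, s * |x| ^ α + u')) u / (y - s * X ^ α - u))
      (y - s * X ^ α) =
      2 * ∫ x in Set.Ioi 0, F.hilbertSnd x (y + s * (x ^ α - X ^ α)) := by
  have hr : Continuous fun x : ℝ => s * |x| ^ α :=
    continuous_const.mul (continuous_abs.rpow_const fun _ => Or.inr (by linarith))
  obtain ⟨_, -, h', -⟩ := (∂_{((0 : ℝ), (1 : ℝ))} F : 𝓢(ℝ × ℝ, ℝ)).exists_decayLip
  simp only [(F.hasDerivAt_integral_comp_curve hr _).deriv]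
  rw [pv_integral_comp_curve
    (G := fun x w => (∂_{((0 : ℝ), (1 : ℝ))} F : 𝓢(ℝ × ℝ, ℝ)) (x, w))
    (SchwartzMap.continuous _) h' hr,
    ← integral_comp_abs]
  refine integral_congr_ae (ae_of_all _ fun x => ?_)
  simp only [hilbertSnd_abs heven]
  unfold hilbertSnd
  congr 1
  ring

end SchwartzMap

/-- Inversion formula for the generalized parabolic Radon transform `P_α`. -/
theorem Palpha_inversion (α c : ℝ) (hα : 1 < α) (m : ℕ) (hm : (m : ℝ) ≥ α - 2)
    (f : SchwartzMap (ℝ × ℝ) ℝ)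
    (hsym : ∀ x y : ℝ, f (x + c, y) = f (-x + c, y))
    (hvan : ∀ k ≤ m, ∀ y : ℝ, iteratedDeriv k (fun x : ℝ => f (x, y)) c = 0)
    (P : ℝ → ℝ → ℝ)
    (hP : ∀ s u : ℝ, P s u = ∫ x : ℝ, f (x + c, s * |x| ^ α + u)) :
    ∀ x y : ℝ, x ≠ c →
      f (x, y) = α * |x - c| ^ (α - 1) / (4 * Real.pi ^ 2) *
        ∫ s : ℝ, pv
          (fun u : ℝ => deriv (fun u' : ℝ => P s u') u / (y - s * |x - c| ^ α - u))
          (y - s * |x - c| ^ α) := by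
  intro x y hxc
  set F := f.compSubConstCLM ℝ ((-c, 0) : ℝ × ℝ) with hFdef
  have hF : ∀ x w, F (x, w) = f (x + c, w) := fun x w => by
    simp [hFdef]
  have heven : ∀ x w, F (-x, w) = F (x, w) := fun x w => by
    rw [hF, hF, hsym x w]
  have hX : 0 < |x - c| := abs_pos.2 (sub_ne_zero.2 hxc)
  have hFx : F (|x - c|, y) = f (x, y) := by
    rcases abs_choice (x - c) with h | h <;> rw [h]
    · rw [hF, sub_add_cancel]
    · rw [heven, hF, sub_add_cancel]
  simp only [hP, ← hF]
  simp only [SchwartzMap.pv_deriv_integral_eq heven hα]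
  rw [integral_const_mul, F.integral_integral_hilbertSnd_shear hα hX, hFx]
  have hq := Real.rpow_pos_of_pos hX (α - 1)
  have hα0 : 0 < α := by linarith
  field_simp
  ring
end
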